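/- Let n be an integer with at least three distinct prime divisors, let ν(n) be the number of distinct prime divisors of n, suppose that n is not equal to 6p or 10p for any prime p, and suppose moreover that gcd(n,6) = 1. Let q be a prime power and let G be a group with SL_n(q) ≤ G ≤ GL_n(q). Then ⌊(n+6)/12⌋ + φ(12,1,3n) + φ(12,0,n) + ν(n) ≤ κ(G). -/

import Mathlib

/-- `k` classes of proper subgroups whose conjugates cover `G`. -/
def IsNormalCover (G : Type*) [Group G] (k : ℕ) : Prop :=
  ∃ H : Fin k → Subgroup G, (∀ i, H i ≠ ⊤) ∧
    ∀ g : G, ∃ i : Fin k, ∃ x : G, x * g * x⁻¹ ∈ H i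

/-- `γ(G)`: the least number of conjugacy classes of proper subgroups needed to cover `G`. -/
noncomputable def gammaCover (G : Type*) [Group G] : ℕ := sInf {k | IsNormalCover G k}

/-- A set of conjugacy classes is independent if any pair of elements from two distinct
classes of the set generates `G`. -/
def IsIndependentClasses (G : Type*) [Group G] (S : Finset (ConjClasses G)) : Prop :=
  ∀ c ∈ S, ∀ d ∈ S, c ≠ d → ∀ x ∈ c.carrier, ∀ y ∈ d.carrier,
    Subgroup.closure {x, y} = ⊤

/-- `κ(G)`: the size of the largest independent set of conjugacy classes of `G`. -/
noncomputable def kappaIndep (G : Type*) [Group G] : ℕ :=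
  sSup {k | ∃ S : Finset (ConjClasses G), S.card = k ∧ IsIndependentClasses G S}

/-- `ν(n)`: the number of distinct prime divisors of `n`. -/
def nuPrimes (n : ℕ) : ℕ := n.primeFactors.card

/-- Lehmer's partial totient `φ(k, t, n)`: the number of integers `x` coprime to `n`
with `n t / k < x < n (t+1) / k`. -/
def partialTotient (k t n : ℕ) : ℕ :=
  ((Finset.range (n * (t + 1) + 1)).filter
    (fun x => Nat.Coprime x n ∧ (n * t : ℚ) / k < (x : ℚ) ∧ (x : ℚ) < (n * (t + 1) : ℚ) / k)).card

/-- The copy of `SL_n(F)` inside `GL_n(F)`. -/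
def SLinGL (n : ℕ) (F : Type*) [Field F] : Subgroup (GL (Fin n) F) :=
  (Matrix.SpecialLinearGroup.toGL (n := Fin n) (R := F)).range

open Finset in
/-- The sum of the squares of the fibre sizes counts the pairs with equal image. -/
theorem sum_card_fiber_sq {α β : Type*} [Fintype α] [Fintype β] [DecidableEq β] (f : α → β) :
    ∑ b, #{a | f a = b} ^ 2 = #{p : α × α | f p.1 = f p.2} := by
  classical
  rw [Finset.card_eq_sum_card_fiberwise (f := fun p : α × α => f p.1) (t := univ) (by simp)]
  refine Finset.sum_congr rfl fun b _ => ?_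
  rw [sq, ← Finset.card_product]
  congr 1
  ext ⟨x, y⟩
  simp only [mem_product, mem_filter, mem_univ, true_and]
  constructor
  · rintro ⟨h1, h2⟩; exact ⟨h1.trans h2.symm, h1⟩
  · rintro ⟨h1, h2⟩; exact ⟨h2, h1.symm.trans h2⟩

open Finset in
theorem card_pairs_same_cosets {K : Type*} [Field K] [Fintype K] [DecidableEq K]
    (T : Subgroup Kˣ) (Z : AddSubgroup K) [DecidableEq (K ⧸ Z)] [DecidableEq (Kˣ ⧸ T)] :
    #{p : Kˣ × Kˣ | ((p.1 : K) : K ⧸ Z) = ((p.2 : K) : K ⧸ Z) ∧ (p.1 : Kˣ ⧸ T) = (p.2 : Kˣ ⧸ T)}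
      = (Nat.card K - 1) + (Nat.card T - 1) * (Nat.card Z - 1) := by
  classical
  have hK : Nat.card K - 1 = #(univ : Finset Kˣ) := by
    rw [Nat.card_eq_fintype_card, Finset.card_univ, Fintype.card_units]
  have hT : Nat.card T - 1 = #({t : Kˣ | t ∈ T ∧ t ≠ 1} : Finset Kˣ) := by
    have : ({t : Kˣ | t ∈ T ∧ t ≠ 1} : Finset Kˣ) = ({t : Kˣ | t ∈ T} : Finset Kˣ).erase 1 := by
      ext; simp [and_comm]
    rw [this, Finset.card_erase_of_mem (by simp [T.one_mem]), Nat.card_eq_fintype_card,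
      Fintype.card_subtype]
  have hZ : Nat.card Z - 1 = #({z : K | z ∈ Z ∧ z ≠ 0} : Finset K) := by
    have : ({t : K | t ∈ Z ∧ t ≠ 0} : Finset K) = ({t : K | t ∈ Z} : Finset K).erase 0 := by
      ext; simp [and_comm]
    rw [this, Finset.card_erase_of_mem (by simp [Z.zero_mem]), Nat.card_eq_fintype_card,
      Fintype.card_subtype]
  rw [← Finset.card_filter_add_card_filter_not (fun p : Kˣ × Kˣ => p.1 = p.2), Finset.filter_filter,
    Finset.filter_filter, hK, hT, hZ, ← Finset.card_product]
  congr 1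
  · symm
    refine Finset.card_bij (fun u _ => (u, u)) (by simp) (by simp) ?_
    rintro ⟨a, b⟩ h
    simp only [mem_filter, mem_univ, true_and] at h
    exact ⟨a, mem_univ _, by rw [h.2]⟩
  · refine Finset.card_bij (fun p _ => (p.1⁻¹ * p.2, (p.2 : K) - p.1)) ?_ ?_ ?_
    · rintro ⟨a, b⟩ h
      simp only [mem_filter, mem_univ, true_and] at h
      obtain ⟨⟨h1, h2⟩, h3⟩ := h
      simp only [mem_product, mem_filter, mem_univ, true_and]
      refine ⟨⟨QuotientGroup.eq.mp h2, ?_⟩, ?_, ?_⟩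
      · intro h; exact h3 (inv_mul_eq_one.mp h)
      · have := QuotientAddGroup.eq.mp h1
        rwa [neg_add_eq_sub] at this
      · intro h; exact h3 (Units.ext (sub_eq_zero.mp h).symm)
    · rintro ⟨a, b⟩ h ⟨a', b'⟩ h' heq
      simp only [mem_filter, mem_univ, true_and] at h h'
      simp only [Prod.mk.injEq] at heq
      obtain ⟨e1, e2⟩ := heq
      obtain ⟨t, ht⟩ : ∃ t, t = a⁻¹ * b := ⟨_, rfl⟩
      rw [← ht] at e1
      have hb : b = a * t := by rw [ht]; group
      have hb' : b' = a' * t := by rw [e1]; group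
      have ht1 : (t : K) - 1 ≠ 0 := by
        intro h0
        apply h.2
        have : t = 1 := Units.ext (by simpa using sub_eq_zero.mp h0)
        rw [hb, this, mul_one]
      rw [hb, hb', Units.val_mul, Units.val_mul] at e2
      have : (a : K) = a' := by
        apply mul_right_cancel₀ ht1
        linear_combination e2
      have : a = a' := Units.ext this
      subst this
      rw [hb, hb']
    · rintro ⟨t, z⟩ h
      simp only [mem_product, mem_filter, mem_univ, true_and] at h
      obtain ⟨⟨h1, h2⟩, h3, h4⟩ := h
      have ht1 : (t : K) - 1 ≠ 0 := by
        intro h0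
        exact h2 (Units.ext (by simpa using sub_eq_zero.mp h0))
      let u : Kˣ := Units.mk0 (z / ((t : K) - 1)) (div_ne_zero h4 ht1)
      have hz : ((u * t : Kˣ) : K) - u = z := by
        simp only [u, Units.val_mul, Units.val_mk0]; field_simp
      refine ⟨(u, u * t), ?_, ?_⟩
      · simp only [mem_filter, mem_univ, true_and]
        refine ⟨⟨QuotientAddGroup.eq.mpr ?_, QuotientGroup.eq.mpr ?_⟩, ?_⟩
        · rw [neg_add_eq_sub, hz]; exact h3
        · simpa using h1
        · simpa using h2
      · simpa using hz

open Finset in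
/-- Cosets of an additive subgroup of a finite field are well distributed among the cosets of a
multiplicative subgroup: few of them can meet some multiplicative coset in at most one point. -/
theorem card_cosets_meeting_once_le {K : Type*} [Field K] [Finite K]
    (T : Subgroup Kˣ) (g : ℕ) (hT : g * Nat.card T + 1 = Nat.card K) (Z : AddSubgroup K)
    (C : Finset (K ⧸ Z)) (w : K ⧸ Z → Kˣ)
    (hC : ∀ c ∈ C, ∀ t ∈ T, ∀ t' ∈ T, ((w c * t : Kˣ) : K) = c → ((w c * t' : Kˣ) : K) = c → t = t')
    (hg : g ≤ Nat.card Z) :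
    (#C : ℤ) * ((Nat.card Z : ℤ) - g) ^ 2 ≤ (g : ℤ) ^ 2 * Nat.card K := by
  classical
  have := Fintype.ofFinite K
  have := Fintype.ofFinite (K ⧸ Z)
  have := Fintype.ofFinite (Kˣ ⧸ T)
  let f : Kˣ → (K ⧸ Z) × (Kˣ ⧸ T) := fun u => (((u : K) : K ⧸ Z), (u : Kˣ ⧸ T))
  let N : (K ⧸ Z) × (Kˣ ⧸ T) → ℤ := fun p => (#{u | f u = p} : ℕ)
  have hTpos : 0 < Nat.card T := Nat.card_pos
  have hZpos : 0 < Nat.card Z := Nat.card_pos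
  have hKpos : 0 < Nat.card K := Nat.card_pos
  have hZK : Nat.card (K ⧸ Z) * Nat.card Z = Nat.card K := by
    rw [AddSubgroup.card_eq_card_quotient_mul_card_addSubgroup Z]
  have hTK : Nat.card (Kˣ ⧸ T) = g := by
    have h1 := Subgroup.card_eq_card_quotient_mul_card_subgroup T
    rw [Nat.card_units] at h1
    have h2 : Nat.card K - 1 = g * Nat.card T := by omega
    rw [h2] at h1
    exact (Nat.eq_of_mul_eq_mul_right hTpos h1).symm
  have hs1 : ∑ p, N p = (Nat.card K : ℤ) - 1 := by
    have : ∑ p, (#{u | f u = p} : ℕ) = #(univ : Finset Kˣ) :=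
      (Finset.card_eq_sum_card_fiberwise (f := f) (t := univ) (by simp)).symm
    rw [Finset.card_univ, Fintype.card_units, ← Nat.card_eq_fintype_card] at this
    have h2 : ((∑ p, (#{u | f u = p} : ℕ) : ℕ) : ℤ) = ((Nat.card K - 1 : ℕ) : ℤ) := by rw [this]
    rw [Nat.cast_sub hKpos] at h2
    push_cast at h2
    exact h2
  have hs2 : ∑ p, N p ^ 2
      = ((Nat.card K : ℤ) - 1) + ((Nat.card T : ℤ) - 1) * ((Nat.card Z : ℤ) - 1) := by
    have h1 := sum_card_fiber_sq f
    have h2 := card_pairs_same_cosets T Z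
    have h3 : #{p : Kˣ × Kˣ | f p.1 = f p.2} = (Nat.card K - 1) + (Nat.card T - 1) *
        (Nat.card Z - 1) := by
      rw [← h2]; congr 1; ext p; simp [f]
    rw [h3] at h1
    have h4 : ((∑ p, (#{u | f u = p} : ℕ) ^ 2 : ℕ) : ℤ)
      = (((Nat.card K - 1) + (Nat.card T - 1) * (Nat.card Z - 1) : ℕ) : ℤ) := by rw [h1]
    push_cast [Nat.cast_sub hKpos, Nat.cast_sub hTpos, Nat.cast_sub hZpos] at h4
    exact h4
  have hcard : (Fintype.card ((K ⧸ Z) × (Kˣ ⧸ T)) : ℤ) * Nat.card Z = g * Nat.card K := by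
    rw [Fintype.card_prod, ← Nat.card_eq_fintype_card, ← Nat.card_eq_fintype_card, hTK, ← hZK]
    push_cast; ring
  have hsum : ∑ p, ((g : ℤ) * N p - Nat.card Z) ^ 2
      = (g : ℤ) ^ 2 * (((Nat.card K : ℤ) - 1) + ((Nat.card T : ℤ) - 1) * ((Nat.card Z : ℤ) - 1))
        - 2 * g * Nat.card Z * ((Nat.card K : ℤ) - 1) + g * Nat.card K * Nat.card Z := by
    have : ∀ p, ((g : ℤ) * N p - Nat.card Z) ^ 2
      = (g : ℤ) ^ 2 * N p ^ 2 - 2 * g * Nat.card Z * N p + (Nat.card Z : ℤ) ^ 2 := fun p => by ring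
    simp_rw [this]
    rw [Finset.sum_add_distrib, Finset.sum_sub_distrib, ← Finset.mul_sum, ← Finset.mul_sum, hs1,
      hs2,
      Finset.sum_const, Finset.card_univ, nsmul_eq_mul, ← hcard]
    ring
  have hle : ∑ c ∈ C, ((Nat.card Z : ℤ) - g) ^ 2 ≤ ∑ p, ((g : ℤ) * N p - Nat.card Z) ^ 2 := by
    calc ∑ c ∈ C, ((Nat.card Z : ℤ) - g) ^ 2
        ≤ ∑ c ∈ C, ((g : ℤ) * N (c, (w c : Kˣ ⧸ T)) - Nat.card Z) ^ 2 := by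
          refine Finset.sum_le_sum fun c hc => ?_
          have h1 : #{u | f u = (c, (w c : Kˣ ⧸ T))} ≤ 1 := by
            rw [Finset.card_le_one]
            intro a ha b hb
            simp only [f, mem_filter, mem_univ, true_and, Prod.mk.injEq] at ha hb
            have ha2 := QuotientGroup.eq.mp ha.2.symm
            have hb2 := QuotientGroup.eq.mp hb.2.symm
            have := hC c hc _ ha2 _ hb2 (by simpa using ha.1) (by simpa using hb.1)
            exact mul_left_cancel this
          have h2 : N (c, (w c : Kˣ ⧸ T)) ≤ 1 := by simp only [N]; exact_mod_cast h1
          have h0 : 0 ≤ N (c, (w c : Kˣ ⧸ T)) := by positivity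
          have hgZ : (g : ℤ) ≤ Nat.card Z := by exact_mod_cast hg
          have hg0 : (0 : ℤ) ≤ g := by positivity
          have : (g : ℤ) * N (c, (w c : Kˣ ⧸ T)) ≤ g := by nlinarith
          nlinarith
      _ = ∑ p ∈ C.image (fun c => (c, (w c : Kˣ ⧸ T))), ((g : ℤ) * N p - Nat.card Z) ^ 2 := by
          rw [Finset.sum_image]
          intro a _ b _ h
          exact (Prod.mk.inj h).1
      _ ≤ _ := Finset.sum_le_sum_of_subset_of_nonneg (Finset.subset_univ _)
        (fun _ _ _ => sq_nonneg _)
  rw [Finset.sum_const, nsmul_eq_mul, hsum] at hle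
  have hT' : (g : ℤ) * Nat.card T = Nat.card K - 1 := by
    have : ((g * Nat.card T + 1 : ℕ) : ℤ) = Nat.card K := by rw [hT]
    push_cast at this; linarith
  have hexp : (g : ℤ) ^ 2 * (((Nat.card K : ℤ) - 1) + ((Nat.card T : ℤ) - 1) *
      ((Nat.card Z : ℤ) - 1))
        - 2 * g * Nat.card Z * ((Nat.card K : ℤ) - 1) + g * Nat.card K * Nat.card Z
      = (g : ℤ) ^ 2 * Nat.card K - g * (g - 1) * Nat.card Z - g * (Nat.card K - 1) := by
    linear_combination (g : ℤ) * ((Nat.card Z : ℤ) - 1) * hT'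
  rw [hexp] at hle
  have hg1 : 0 ≤ (g : ℤ) * (g - 1) := by
    rcases Nat.eq_zero_or_pos g with h | h
    · simp [h]
    · have : (1 : ℤ) ≤ g := by exact_mod_cast h
      nlinarith
  have : (1 : ℤ) ≤ Nat.card K := by exact_mod_cast hKpos
  have h5 : 0 ≤ (g : ℤ) * (Nat.card K - 1) := by
    apply mul_nonneg <;> [positivity; linarith]
  nlinarith [mul_nonneg hg1 (Nat.cast_nonneg (α := ℤ) (Nat.card Z))]

/-- A decomposition of the space `V` as `im ι ⊕ ker π`, with `im ι` identified with the field
`K`. -/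
structure FieldSplit (F K V : Type*) [Field F] [Field K] [Algebra F K] [AddCommGroup V]
    [Module F V] where
  ι : K →ₗ[F] V
  π : V →ₗ[F] K
  proj : ∀ k, π (ι k) = k

namespace FieldSplit

variable {F K V : Type*} [Field F] [Field K] [Algebra F K] [AddCommGroup V] [Module F V]

@[ext]
theorem ext_iota_pi {s t : FieldSplit F K V} (h1 : s.ι = t.ι) (h2 : s.π = t.π) : s = t := by
  cases s; cases t; simp_all

/-- The summand identified with `K`. -/
def W (s : FieldSplit F K V) : Submodule F V := LinearMap.range s.ι

/-- The complementary summand. -/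
def U (s : FieldSplit F K V) : Submodule F V := LinearMap.ker s.π

theorem mem_U {s : FieldSplit F K V} {v : V} : v ∈ s.U ↔ s.π v = 0 := LinearMap.mem_ker

theorem iota_mem_W (s : FieldSplit F K V) (k : K) : s.ι k ∈ s.W := ⟨k, rfl⟩

theorem mem_W {s : FieldSplit F K V} {v : V} : v ∈ s.W ↔ s.ι (s.π v) = v := by
  constructor
  · rintro ⟨k, rfl⟩; rw [s.proj]
  · intro h; exact ⟨_, h⟩

theorem iota_injective (s : FieldSplit F K V) : Function.Injective s.ι :=
  Function.LeftInverse.injective s.proj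

theorem sub_iota_mem_U (s : FieldSplit F K V) (v : V) : v - s.ι (s.π v) ∈ s.U := by
  rw [mem_U, map_sub, s.proj, sub_self]

theorem eq_zero_of_mem {s : FieldSplit F K V} {v : V} (h1 : v ∈ s.W) (h2 : v ∈ s.U) : v = 0 := by
  rw [mem_W, mem_U.mp h2, map_zero] at h1
  exact h1.symm

theorem isCompl (s : FieldSplit F K V) : IsCompl s.W s.U := by
  refine ⟨Submodule.disjoint_def.mpr fun v h1 h2 => eq_zero_of_mem h1 h2, ?_⟩
  rw [codisjoint_iff, eq_top_iff]
  intro v _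
  rw [Submodule.mem_sup]
  exact ⟨s.ι (s.π v), s.iota_mem_W _, _, s.sub_iota_mem_U v, by abel⟩

/-- Multiplication by `t` on the summand `K`, identity on the complement. -/
def B (s : FieldSplit F K V) : Kˣ →* (V ≃ₗ[F] V) where
  toFun t :=
    { toFun := fun v => v + s.ι (((t : K) - 1) * s.π v)
      map_add' := fun v w => by simp only [map_add, mul_add]; abel
      map_smul' := fun c v => by simp [smul_add]
      invFun := fun v => v + s.ι ((((t⁻¹ : Kˣ) : K) - 1) * s.π v)
      left_inv := fun v => by
        simp only [map_add, s.proj]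
        rw [add_assoc, ← map_add]
        have : ((t : K) - 1) * s.π v + (((t⁻¹ : Kˣ) : K) - 1) * (s.π v + ((t : K) - 1) * s.π v) =
            0 := by
          have := t.inv_mul
          linear_combination s.π v * this
        rw [this]; simp
      right_inv := fun v => by
        simp only [map_add, s.proj]
        rw [add_assoc, ← map_add]
        have : (((t⁻¹ : Kˣ) : K) - 1) * s.π v + ((t : K) - 1) *
            (s.π v + (((t⁻¹ : Kˣ) : K) - 1) * s.π v) = 0 := by
          have := t.inv_mul
          linear_combination s.π v * this
        rw [this]; simp }
  map_one' := by ext v; simp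
  map_mul' t u := by
    ext v
    change v + s.ι ((((t * u : Kˣ) : K) - 1) * s.π v) = (v + s.ι (((u : K) - 1) * s.π v))
      + s.ι (((t : K) - 1) * s.π (v + s.ι (((u : K) - 1) * s.π v)))
    rw [map_add s.π, s.proj, add_assoc, ← map_add s.ι]
    congr 2
    push_cast; ring

theorem B_apply (s : FieldSplit F K V) (t : Kˣ) (v : V) :
    s.B t v = v + s.ι (((t : K) - 1) * s.π v) := rfl

theorem pi_B (s : FieldSplit F K V) (t : Kˣ) (v : V) : s.π (s.B t v) = t * s.π v := by
  rw [B_apply, map_add, s.proj]; ring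

theorem B_iota (s : FieldSplit F K V) (t : Kˣ) (k : K) : s.B t (s.ι k) = s.ι (t * k) := by
  rw [B_apply, s.proj, ← map_add]; congr 1; ring

theorem B_of_mem_U {s : FieldSplit F K V} (t : Kˣ) {v : V} (hv : v ∈ s.U) : s.B t v = v := by
  rw [B_apply, mem_U.mp hv, mul_zero, map_zero, add_zero]

/-- Transport of a decomposition by an automorphism of the space. -/
def conj (g : V ≃ₗ[F] V) (s : FieldSplit F K V) : FieldSplit F K V where
  ι := g.toLinearMap ∘ₗ s.ι
  π := s.π ∘ₗ g.symm.toLinearMap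
  proj k := by simp [s.proj]

@[simp] theorem conj_iota (g : V ≃ₗ[F] V) (s : FieldSplit F K V) (k : K) :
    (s.conj g).ι k = g (s.ι k) := rfl

@[simp] theorem conj_pi (g : V ≃ₗ[F] V) (s : FieldSplit F K V) (v : V) :
    (s.conj g).π v = s.π (g.symm v) := rfl

theorem conj_one (s : FieldSplit F K V) : s.conj 1 = s := rfl

theorem conj_conj (g h : V ≃ₗ[F] V) (s : FieldSplit F K V) :
    (s.conj h).conj g = s.conj (g * h) := rfl

theorem mem_conj_W {g : V ≃ₗ[F] V} {s : FieldSplit F K V} {v : V} :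
    v ∈ (s.conj g).W ↔ g.symm v ∈ s.W := by
  rw [mem_W, mem_W, conj_pi, conj_iota, LinearEquiv.eq_symm_apply]

theorem mem_conj_U {g : V ≃ₗ[F] V} {s : FieldSplit F K V} {v : V} :
    v ∈ (s.conj g).U ↔ g.symm v ∈ s.U := Iff.rfl

theorem conj_W (g : V ≃ₗ[F] V) (s : FieldSplit F K V) :
    (s.conj g).W = s.W.map g.toLinearMap := by
  ext v
  rw [mem_conj_W, Submodule.mem_map]
  constructor
  · intro h; exact ⟨_, h, by simp⟩
  · rintro ⟨w, h, rfl⟩; simpa using h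

theorem conj_U (g : V ≃ₗ[F] V) (s : FieldSplit F K V) :
    (s.conj g).U = s.U.map g.toLinearMap := by
  ext v
  rw [mem_conj_U, Submodule.mem_map]
  constructor
  · intro h; exact ⟨_, h, by simp⟩
  · rintro ⟨w, h, rfl⟩; simpa using h

theorem conj_B (g : V ≃ₗ[F] V) (s : FieldSplit F K V) (t : Kˣ) :
    (s.conj g).B t = g * s.B t * g⁻¹ := by
  ext v
  simp only [B_apply, LinearEquiv.mul_apply, map_add]
  congr 1
  exact (g.apply_symm_apply v).symm

theorem card_W [Finite K] (s : FieldSplit F K V) : Nat.card s.W = Nat.card K :=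
  (Nat.card_congr (LinearEquiv.ofInjective s.ι s.iota_injective).toEquiv).symm

/-- Differences `t - 1` span, so a subspace containing all `ι ((t - 1) w)` contains the image
of `ι`. -/
theorem W_le_of_forall {T : Subgroup Kˣ}
    (hspan : Submodule.span F {x : K | ∃ t ∈ T, x = (t : K) - 1} = ⊤)
    (s : FieldSplit F K V) (P : Submodule F V) {w : K} (hw : w ≠ 0)
    (h : ∀ t ∈ T, s.ι (((t : K) - 1) * w) ∈ P) : s.W ≤ P := by
  have key : ⊤ ≤ P.comap (s.ι ∘ₗ LinearMap.mulRight F w) := by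
    rw [← hspan, Submodule.span_le]
    rintro x ⟨t, ht, rfl⟩
    simpa using h t ht
  rintro v ⟨k, rfl⟩
  have := key (Submodule.mem_top (x := k / w))
  simpa [div_mul_cancel₀ _ hw] using this

theorem card_mul_card_inf_ge [Finite V] (A C : Submodule F V) :
    Nat.card A * Nat.card C ≤ Nat.card V * Nat.card (A ⊓ C : Submodule F V) := by
  classical
  have h : Nat.card (A × C) ≤ Nat.card (V × (A ⊓ C : Submodule F V)) := by
    -- fibres of addition
    let f : A × C → V := fun p => p.1 + p.2
    have hf : ∀ v : V, ∃ p0 : A × C, ∀ p, f p = v → f p0 = v := by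
      intro v
      by_cases hv : ∃ p, f p = v
      · obtain ⟨p, hp⟩ := hv; exact ⟨p, fun _ _ => hp⟩
      · exact ⟨0, fun p hp => (hv ⟨p, hp⟩).elim⟩
    choose p0 hp0 using hf
    refine Nat.card_le_card_of_injective
      (fun p : A × C => (f p, (⟨(p.1 : V) - (p0 (f p)).1, ?_⟩ : (A ⊓ C : Submodule F V)))) ?_
    · refine ⟨A.sub_mem p.1.2 (p0 (f p)).1.2, ?_⟩
      have h2 : f (p0 (f p)) = f p := hp0 (f p) p rfl
      have : (p.1 : V) - (p0 (f p)).1 = (p0 (f p)).2 - p.2 := by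
        change ((p0 (f p)).1 : V) + (p0 (f p)).2 = p.1 + p.2 at h2
        rw [sub_eq_sub_iff_add_eq_add, ← h2, add_comm]
      rw [this]
      exact C.sub_mem (p0 (f p)).2.2 p.2.2
    · rintro p p' h
      simp only [Prod.mk.injEq] at h
      obtain ⟨h1, h2⟩ := h
      have h2 := congrArg Subtype.val h2
      simp only [h1] at h2
      have h3 : (p.1 : V) = p'.1 := sub_left_injective h2
      have h4 : (p.2 : V) = p'.2 := by
        simp only [f] at h1
        rw [h3] at h1
        exact add_left_cancel h1
      exact Prod.ext (Subtype.ext h3) (Subtype.ext h4)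
  simpa [Nat.card_prod] using h

end FieldSplit

namespace FieldSplit

variable {F K V : Type*} [Field F] [Field K] [Algebra F K] [AddCommGroup V] [Module F V]

/-- The points covered by the `K`-summands of a family of decompositions. -/
def cover (J : Set (FieldSplit F K V)) : Set V := {v | ∃ s ∈ J, v ∈ s.W}

/-- `v` such that the only uncovered points of `v + W` lie in `U`. -/
def nearCover (J : Set (FieldSplit F K V)) (s : FieldSplit F K V) : Set V :=
  {v | ∀ y ∈ s.W, v + y ∉ s.U → v + y ∈ cover J}

/-- A family of decompositions closed under the dilations of its members. -/
def ClosedFamily (T : Subgroup Kˣ) (J : Set (FieldSplit F K V)) : Prop :=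
  ∀ s ∈ J, ∀ s' ∈ J, ∀ t ∈ T, s.conj (s'.B t) ∈ J

variable {T : Subgroup Kˣ} {J : Set (FieldSplit F K V)}

theorem ClosedFamily.B_mem_cover (hJ : ClosedFamily T J) {s : FieldSplit F K V} (hs : s ∈ J)
    {t : Kˣ} (ht : t ∈ T) {v : V} (hv : v ∈ cover J) : s.B t v ∈ cover J := by
  obtain ⟨r, hr, hv⟩ := hv
  refine ⟨_, hJ r hr s hs t ht, ?_⟩
  rw [mem_conj_W]; simpa using hv

theorem B_inv_B (s : FieldSplit F K V) (t : Kˣ) (v : V) : s.B t⁻¹ (s.B t v) = v := by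
  rw [← LinearEquiv.mul_apply, ← map_mul, inv_mul_cancel, map_one]; rfl

theorem B_B_inv (s : FieldSplit F K V) (t : Kˣ) (v : V) : s.B t (s.B t⁻¹ v) = v := by
  rw [← LinearEquiv.mul_apply, ← map_mul, mul_inv_cancel, map_one]; rfl

theorem ClosedFamily.B_mem_cover_iff (hJ : ClosedFamily T J) {s : FieldSplit F K V} (hs : s ∈ J)
    {t : Kˣ} (ht : t ∈ T) {v : V} : s.B t v ∈ cover J ↔ v ∈ cover J := by
  refine ⟨fun h => ?_, hJ.B_mem_cover hs ht⟩
  have := hJ.B_mem_cover hs (T.inv_mem ht) h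
  rwa [B_inv_B] at this

theorem smul_mem_cover {v : V} (c : F) (hv : v ∈ cover J) : c • v ∈ cover J := by
  obtain ⟨s, hs, h⟩ := hv
  exact ⟨s, hs, s.W.smul_mem c h⟩

/-- Arithmetic hypotheses under which a closed family is controlled by its cover. -/
structure Thick (V : Type*) (T : Subgroup Kˣ) (g M : ℕ) : Prop where
  index : g * Nat.card T + 1 = Nat.card K
  two_mul_lt : 2 * g < M
  big : Nat.card V < Nat.card K ^ 2
  main : ∀ z : ℕ, Nat.card K ^ 2 ≤ Nat.card V * z → g ≤ z ∧
    (g ^ 2 * Nat.card K * M * z : ℤ) < ((Nat.card T : ℤ) - M) * ((z : ℤ) - g) ^ 2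

theorem card_W_inf_W [Finite V] [Finite K] (s r : FieldSplit F K V) :
    Nat.card K ^ 2 ≤ Nat.card V * Nat.card (s.W ⊓ r.W : Submodule F V) := by
  have := card_mul_card_inf_ge s.W r.W
  rwa [card_W, card_W, ← sq] at this

theorem exists_ne_zero_W_inf_W [Finite V] [Finite K] (hb : Nat.card V < Nat.card K ^ 2)
    (s r : FieldSplit F K V) : ∃ v ∈ s.W, v ∈ r.W ∧ v ≠ 0 := by
  by_contra! h
  have h1 : s.W ⊓ r.W = ⊥ := by
    rw [eq_bot_iff]; intro v hv; exact h v hv.1 hv.2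
  have := card_W_inf_W s r
  rw [h1] at this
  simp at this
  omega

theorem exists_mem_W_notMem_U [Finite V] [Finite K] (hb : Nat.card V < Nat.card K ^ 2)
    (s r : FieldSplit F K V) : ∃ v ∈ s.W, v ∉ r.U := by
  obtain ⟨v, h1, h2, h3⟩ := exists_ne_zero_W_inf_W hb s r
  exact ⟨v, h1, fun h => h3 (eq_zero_of_mem h2 h)⟩

open Finset in
theorem _root_.Finset.card_le_natCard {α β : Type*} (A : Finset α) (f : α → β) (P : Set β)
    [Finite P]
    (hf : ∀ a ∈ A, f a ∈ P) (hi : ∀ a ∈ A, ∀ b ∈ A, f a = f b → a = b) : #A ≤ Nat.card P := by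
  have h : Nat.card A ≤ Nat.card P :=
    Nat.card_le_card_of_injective (fun a : A => (⟨f a, hf a a.2⟩ : P)) fun a b h =>
      Subtype.ext (hi a a.2 b b.2 (congrArg Subtype.val h))
  simpa using h

open Finset in
theorem nearCover_subset [Finite V] [Finite K] (hJ : ClosedFamily T J)
    (hspan : Submodule.span F {x : K | ∃ t ∈ T, x = (t : K) - 1} = ⊤)
    {g M : ℕ} (hT : Thick V T g M) {s r : FieldSplit F K V} (hs : s ∈ J) (hr : r ∈ J)
    (hM : Nat.card (r.W ⊓ s.U : Submodule F V) ≤ M) : nearCover J r ⊆ nearCover J s := by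
  classical
  have := Fintype.ofFinite K
  have := Fintype.ofFinite T
  intro v hv
  by_contra hns
  simp only [nearCover, Set.mem_ofPred_eq, not_forall] at hns
  obtain ⟨y, hy, hyU, hyO⟩ := hns
  -- move to a point outside `r.U`
  obtain ⟨k', hk', hkO⟩ : ∃ k', v + s.ι k' ∉ r.U ∧ v + s.ι k' ∉ cover J := by
    by_contra! hcon
    have h1 : ∀ t ∈ T, s.B t (v + y) ∈ r.U := by
      intro t ht
      by_contra hU
      have h2 : s.B t (v + y) = v + s.ι (s.π y + ((t : K) - 1) * s.π (v + y)) := by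
        rw [B_apply, map_add s.ι, mem_W.mp hy, add_assoc]
      rw [h2] at hU
      have h3 := hcon _ hU
      rw [← h2, hJ.B_mem_cover_iff hs ht] at h3
      exact hyO h3
    have h0 := h1 1 T.one_mem
    rw [map_one] at h0; change v + y ∈ r.U at h0
    have hle : s.W ≤ r.U := by
      refine s.W_le_of_forall hspan r.U (w := s.π (v + y)) (fun h => hyU (mem_U.mpr h)) ?_
      intro t ht
      have := r.U.sub_mem (h1 t ht) h0
      rwa [B_apply, add_sub_cancel_left] at this
    obtain ⟨x, hx, hx2⟩ := exists_mem_W_notMem_U hT.big s r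
    exact hx2 (hle hx)
  set p := v + s.ι k' with hp
  let ω : T → V := fun t => r.B t p
  have hωO : ∀ t, ω t ∉ cover J := fun t => by
    rw [hJ.B_mem_cover_iff hr t.2]; exact hkO
  have hωsub : ∀ t t', ω t - ω t' ∈ r.W := fun t t' => by
    simp only [ω, B_apply]
    rw [add_sub_add_left_eq_sub, ← map_sub]
    exact r.iota_mem_W _
  have hωp : ∀ t, ω t - p ∈ r.W := fun t => by
    simp only [ω, B_apply]
    rw [add_sub_cancel_left]
    exact r.iota_mem_W _
  have hωinj : Function.Injective ω := by
    intro t t' h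
    simp only [ω, B_apply] at h
    have h1 := r.iota_injective (add_left_cancel h)
    have h2 := mul_right_cancel₀ (fun h => hk' (mem_U.mpr h)) h1
    exact Subtype.ext (Units.ext (sub_left_injective h2))
  let Z : AddSubgroup K := (r.W.comap s.ι).toAddSubgroup
  have hZmem : ∀ {k}, k ∈ Z ↔ s.ι k ∈ r.W := Iff.rfl
  have hZcard : Nat.card Z = Nat.card (s.W ⊓ r.W : Submodule F V) := by
    refine Nat.card_congr (Equiv.ofBijective
      (fun z : Z => (⟨s.ι z, s.iota_mem_W _, z.2⟩ : (s.W ⊓ r.W : Submodule F V))) ⟨?_, ?_⟩)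
    · intro a b h
      exact Subtype.ext (s.iota_injective (congrArg Subtype.val h))
    · rintro ⟨x, ⟨k, rfl⟩, hx⟩
      exact ⟨⟨k, hx⟩, rfl⟩
  let col : T → K ⧸ Z := fun t => ((s.π (ω t) - k' : K) : K ⧸ Z)
  let Good : Finset T := {t | ω t ∉ s.U}
  have hbad : #({t | ¬ (ω t ∉ s.U)} : Finset T) ≤ M := by
    rcases Finset.eq_empty_or_nonempty ({t | ¬ (ω t ∉ s.U)} : Finset T) with h | ⟨t0, ht0⟩
    · rw [h]; simp
    refine le_trans ?_ hM
    refine Finset.card_le_natCard _ (fun t => ω t - ω t0) (r.W ⊓ s.U : Submodule F V) ?_ ?_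
    · intro t ht
      simp only [mem_filter, mem_univ, true_and, not_not] at ht ht0
      exact ⟨hωsub _ _, s.U.sub_mem ht ht0⟩
    · intro a _ b _ h
      exact hωinj (sub_left_injective h)
  have hsplit : Nat.card T ≤ #Good + M := by
    rw [Nat.card_eq_fintype_card, ← Finset.card_univ,
      ← Finset.card_filter_add_card_filter_not (fun t => ω t ∉ s.U)]
    exact Nat.add_le_add_left hbad _
  have hfib : #Good ≤ M * Nat.card Z * #(Good.image col) := by
    refine Finset.card_le_mul_card_image _ _ fun c hc => ?_
    obtain ⟨t0, ht0, rfl⟩ := Finset.mem_image.mp hc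
    have hcard : Nat.card (((r.W ⊓ s.U : Submodule F V) : Set V) ×ˢ (Z : Set K)) ≤
        M * Nat.card Z := by
      rw [Nat.card_congr (Equiv.Set.prod _ _), Nat.card_prod]
      exact Nat.mul_le_mul_right _ hM
    refine le_trans (Finset.card_le_natCard _
      (fun t => ((ω t - s.ι (s.π (ω t))) - (ω t0 - s.ι (s.π (ω t0))), s.π (ω t) - s.π (ω t0))) _
      ?_ ?_) hcard
    · intro t ht
      simp only [mem_filter] at ht
      have hz : s.π (ω t) - s.π (ω t0) ∈ Z := by
        have := QuotientAddGroup.eq.mp ht.2.symm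
        convert this using 1; ring
      refine ⟨⟨?_, s.U.sub_mem (s.sub_iota_mem_U _) (s.sub_iota_mem_U _)⟩, hz⟩
      rw [sub_sub_sub_comm, ← map_sub]
      exact r.W.sub_mem (hωsub _ _) hz
    · intro a _ b _ h
      simp only [Prod.mk.injEq] at h
      apply hωinj
      have h2 : s.π (ω a) = s.π (ω b) := sub_left_injective h.2
      have h1 := sub_left_injective h.1
      rw [h2] at h1
      exact sub_left_injective h1
  -- representatives of the cosets
  have hrep : ∀ c : K ⧸ Z, ∃ w : Kˣ, c ∈ Good.image col → ∃ t ∈ Good, col t = c ∧ (w : K) = s.π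
      (ω t) := by
    intro c
    by_cases hc : c ∈ Good.image col
    · obtain ⟨t, ht, rfl⟩ := Finset.mem_image.mp hc
      have h0 : s.π (ω t) ≠ 0 := fun h => (Finset.mem_filter.mp ht).2 (mem_U.mpr h)
      exact ⟨Units.mk0 _ h0, fun _ => ⟨t, ht, rfl, rfl⟩⟩
    · exact ⟨1, fun h => (hc h).elim⟩
  choose w hw using hrep
  obtain ⟨hgZ, hlt⟩ := hT.main (Nat.card Z) (by rw [hZcard]; exact card_W_inf_W s r)
  have hD := card_cosets_meeting_once_le T g hT.index Z (Good.image col) w (by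
    intro c hc
    obtain ⟨t1, ht1, rfl, hwt⟩ := hw c hc
    have aux : ∀ t ∈ T, ((w (col t1) * t : Kˣ) : K) = col t1 → s.B t (ω t1) ∈ r.U := by
      intro t ht h
      by_contra hU
      have hz : ((t : K) - 1) * s.π (ω t1) + k' ∈ Z := by
        have := QuotientAddGroup.eq.mp h.symm
        rw [Units.val_mul, hwt] at this
        convert this using 1; ring
      have hy : (ω t1 - p) + s.ι (((t : K) - 1) * s.π (ω t1) + k') ∈ r.W :=
        r.W.add_mem (hωp _) hz
      have heq : v + ((ω t1 - p) + s.ι (((t : K) - 1) * s.π (ω t1) + k')) = s.B t (ω t1) := by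
        rw [B_apply, map_add, hp]; abel
      have := hv _ hy (by rw [heq]; exact hU)
      rw [heq, hJ.B_mem_cover_iff hs ht] at this
      exact hωO _ this
    intro t ht t' ht' h h'
    have h1 := aux t ht h
    have h2 := aux t' ht' h'
    have h3 : s.B t (ω t1) - s.B t' (ω t1) ∈ r.W := by
      rw [B_apply, B_apply, add_sub_add_left_eq_sub, ← map_sub, ← sub_mul, sub_sub_sub_cancel_right]
      have e1 := QuotientAddGroup.eq.mp (h'.trans h.symm)
      rw [Units.val_mul, Units.val_mul, hwt] at e1
      have : (-(s.π (ω t1) * (t' : K)) + s.π (ω t1) * t) = ((t : K) - t') * s.π (ω t1) := by ring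
      rw [this] at e1
      exact e1
    have h4 := eq_zero_of_mem h3 (r.U.sub_mem h1 h2)
    rw [B_apply, B_apply, add_sub_add_left_eq_sub, sub_eq_zero] at h4
    have h5 := mul_right_cancel₀ (hwt ▸ (w (col t1)).ne_zero) (s.iota_injective h4)
    exact Units.ext (sub_left_injective h5)) hgZ
  have h1 : (Nat.card T : ℤ) - M ≤ M * Nat.card Z * #(Good.image col) := by
    have : (Nat.card T : ℤ) ≤ #Good + M := by exact_mod_cast hsplit
    have : (#Good : ℤ) ≤ M * Nat.card Z * #(Good.image col) := by exact_mod_cast hfib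
    linarith
  have h2 := mul_le_mul_of_nonneg_right h1 (sq_nonneg ((Nat.card Z : ℤ) - g))
  have h3 : (0 : ℤ) ≤ M * Nat.card Z := by positivity
  have h4 := mul_le_mul_of_nonneg_left hD h3
  linarith

end FieldSplit

namespace FieldSplit

variable {F K V : Type*} [Field F] [Field K] [Algebra F K] [AddCommGroup V] [Module F V]
variable {T : Subgroup Kˣ} {J : Set (FieldSplit F K V)}

open Finset in
/-- For most dilations `b` of `r`, the summand `b W` meets the complement `U` of `s` in a small
subspace. -/
theorem card_bad_dilations [Finite V] [Finite K] [Fintype T] (s r : FieldSplit F K V) (M : ℕ)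
    (A : Finset T)
    (hA : ∀ t ∈ A, M < Nat.card ((s.conj (r.B (t : Kˣ))).W ⊓ s.U : Submodule F V)) :
    #A * M + 1 ≤ Nat.card K := by
  classical
  have := Fintype.ofFinite V
  let P : T → Finset V := fun t =>
    ({w : V | w ∈ s.W ∧ r.B (t : Kˣ) w ∈ s.U ∧ w ≠ 0} : Finset V)
  have hP : ∀ t ∈ A, M ≤ #(P t) := by
    intro t ht
    have h1 := hA t ht
    have h2 : Nat.card ((s.conj (r.B (t : Kˣ))).W ⊓ s.U : Submodule F V) ≤ #(insert 0 (P t)) := by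
      rw [Nat.card_eq_fintype_card, ← Finset.card_univ]
      refine Finset.card_le_card_of_injOn (fun x => (r.B (t : Kˣ)).symm x.1) ?_ ?_
      · rintro ⟨x, hx⟩ -
        simp only [coe_insert, Set.mem_insert_iff, Finset.mem_coe, P, mem_filter, mem_univ,
          true_and]
        by_cases h0 : (r.B (t : Kˣ)).symm x = 0
        · exact Or.inl h0
        · refine Or.inr ⟨mem_conj_W.mp hx.1, ?_, h0⟩
          simpa using hx.2
      · intro a _ b _ h
        exact Subtype.ext ((r.B (t : Kˣ)).symm.injective h)
    have h3 : #(insert 0 (P t)) ≤ #(P t) + 1 := Finset.card_insert_le _ _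
    omega
  have h1 : #A * M ≤ #(A.sigma P) := by
    rw [Finset.card_sigma, ← smul_eq_mul]
    exact Finset.card_nsmul_le_sum _ _ _ hP
  have h2 : #(A.sigma P) + 1 ≤ Nat.card K := by
    rw [← r.card_W]
    have h0 : (0 : V) ∉ (A.sigma P).image (fun p => r.B (p.1 : Kˣ) p.2 - p.2) := by
      intro h
      obtain ⟨⟨t, w⟩, hp, h⟩ := Finset.mem_image.mp h
      simp only [mem_sigma, P, mem_filter, mem_univ, true_and] at hp
      obtain ⟨-, hw1, hw2, hw3⟩ := hp
      rw [sub_eq_zero] at h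
      change r.B (t : Kˣ) w = w at h
      exact hw3 (eq_zero_of_mem hw1 (h ▸ hw2))
    have hinj : Set.InjOn (fun p : (_ : T) × V => r.B (p.1 : Kˣ) p.2 - p.2) (A.sigma P) := by
      rintro ⟨t, w⟩ hp ⟨t', w'⟩ hp' h
      simp only [coe_sigma, Set.mem_sigma_iff, Finset.mem_coe, P, mem_filter, mem_univ,
        true_and] at hp hp'
      obtain ⟨-, hw1, hw2, hw3⟩ := hp
      obtain ⟨-, hw1', hw2', hw3'⟩ := hp'
      simp only at h
      have e1 : w' - w ∈ s.U := by
        have : w' - w = r.B (t' : Kˣ) w' - r.B (t : Kˣ) w := by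
          rw [sub_eq_sub_iff_add_eq_add] at h ⊢
          rw [add_comm w', h, add_comm]
        rw [this]
        exact s.U.sub_mem hw2' hw2
      have e2 : w' = w := sub_eq_zero.mp (eq_zero_of_mem (s.W.sub_mem hw1' hw1) e1)
      subst e2
      have h3 : r.π w' ≠ 0 := by
        intro h0
        rw [B_of_mem_U _ (mem_U.mpr h0)] at hw2
        exact hw3 (eq_zero_of_mem hw1 hw2)
      have h4 := sub_left_injective h
      simp only [B_apply] at h4
      have h5 := mul_right_cancel₀ h3 (r.iota_injective (add_left_cancel h4))
      have : t = t' := Subtype.ext (Units.ext (sub_left_injective h5))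
      rw [this]
    rw [← Finset.card_image_of_injOn hinj, ← Finset.card_insert_of_notMem h0]
    refine Finset.card_le_natCard _ id (r.W : Set V) ?_ (fun _ _ _ _ h => h)
    intro a ha
    rcases Finset.mem_insert.mp ha with rfl | h
    · exact r.W.zero_mem
    · obtain ⟨⟨t, w⟩, -, rfl⟩ := Finset.mem_image.mp h
      simp only [id, B_apply, add_sub_cancel_left]
      exact r.iota_mem_W _
  omega

open Finset in
theorem B_mem_nearCover [Finite V] [Finite K] (hJ : ClosedFamily T J)
    (hspan : Submodule.span F {x : K | ∃ t ∈ T, x = (t : K) - 1} = ⊤)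
    {g M : ℕ} (hT : Thick V T g M) {s r : FieldSplit F K V} (hs : s ∈ J) (hr : r ∈ J)
    {t : Kˣ} (ht : t ∈ T) {v : V} :
    r.B t v ∈ nearCover J s ↔ v ∈ nearCover J s := by
  classical
  have := Fintype.ofFinite T
  have := Fintype.ofFinite V
  -- the stabiliser of the near cover
  let S : Subgroup T :=
    { carrier := {t | ∀ v, r.B (t : Kˣ) v ∈ nearCover J s ↔ v ∈ nearCover J s}
      mul_mem' := by
        intro a b ha hb v
        rw [Subgroup.coe_mul, map_mul, LinearEquiv.mul_apply, ha, hb]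
      one_mem' := by intro v; rw [Subgroup.coe_one, map_one]; rfl
      inv_mem' := by
        intro a ha v
        rw [Subgroup.coe_inv, ← ha, B_B_inv] }
  let A : Finset T := {t | M < Nat.card ((s.conj (r.B (t : Kˣ))).W ⊓ s.U : Submodule F V)}
  have hA := card_bad_dilations s r M A (fun t ht => (Finset.mem_filter.mp ht).2)
  have hgood : ∀ t ∉ A, t ∈ S := by
    intro t ht
    have hM : Nat.card ((s.conj (r.B (t : Kˣ))).W ⊓ s.U : Submodule F V) ≤ M := by
      by_contra h
      exact ht (Finset.mem_filter.mpr ⟨mem_univ _, by omega⟩)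
    have hsub := nearCover_subset hJ hspan hT hs (hJ s hs r hr t t.2) hM
    have himg : ∀ v ∈ nearCover J s, r.B (t : Kˣ) v ∈ nearCover J s := by
      intro v hv
      apply hsub
      intro y hy hyU
      rw [mem_conj_W] at hy
      rw [mem_conj_U] at hyU
      have h1 := hv _ hy (by simpa using hyU)
      rw [← hJ.B_mem_cover_iff hr t.2] at h1
      simpa using h1
    have hcard : (univ.filter (· ∈ nearCover J s)).image (r.B (t : Kˣ))
        = univ.filter (· ∈ nearCover J s) := by
      apply Finset.eq_of_subset_of_card_le
      · intro x hx
        obtain ⟨v, hv, rfl⟩ := Finset.mem_image.mp hx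
        simp only [mem_filter, mem_univ, true_and] at hv ⊢
        exact himg v hv
      · rw [Finset.card_image_of_injective _ (r.B (t : Kˣ)).injective]
    intro v
    refine ⟨fun h => ?_, himg v⟩
    have : r.B (t : Kˣ) v ∈ univ.filter (· ∈ nearCover J s) := by simpa using h
    rw [← hcard, Finset.mem_image] at this
    obtain ⟨w, hw, hwv⟩ := this
    rw [← (r.B (t : Kˣ)).injective hwv]
    simpa using hw
  have hS : S = ⊤ := by
    rw [← Subgroup.card_eq_iff_eq_top]
    have h1 : Nat.card T ≤ #A + Nat.card S := by
      have : (univ : Finset T) ⊆ A ∪ ({t | t ∈ S} : Finset T) := by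
        intro t _
        by_cases h : t ∈ A
        · exact Finset.mem_union_left _ h
        · exact Finset.mem_union_right _ (by simpa using hgood t h)
      have h2 := (Finset.card_le_card this).trans (Finset.card_union_le _ _)
      rw [Finset.card_univ, ← Nat.card_eq_fintype_card] at h2
      have h3 : #({t | t ∈ S} : Finset T) = Nat.card S := by
        rw [Nat.card_eq_fintype_card]; exact (Fintype.card_subtype _).symm
      omega
    have h2 := hT.index
    have h3 := hT.two_mul_lt
    obtain ⟨d, hd⟩ := Subgroup.card_subgroup_dvd_card S
    have hTpos : 0 < Nat.card T := Nat.card_pos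
    have h4 : 2 * #A < Nat.card T := by
      have e1 : #A * M ≤ g * Nat.card T := by omega
      by_contra hcon
      push Not at hcon
      nlinarith
    rcases d with _ | _ | d
    · omega
    · omega
    · nlinarith
  have : (⟨t, ht⟩ : T) ∈ S := by rw [hS]; trivial
  exact this v

/-- The periods of the near cover form a subspace. -/
def periods (J : Set (FieldSplit F K V)) (s : FieldSplit F K V) : Submodule F V where
  carrier := {z | ∀ v ∈ nearCover J s, v + z ∈ nearCover J s}
  add_mem' := by
    intro a b ha hb v hv
    rw [← add_assoc]
    exact hb _ (ha _ hv)
  zero_mem' := by intro v hv; rwa [add_zero]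
  smul_mem' := by
    intro c z hz v hv
    have hcone : ∀ (c : F) (v : V), c ≠ 0 → v ∈ nearCover J s → c • v ∈ nearCover J s := by
      intro c v hc hv y hy hyU
      have h1 : c • v + y = c • (v + c⁻¹ • y) := by rw [smul_add, smul_inv_smul₀ hc]
      rw [h1] at hyU ⊢
      exact smul_mem_cover c (hv _ (s.W.smul_mem _ hy) fun h => hyU (s.U.smul_mem c h))
    by_cases hc : c = 0
    · rw [hc, zero_smul, add_zero]; exact hv
    · have h1 : v + c • z = c • (c⁻¹ • v + z) := by rw [smul_add, smul_inv_smul₀ hc]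
      rw [h1]
      exact hcone c _ hc (hz _ (hcone _ _ (inv_ne_zero hc) hv))

/-- Every point of the span of the summands which lies outside some complement is covered by a
summand. -/
theorem mem_cover_of_mem_iSup [Finite V] [Finite K] (hJ : ClosedFamily T J)
    (hspan : Submodule.span F {x : K | ∃ t ∈ T, x = (t : K) - 1} = ⊤)
    {g M : ℕ} (hT : Thick V T g M) {s : FieldSplit F K V} (hs : s ∈ J) {v : V}
    (hv : v ∈ ⨆ r ∈ J, r.W) (hvU : v ∉ s.U) : ∃ r ∈ J, v ∈ r.W := by
  have hsW : s.W ≤ periods J s := by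
    intro z hz v hv y hy hyU
    rw [add_assoc] at hyU ⊢
    exact hv _ (s.W.add_mem hz hy) hyU
  have hle : ⨆ r ∈ J, r.W ≤ periods J s := by
    refine iSup₂_le fun r hr => ?_
    obtain ⟨w, hw, hwU⟩ := exists_mem_W_notMem_U hT.big s r
    refine r.W_le_of_forall hspan _ (w := r.π w) (fun h => hwU (mem_U.mpr h)) fun t ht => ?_
    have h1 : r.B t w ∈ periods J s := by
      intro v hv
      have h2 : v + r.B t w = r.B t (r.B t⁻¹ v + w) := by rw [map_add, B_B_inv]
      rw [h2, B_mem_nearCover hJ hspan hT hs hr ht]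
      apply hsW hw
      rwa [B_mem_nearCover hJ hspan hT hs hr (T.inv_mem ht)]
    have h2 := (periods J s).sub_mem h1 (hsW hw)
    rwa [B_apply, add_sub_cancel_left] at h2
  have h0 : (0 : V) ∈ nearCover J s := by
    intro y hy _
    rw [zero_add]; exact ⟨s, hs, hy⟩
  have h1 := hle hv 0 h0 0 s.W.zero_mem
  rw [zero_add, add_zero] at h1
  exact h1 hvU

end FieldSplit

namespace FieldSplit

variable {F K V : Type*} [Field F] [Field K] [Algebra F K] [AddCommGroup V] [Module F V]

/-- The orbit members whose complement contains `X`. -/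
def fam (Γ : Subgroup (V ≃ₗ[F] V)) (s : FieldSplit F K V) (X : Submodule F V) :
    Set (FieldSplit F K V) := {r | ∃ γ ∈ Γ, r = s.conj γ ∧ X ≤ r.U}

/-- The orbit members for which `X` lies in the marked part of the complement. -/
def markedFam (Γ : Subgroup (V ≃ₗ[F] V)) (s : FieldSplit F K V) (P X : Submodule F V) :
    Set (FieldSplit F K V) := {r | ∃ γ ∈ Γ, r = s.conj γ ∧ X ≤ P.map γ.toLinearMap}

/-- The span of the summands `W` over the members of `fam`. -/
def spanW (Γ : Subgroup (V ≃ₗ[F] V)) (s : FieldSplit F K V) (X : Submodule F V) :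
    Submodule F V := ⨆ r ∈ fam Γ s X, r.W

/-- The intersection of the complements `U` over the members of `fam`. -/
def coreU (Γ : Subgroup (V ≃ₗ[F] V)) (s : FieldSplit F K V) (X : Submodule F V) :
    Submodule F V := ⨅ r ∈ fam Γ s X, r.U

variable {Γ : Subgroup (V ≃ₗ[F] V)} {s : FieldSplit F K V} {P X : Submodule F V}
variable {T : Subgroup Kˣ}

theorem conj_mem_fam {r : FieldSplit F K V} (hr : r ∈ fam Γ s X) {γ : V ≃ₗ[F] V} (hγ : γ ∈ Γ) :
    r.conj γ ∈ fam Γ s (X.map γ.toLinearMap) := by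
  obtain ⟨δ, hδ, rfl, hX⟩ := hr
  refine ⟨γ * δ, Γ.mul_mem hγ hδ, rfl, ?_⟩
  rw [conj_U]
  exact Submodule.map_mono hX

theorem map_inv_map (γ : V ≃ₗ[F] V) (X : Submodule F V) :
    (X.map γ.toLinearMap).map (γ⁻¹ : V ≃ₗ[F] V).toLinearMap = X := by
  rw [← Submodule.map_comp]
  have : (γ⁻¹ : V ≃ₗ[F] V).toLinearMap ∘ₗ γ.toLinearMap = LinearMap.id := by
    ext v; exact γ.symm_apply_apply v
  rw [this, Submodule.map_id]

theorem map_map_inv (γ : V ≃ₗ[F] V) (X : Submodule F V) :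
    (X.map (γ⁻¹ : V ≃ₗ[F] V).toLinearMap).map γ.toLinearMap = X := by
  have := map_inv_map γ⁻¹ X
  rwa [inv_inv] at this

theorem map_mul_equiv (γ δ : V ≃ₗ[F] V) (X : Submodule F V) :
    X.map (γ * δ : V ≃ₗ[F] V).toLinearMap = (X.map δ.toLinearMap).map γ.toLinearMap := by
  rw [← Submodule.map_comp]; rfl

theorem map_eq_of_fix {γ : V ≃ₗ[F] V} {X : Submodule F V} (h : ∀ x ∈ X, γ x = x) :
    X.map γ.toLinearMap = X := by
  ext v
  rw [Submodule.mem_map]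
  constructor
  · rintro ⟨w, hw, rfl⟩
    change γ w ∈ X
    rw [h w hw]; exact hw
  · intro hv; exact ⟨v, hv, h v hv⟩

theorem mem_map_iff_inv {γ : V ≃ₗ[F] V} {X : Submodule F V} {v : V} :
    v ∈ X.map γ.toLinearMap ↔ γ⁻¹ v ∈ X := by
  rw [Submodule.mem_map]
  constructor
  · rintro ⟨w, hw, rfl⟩
    change γ.symm (γ w) ∈ X
    rwa [γ.symm_apply_apply]
  · intro h; exact ⟨_, h, γ.apply_symm_apply v⟩

theorem spanW_map {γ : V ≃ₗ[F] V} (hγ : γ ∈ Γ) (X : Submodule F V) :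
    spanW Γ s (X.map γ.toLinearMap) = (spanW Γ s X).map γ.toLinearMap := by
  have aux : ∀ {γ : V ≃ₗ[F] V}, γ ∈ Γ → ∀ X : Submodule F V,
      (spanW Γ s X).map γ.toLinearMap ≤ spanW Γ s (X.map γ.toLinearMap) := by
    intro γ hγ X
    rw [spanW, Submodule.map_iSup]
    refine iSup_le fun r => ?_
    rw [Submodule.map_iSup]
    refine iSup_le fun hr => ?_
    rw [← conj_W]
    exact le_iSup₂_of_le (r.conj γ) (conj_mem_fam hr hγ) le_rfl
  refine le_antisymm ?_ (aux hγ X)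
  have h1 := Submodule.map_mono (f := γ.toLinearMap) (aux (Γ.inv_mem hγ) (X.map γ.toLinearMap))
  rwa [map_map_inv, map_inv_map] at h1

theorem coreU_map {γ : V ≃ₗ[F] V} (hγ : γ ∈ Γ) (X : Submodule F V) :
    coreU Γ s (X.map γ.toLinearMap) = (coreU Γ s X).map γ.toLinearMap := by
  have aux : ∀ {γ : V ≃ₗ[F] V}, γ ∈ Γ → ∀ X : Submodule F V,
      coreU Γ s (X.map γ.toLinearMap) ≤ (coreU Γ s X).map γ.toLinearMap := by
    intro γ hγ X v hv
    rw [mem_map_iff_inv]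
    simp only [coreU, Submodule.mem_iInf] at hv ⊢
    intro r hr
    exact mem_conj_U.mp (hv _ (conj_mem_fam hr hγ))
  refine le_antisymm (aux hγ X) ?_
  have h1 := Submodule.map_mono (f := γ.toLinearMap) (aux (Γ.inv_mem hγ) (X.map γ.toLinearMap))
  rwa [map_map_inv, map_inv_map] at h1

theorem le_coreU : X ≤ coreU Γ s X := le_iInf₂ fun _ hr => by
  obtain ⟨_, _, _, h⟩ := hr; exact h

theorem markedFam_subset (hP : P ≤ s.U) : markedFam Γ s P X ⊆ fam Γ s X := by
  rintro r ⟨γ, hγ, rfl, h⟩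
  exact ⟨γ, hγ, rfl, h.trans (by rw [conj_U]; exact Submodule.map_mono hP)⟩

theorem B_mem_of_mem_fam (hB : ∀ t ∈ T, s.B t ∈ Γ) {r : FieldSplit F K V} (hr : r ∈ fam Γ s X)
    {t : Kˣ} (ht : t ∈ T) : r.B t ∈ Γ := by
  obtain ⟨γ, hγ, rfl, -⟩ := hr
  rw [conj_B]
  exact Γ.mul_mem (Γ.mul_mem hγ (hB t ht)) (Γ.inv_mem hγ)

theorem B_fix_of_mem_fam {r : FieldSplit F K V} (hr : r ∈ fam Γ s X) (t : Kˣ) {x : V} (hx : x ∈ X) :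
    r.B t x = x := by
  obtain ⟨_, _, _, h⟩ := hr
  exact B_of_mem_U t (h hx)

theorem closedFamily_fam (hB : ∀ t ∈ T, s.B t ∈ Γ) : ClosedFamily T (fam Γ s X) := by
  intro r hr r' hr' t ht
  have h1 := conj_mem_fam hr (B_mem_of_mem_fam hB hr' ht)
  rwa [map_eq_of_fix (fun x hx => B_fix_of_mem_fam hr' t hx)] at h1

theorem conj_mem_markedFam {r : FieldSplit F K V} (hr : r ∈ markedFam Γ s P X) {γ : V ≃ₗ[F] V}
    (hγ : γ ∈ Γ) (hfix : ∀ x ∈ X, γ x = x) : r.conj γ ∈ markedFam Γ s P X := by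
  obtain ⟨δ, hδ, rfl, hX⟩ := hr
  refine ⟨γ * δ, Γ.mul_mem hγ hδ, rfl, ?_⟩
  rw [map_mul_equiv, ← map_eq_of_fix hfix]
  exact Submodule.map_mono hX

theorem closedFamily_markedFam (hB : ∀ t ∈ T, s.B t ∈ Γ) (hP : P ≤ s.U) :
    ClosedFamily T (markedFam Γ s P X) := by
  intro r hr r' hr' t ht
  have hfam := markedFam_subset hP hr'
  exact conj_mem_markedFam hr (B_mem_of_mem_fam hB hfam ht) fun x hx => B_fix_of_mem_fam hfam t hx

/-- Standing hypotheses on a linear group containing the dilations of one decomposition. -/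
structure Setup (Γ : Subgroup (V ≃ₗ[F] V)) (s : FieldSplit F K V) (P : Submodule F V)
    (T : Subgroup Kˣ) (g M : ℕ) : Prop where
  B_mem : ∀ t ∈ T, s.B t ∈ Γ
  span : Submodule.span F {x : K | ∃ t ∈ T, x = (t : K) - 1} = ⊤
  thick : Thick V T g M
  P_le : P ≤ s.U
  cyc : ∀ t : Kˣ, ∃ γ ∈ Γ, ∃ c : F, c ≠ 0 ∧ (∀ v ∈ P, γ v = v) ∧
    ∀ k, γ (s.ι k) = c • s.ι (t * k)

section
variable {g M : ℕ}

theorem Setup.W_le_of_mem (h : Setup Γ s P T g M) {r : FieldSplit F K V} (hr : r ∈ fam Γ s X)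
    {Q : Submodule F V} (hQ : ∀ γ ∈ Γ, (∀ x ∈ X, γ x = x) → ∀ v ∈ Q, γ v ∈ Q)
    {w : V} (hw : w ∈ Q) (hwU : w ∉ r.U) : r.W ≤ Q := by
  refine r.W_le_of_forall h.span Q (w := r.π w) (fun h => hwU (mem_U.mpr h)) fun t ht => ?_
  have h1 := hQ _ (B_mem_of_mem_fam h.B_mem hr ht) (fun x hx => B_fix_of_mem_fam hr t hx) w hw
  have h2 := Q.sub_mem h1 hw
  rwa [B_apply, add_sub_cancel_left] at h2

/-- Points of `spanW` outside `X` lie in the summand of a marked member. -/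
theorem Setup.exists_marked [Finite V] [Finite K] (h : Setup Γ s P T g M) (hC : coreU Γ s X = X)
    (hne : (markedFam Γ s P X).Nonempty) {v : V} (hv : v ∈ spanW Γ s X) (hvX : v ∉ X) :
    ∃ r ∈ markedFam Γ s P X, v ∈ r.W := by
  have h1 : ∃ r ∈ fam Γ s X, v ∉ r.U := by
    by_contra! hcon
    apply hvX
    rw [← hC, coreU]
    simpa only [Submodule.mem_iInf] using hcon
  obtain ⟨r0, hr0, hvr0⟩ := h1
  obtain ⟨r, hr, hvr⟩ := mem_cover_of_mem_iSup (closedFamily_fam h.B_mem) h.span h.thick hr0 hv hvr0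
  obtain ⟨m, hm⟩ := hne
  have hv0 : v ≠ 0 := fun h0 => hvX (h0 ▸ X.zero_mem)
  have h2 : ∃ r' ∈ markedFam Γ s P X, v ∉ r'.U := by
    by_contra! hcon
    let Q : Submodule F V := ⨅ r' ∈ markedFam Γ s P X, r'.U
    have hQ : r.W ≤ Q := by
      refine h.W_le_of_mem hr (Q := Q) ?_ (w := v) ?_ (fun h => hv0 (eq_zero_of_mem hvr h))
      · intro γ hγ hfix v hv
        simp only [Q, Submodule.mem_iInf] at hv ⊢
        intro r' hr'
        have hfix' : ∀ x ∈ X, γ⁻¹ x = x := fun x hx => by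
          have e : γ⁻¹ (γ x) = x := γ.symm_apply_apply x
          rwa [hfix x hx] at e
        have := hv _ (conj_mem_markedFam hr' (Γ.inv_mem hγ) hfix')
        rw [mem_conj_U] at this
        exact this
      · simpa only [Q, Submodule.mem_iInf] using hcon
    obtain ⟨w, hw, hwU⟩ := exists_mem_W_notMem_U h.thick.big r m
    exact hwU (((hQ.trans (iInf₂_le m hm))) hw)
  obtain ⟨r', hr', hvr'⟩ := h2
  refine mem_cover_of_mem_iSup (closedFamily_markedFam h.B_mem h.P_le) h.span h.thick hr' ?_ hvr'
  obtain ⟨w, hwm, hwr, hw0⟩ := exists_ne_zero_W_inf_W h.thick.big m r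
  refine h.W_le_of_mem hr (Q := ⨆ r' ∈ markedFam Γ s P X, r'.W) ?_ (w := w) ?_
    (fun h => hw0 (eq_zero_of_mem hwr h)) hvr
  · intro γ hγ hfix v hv
    have : (⨆ r' ∈ markedFam Γ s P X, r'.W) ≤ (⨆ r' ∈ markedFam Γ s P X, r'.W).comap
        γ.toLinearMap := by
      refine iSup₂_le fun r' hr' => ?_
      rw [← Submodule.map_le_iff_le_comap, ← conj_W]
      exact le_iSup₂_of_le (r'.conj γ) (conj_mem_markedFam hr' hγ hfix) le_rfl
    exact this hv
  · exact (le_iSup₂_of_le m hm le_rfl : m.W ≤ _) hwm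

theorem Setup.move_in_W (h : Setup Γ s P T g M) {r : FieldSplit F K V}
    (hr : r ∈ markedFam Γ s P X) {v w : V} (hv : v ∈ r.W) (hw : w ∈ r.W) (hv0 : v ≠ 0)
    (hw0 : w ≠ 0) : ∃ γ ∈ Γ, (∀ x ∈ X, γ x = x) ∧ ∃ c : F, c ≠ 0 ∧ γ v = c • w := by
  obtain ⟨δ, hδ, rfl, hX⟩ := hr
  obtain ⟨k, rfl⟩ := hv
  obtain ⟨l, rfl⟩ := hw
  have hk : k ≠ 0 := by rintro rfl; exact hv0 (map_zero _)
  have hl : l ≠ 0 := by rintro rfl; exact hw0 (map_zero _)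
  obtain ⟨γ, hγ, c, hc, hfix, hcyc⟩ := h.cyc (Units.mk0 (l / k) (div_ne_zero hl hk))
  refine ⟨δ * γ * δ⁻¹, Γ.mul_mem (Γ.mul_mem hδ hγ) (Γ.inv_mem hδ), ?_, c, hc, ?_⟩
  · intro x hx
    obtain ⟨p, hp, rfl⟩ := hX hx
    change δ (γ (δ.symm (δ p))) = δ p
    rw [δ.symm_apply_apply, hfix p hp]
  · change δ (γ (δ.symm (δ (s.ι k)))) = c • δ (s.ι l)
    rw [δ.symm_apply_apply, hcyc, map_smul, Units.val_mk0, div_mul_cancel₀ _ hk]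

/-- The pointwise stabiliser of `X` is transitive, up to scalars, on `spanW` minus `X`. -/
theorem Setup.transitive_spanW [Finite V] [Finite K] (h : Setup Γ s P T g M) (hC : coreU Γ s X = X)
    (hne : (markedFam Γ s P X).Nonempty) {v w : V} (hv : v ∈ spanW Γ s X) (hvX : v ∉ X)
    (hw : w ∈ spanW Γ s X) (hwX : w ∉ X) :
    ∃ γ ∈ Γ, (∀ x ∈ X, γ x = x) ∧ ∃ c : F, c ≠ 0 ∧ γ v = c • w := by
  obtain ⟨r, hr, hvr⟩ := h.exists_marked hC hne hv hvX
  obtain ⟨r', hr', hwr'⟩ := h.exists_marked hC hne hw hwX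
  obtain ⟨u, hu, hu', hu0⟩ := exists_ne_zero_W_inf_W h.thick.big r r'
  have hv0 : v ≠ 0 := fun h0 => hvX (h0 ▸ X.zero_mem)
  have hw0 : w ≠ 0 := fun h0 => hwX (h0 ▸ X.zero_mem)
  obtain ⟨γ, hγ, hf, c, hc, e⟩ := h.move_in_W hr hvr hu hv0 hu0
  obtain ⟨δ, hδ, hf', c', hc', e'⟩ := h.move_in_W hr' hu' hwr' hu0 hw0
  refine ⟨δ * γ, Γ.mul_mem hδ hγ, fun x hx => ?_, c * c', mul_ne_zero hc hc', ?_⟩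
  · rw [LinearEquiv.mul_apply, hf x hx, hf' x hx]
  · rw [LinearEquiv.mul_apply, e, map_smul, e', smul_smul]

end

end FieldSplit

namespace FieldSplit

variable {F K V : Type*} [Field F] [Field K] [Algebra F K] [AddCommGroup V] [Module F V]
variable {Γ : Subgroup (V ≃ₗ[F] V)} {s : FieldSplit F K V} {P X E : Submodule F V}
variable {T : Subgroup Kˣ} {g M : ℕ}

instance [Finite V] [Finite K] : Finite (FieldSplit F K V) :=
  Finite.of_injective (fun s : FieldSplit F K V => ((s.ι : K → V), (s.π : V → K))) fun s t h => by
    simp only [Prod.mk.injEq, DFunLike.coe_fn_eq] at h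
    exact ext_iota_pi h.1 h.2

/-- The pointwise stabiliser of `X` is transitive on the points outside `X`. -/
def TransOff (Γ : Subgroup (V ≃ₗ[F] V)) (X : Submodule F V) : Prop :=
  ∀ v ∉ X, ∀ w ∉ X, ∃ γ ∈ Γ, (∀ x ∈ X, γ x = x) ∧ ∃ c : F, c ≠ 0 ∧ γ v = c • w

theorem conj_mem_fam_of_fix {r : FieldSplit F K V} (hr : r ∈ fam Γ s X) {γ : V ≃ₗ[F] V}
    (hγ : γ ∈ Γ) (hfix : ∀ x ∈ X, γ x = x) : r.conj γ ∈ fam Γ s X := by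
  have := conj_mem_fam hr hγ
  rwa [map_eq_of_fix hfix] at this

theorem inv_fix {γ : V ≃ₗ[F] V} (hfix : ∀ x ∈ X, γ x = x) : ∀ x ∈ X, γ⁻¹ x = x := fun x hx => by
  have e : γ⁻¹ (γ x) = x := γ.symm_apply_apply x
  rwa [hfix x hx] at e

open Finset in
open Classical in
theorem card_fam_filter_eq [Finite V] [Finite K] [Fintype (FieldSplit F K V)]
    (hE : TransOff Γ E) (S : FieldSplit F K V → Submodule F V)
    (hS : ∀ (γ : V ≃ₗ[F] V) r, S (r.conj γ) = (S r).map γ.toLinearMap)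
    {x y : V} (hx : x ∉ E) (hy : y ∉ E) :
    #{r | r ∈ fam Γ s E ∧ x ∈ S r} = #{r | r ∈ fam Γ s E ∧ y ∈ S r} := by
  have aux : ∀ {x y : V}, x ∉ E → y ∉ E →
      #{r | r ∈ fam Γ s E ∧ x ∈ S r} ≤ #{r | r ∈ fam Γ s E ∧ y ∈ S r} := by
    intro x y hx hy
    obtain ⟨γ, hγ, hfix, c, hc, e⟩ := hE x hx y hy
    refine Finset.card_le_card_of_injOn (fun r => r.conj γ) ?_ ?_
    · intro r hr
      simp only [coe_filter, mem_univ, true_and, Set.mem_ofPred_eq] at hr ⊢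
      refine ⟨conj_mem_fam_of_fix hr.1 hγ hfix, ?_⟩
      rw [hS]
      have : γ x ∈ (S r).map γ.toLinearMap := ⟨x, hr.2, rfl⟩
      rw [e] at this
      exact (Submodule.smul_mem_iff _ hc).mp this
    · intro a _ b _ h
      have := congrArg (fun r => r.conj γ⁻¹) h
      simp only [conj_conj, inv_mul_cancel, conj_one] at this
      exact this
  exact le_antisymm (aux hx hy) (aux hy hx)

open Finset in
open Classical in
theorem sum_fam_inter [Finite V] [Finite K] [Fintype (FieldSplit F K V)]
    (hE : TransOff Γ E) (S : FieldSplit F K V → Submodule F V)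
    (hS : ∀ (γ : V ≃ₗ[F] V) r, S (r.conj γ) = (S r).map γ.toLinearMap)
    {x : V} (hx : x ∉ E) (R : Finset V) (hR : ∀ y ∈ R, y ∉ E) :
    ∑ r with r ∈ fam Γ s E, #{y ∈ R | y ∈ S r} = #R * #{r | r ∈ fam Γ s E ∧ x ∈ S r} := by
  have h1 := Finset.sum_card_bipartiteAbove_eq_sum_card_bipartiteBelow
    (s := ({r | r ∈ fam Γ s E} : Finset (FieldSplit F K V))) (t := R) (fun r y => y ∈ S r)
  simp only [bipartiteAbove, bipartiteBelow, Finset.filter_filter] at h1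
  rw [h1, ← smul_eq_mul, ← Finset.sum_const]
  exact Finset.sum_congr rfl fun y hy => card_fam_filter_eq hE S hS (hR y hy) hx

theorem card_mul_ker [Finite V] (l : V →ₗ[F] F) (hl : l ≠ 0) :
    Nat.card (LinearMap.ker l) * Nat.card F = Nat.card V := by
  have h1 := Submodule.card_eq_card_quotient_mul_card (LinearMap.ker l)
  rw [h1, Nat.card_congr (l.quotKerEquivOfSurjective (LinearMap.surjective hl)).toEquiv, mul_comm]

theorem card_U_mul [Finite V] [Finite K] (s : FieldSplit F K V) :
    Nat.card s.U * Nat.card K = Nat.card V := by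
  have h1 := Submodule.card_eq_card_quotient_mul_card s.U
  have hs : Function.Surjective s.π := fun k => ⟨s.ι k, s.proj k⟩
  have h2 : Nat.card (V ⧸ s.U) = Nat.card K :=
    Nat.card_congr (s.π.quotKerEquivOfSurjective hs).toEquiv
  rw [h1, h2]

open Finset in
open Classical in
/-- The number of members of the family whose complement contains `x` equals the number of
members whose summand is killed by the functional `l`. -/
theorem card_fam_U_eq_card_fam_ker [Finite F] [Finite V] [Finite K] [Fintype (FieldSplit F K V)]
    (hE : TransOff Γ E) {x : V} (hx : x ∉ E) {l : V →ₗ[F] F} (hl0 : l ≠ 0)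
      (hlE : ∀ e ∈ E, l e = 0) :
    #{r | r ∈ fam Γ s E ∧ x ∈ r.U} = #{r | r ∈ fam Γ s E ∧ r.W ≤ LinearMap.ker l} := by
  have := Fintype.ofFinite V
  set 𝓕 : Finset (FieldSplit F K V) := {r | r ∈ fam Γ s E} with h𝓕
  have key : ∀ r ∈ 𝓕, E ≤ r.U := fun r hr => by
    obtain ⟨_, _, _, h⟩ := (Finset.mem_filter.mp hr).2; exact h
  have hsd : ∀ (A : Submodule F V), #{y | y ∈ A} = Nat.card A := fun A => by
    rw [Nat.card_eq_fintype_card]; exact (Fintype.card_subtype _).symm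
  have cardW : ∀ r : FieldSplit F K V, Nat.card r.W = Nat.card K := fun r => r.card_W
  have cardU : ∀ r : FieldSplit F K V, Nat.card r.U * Nat.card K = Nat.card V := card_U_mul
  -- abbreviations
  set e := Nat.card E
  set q := Nat.card F
  set u := Nat.card s.U
  have hk : 0 < Nat.card K := Nat.card_pos
  have cardU' : ∀ r : FieldSplit F K V, Nat.card r.U = u := fun r =>
    Nat.eq_of_mul_eq_mul_right hk ((cardU r).trans (cardU s).symm)
  have hcompl : #{y | y ∉ E} + e = Nat.card V := by
    have := Finset.card_filter_add_card_filter_not (s := (univ : Finset V)) (fun y => y ∈ E)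
    rw [hsd, Finset.card_univ, ← Nat.card_eq_fintype_card] at this
    omega
  have heq1 := sum_fam_inter (s := s) hE (fun r => r.U) conj_U hx ({y | y ∉ E} : Finset V) (by simp)
  have heq2 := sum_fam_inter (s := s) hE (fun r => r.W) conj_W hx ({y | y ∉ E} : Finset V) (by simp)
  have heq3 := sum_fam_inter (s := s) hE (fun r => r.W) conj_W hx
    ({y | y ∉ E ∧ l y = 0} : Finset V) (fun y hy => (Finset.mem_filter.mp hy).2.1)
  have sub1 : ∀ r ∈ 𝓕, (#{y ∈ ({y | y ∉ E} : Finset V) | y ∈ r.U} : ℤ) = u - e := by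
    intro r hr
    have := Finset.card_filter_add_card_filter_not (s := ({y | y ∈ r.U} : Finset V))
        (fun y => y ∈ E)
    rw [Finset.filter_filter, Finset.filter_filter, hsd, cardU'] at this
    have e1 : #{y | y ∈ r.U ∧ y ∈ E} = e := by
      refine Eq.trans ?_ (hsd E); congr 1; ext y; simp only [mem_filter, mem_univ, true_and]
      exact ⟨fun h => h.2, fun h => ⟨key r hr h, h⟩⟩
    have e2 : #{y ∈ ({y | y ∉ E} : Finset V) | y ∈ r.U} = #{y | y ∈ r.U ∧ y ∉ E} := by
      rw [Finset.filter_filter]; congr 1; ext y; simp [and_comm]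
    rw [e2]; push_cast [← this, e1]; ring
  have sub0 : ∀ r ∈ 𝓕, ∀ A : Submodule F V, A ≤ r.W → (#{y | y ∈ A ∧ y ∉ E} : ℤ) =
      Nat.card A - 1 := by
    intro r hr A hA
    have h0 : ({y | y ∈ A ∧ y ∉ E} : Finset V) = ({y | y ∈ A} : Finset V).erase 0 := by
      ext y
      simp only [mem_filter, mem_univ, true_and, mem_erase]
      constructor
      · rintro ⟨h1, h2⟩; exact ⟨fun h => h2 (h ▸ E.zero_mem), h1⟩
      · rintro ⟨h1, h2⟩; exact ⟨h2, fun h => h1 (eq_zero_of_mem (hA h2) (key r hr h))⟩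
    rw [h0, Finset.card_erase_of_mem (by simp), hsd, Nat.cast_sub Nat.card_pos]; simp
  have sub2 : ∀ r ∈ 𝓕, (#{y ∈ ({y | y ∉ E} : Finset V) | y ∈ r.W} : ℤ) = Nat.card K - 1 := by
    intro r hr
    rw [← cardW r, ← sub0 r hr r.W le_rfl, Finset.filter_filter]
    congr 2; ext y; simp [and_comm]
  obtain ⟨N', hN'⟩ : ∃ N', Nat.card (LinearMap.ker l) = N' := ⟨_, rfl⟩
  have hNq : N' * q = Nat.card V := by rw [← hN']; exact card_mul_ker l hl0
  have hker : (#{y | y ∉ E ∧ l y = 0} : ℤ) = N' - e := by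
    have := Finset.card_filter_add_card_filter_not (s := ({y | y ∈ LinearMap.ker l} : Finset V))
        (fun y => y ∈ E)
    rw [Finset.filter_filter, Finset.filter_filter, hsd, hN'] at this
    have e1 : #{y | y ∈ LinearMap.ker l ∧ y ∈ E} = e := by
      refine Eq.trans ?_ (hsd E); congr 1; ext y; simp only [mem_filter, mem_univ, true_and]
      exact ⟨fun h => h.2, fun h => ⟨hlE y h, h⟩⟩
    have e2 : #{y | y ∉ E ∧ l y = 0} = #{y | y ∈ LinearMap.ker l ∧ y ∉ E} := by
      congr 1; ext y; simp [and_comm]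
    rw [e2]; push_cast [← this, e1]; ring
  have hq : 1 < q := Finite.one_lt_card
  obtain ⟨k', hk'⟩ : ∃ k', k' * q = Nat.card K := by
    have h1 : Nat.card K = q ^ Module.finrank F K := Module.natCard_eq_pow_finrank
    have : Module.Finite F K := Module.Finite.of_finite
    have h2 : 0 < Module.finrank F K := Module.finrank_pos
    refine ⟨q ^ (Module.finrank F K - 1), ?_⟩
    rw [h1, ← pow_succ]; congr 1; omega
  have sub3 : ∀ r ∈ 𝓕, (#{y ∈ ({y | y ∉ E ∧ l y = 0} : Finset V) | y ∈ r.W} : ℤ)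
      = if r.W ≤ LinearMap.ker l then (Nat.card K - 1 : ℤ) else k' - 1 := by
    intro r hr
    have e1 : #{y ∈ ({y | y ∉ E ∧ l y = 0} : Finset V) | y ∈ r.W}
        = #{y | y ∈ (r.W ⊓ LinearMap.ker l : Submodule F V) ∧ y ∉ E} := by
      rw [Finset.filter_filter]; congr 1; ext y
      simp only [mem_filter, mem_univ, true_and, Submodule.mem_inf, LinearMap.mem_ker]; tauto
    rw [e1, sub0 r hr _ inf_le_left]
    split_ifs with h
    · rw [inf_eq_left.mpr h, cardW]
    · have hne : l.domRestrict r.W ≠ 0 := by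
        intro h0
        apply h
        intro w hw
        have := LinearMap.congr_fun h0 ⟨w, hw⟩
        simpa using this
      have h1 := card_mul_ker (l.domRestrict r.W) hne
      rw [cardW, ← hk'] at h1
      have h2 := Nat.eq_of_mul_eq_mul_right (by omega) h1
      have h3 : Nat.card (r.W ⊓ LinearMap.ker l : Submodule F V) = Nat.card
          (LinearMap.ker (l.domRestrict r.W)) := by
        refine (Nat.card_congr (Equiv.ofBijective (fun y : LinearMap.ker (l.domRestrict r.W) =>
          (⟨y.1.1, y.1.2, y.2⟩ : (r.W ⊓ LinearMap.ker l : Submodule F V))) ⟨?_, ?_⟩)).symm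
        · intro a b hab
          exact Subtype.ext (Subtype.ext (by simpa using congrArg Subtype.val hab))
        · rintro ⟨y, h1, h2⟩
          exact ⟨⟨⟨y, h1⟩, h2⟩, rfl⟩
      rw [h3, h2]
  obtain ⟨a, ha⟩ : ∃ a, #{r | r ∈ fam Γ s E ∧ x ∈ r.U} = a := ⟨_, rfl⟩
  obtain ⟨b, hb⟩ : ∃ b, #{r | r ∈ fam Γ s E ∧ r.W ≤ LinearMap.ker l} = b := ⟨_, rfl⟩
  obtain ⟨w, hw⟩ : ∃ w, #{r | r ∈ fam Γ s E ∧ x ∈ r.W} = w := ⟨_, rfl⟩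
  rw [ha] at heq1
  rw [hw] at heq2 heq3
  have hVE : (#{y | y ∉ E} : ℤ) = Nat.card V - e := by
    have : ((#{y | y ∉ E} + e : ℕ) : ℤ) = Nat.card V := by rw [hcompl]
    push_cast at this; linarith
  have f1 : (#𝓕 : ℤ) * (u - e) = (Nat.card V - e) * a := by
    have : ((∑ r ∈ 𝓕, #{y ∈ ({y | y ∉ E} : Finset V) | y ∈ r.U} : ℕ) : ℤ) =
        ((#{y | y ∉ E} * a : ℕ) : ℤ) := by
      rw [heq1]
    rw [Nat.cast_sum, Finset.sum_congr rfl sub1, Finset.sum_const, nsmul_eq_mul, Nat.cast_mul,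
      hVE] at this
    exact this
  have f2 : (#𝓕 : ℤ) * (Nat.card K - 1) = (Nat.card V - e) * w := by
    have : ((∑ r ∈ 𝓕, #{y ∈ ({y | y ∉ E} : Finset V) | y ∈ r.W} : ℕ) : ℤ) =
        ((#{y | y ∉ E} * w : ℕ) : ℤ) := by
      rw [heq2]
    rw [Nat.cast_sum, Finset.sum_congr rfl sub2, Finset.sum_const, nsmul_eq_mul, Nat.cast_mul,
      hVE] at this
    exact this
  have f3 : (b : ℤ) * (Nat.card K - 1) + (#𝓕 - b) * (k' - 1) = (N' - e) * w := by
    have : ((∑ r ∈ 𝓕, #{y ∈ ({y | y ∉ E ∧ l y = 0} : Finset V) | y ∈ r.W} : ℕ) : ℤ)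
        = ((#{y | y ∉ E ∧ l y = 0} * w : ℕ) : ℤ) := by rw [heq3]
    rw [Nat.cast_sum, Finset.sum_congr rfl sub3, Finset.sum_ite, Finset.sum_const, Finset.sum_const,
      nsmul_eq_mul, nsmul_eq_mul, Nat.cast_mul, hker, h𝓕, Finset.filter_filter, hb] at this
    rw [← this]
    have h2 := Finset.card_filter_add_card_filter_not (s := 𝓕) (fun r => r.W ≤ LinearMap.ker l)
    rw [h𝓕, Finset.filter_filter, hb] at h2
    rw [← h2]; push_cast; ring
  have hVuk : (u : ℤ) * Nat.card K = Nat.card V := by exact_mod_cast cardU s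
  have hNq' : (N' : ℤ) * q = Nat.card V := by exact_mod_cast hNq
  have hkq : (k' : ℤ) * q = Nat.card K := by exact_mod_cast hk'
  have hq0 : (q : ℤ) ≠ 0 := by positivity
  have hN'u : (N' : ℤ) = u * k' := by
    apply mul_right_cancel₀ hq0
    rw [hNq', ← hVuk, ← hkq]; ring
  have hVE0 : (Nat.card V : ℤ) - e ≠ 0 := by
    rw [← hVE]
    have : 0 < #{y | y ∉ E} := Finset.card_pos.mpr ⟨x, by simpa using hx⟩
    positivity
  have hkk : (Nat.card K : ℤ) - k' ≠ 0 := by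
    have h1 : (0 : ℤ) < k' := by
      have : 0 < k' := Nat.pos_of_mul_pos_right (by rw [hk']; exact hk)
      exact_mod_cast this
    have h2 : (2 : ℤ) ≤ q := by exact_mod_cast hq
    rw [← hkq]; nlinarith
  have hfin : ((Nat.card V : ℤ) - e) * (Nat.card K - k') * a = ((Nat.card V : ℤ) - e) *
      (Nat.card K - k') * b := by
    rw [← hVuk] at f1 f2 ⊢
    rw [hN'u] at f3
    linear_combination (-(Nat.card K : ℤ) + k') * f1 - (u * Nat.card K - e) * f3 + (u * k' - e) * f2
  have := mul_left_cancel₀ (mul_ne_zero hVE0 hkk) hfin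
  rw [ha, hb]
  exact_mod_cast this

end FieldSplit

section Hua
variable {F K : Type*} [Field F] [Field K] [Algebra F K]

theorem mul_mul_mem_of_inv_mem {S : AddSubgroup K} (hinv : ∀ a ∈ S, a⁻¹ ∈ S) {a b : K} (ha : a ∈ S)
    (hb : b ∈ S) : a * b * a ∈ S := by
  by_cases ha0 : a = 0
  · simp [ha0, S.zero_mem]
  by_cases hb0 : b = 0
  · simp [hb0, S.zero_mem]
  by_cases hab : a * b = 1
  · rw [hab, one_mul]; exact ha
  have h1 : b⁻¹ - a ≠ 0 := by
    intro h
    apply hab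
    rw [← sub_eq_zero.mp h, inv_mul_cancel₀ hb0]
  have h2 : 1 - a * b ≠ 0 := fun h => hab (sub_eq_zero.mp h).symm
  have key : a * b * a = a - (a⁻¹ + (b⁻¹ - a)⁻¹)⁻¹ := by
    have e1 : b⁻¹ - a = (1 - a * b) / b := by field_simp
    have e2 : a⁻¹ + (b⁻¹ - a)⁻¹ = 1 / (a * (1 - a * b)) := by
      rw [e1]; field_simp; ring
    rw [e2]; field_simp; ring
  rw [key]
  exact S.sub_mem ha (hinv _ (S.add_mem (hinv _ ha) (hinv _ (S.sub_mem (hinv _ hb) ha))))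

/-- A hyperplane of a finite field that is closed under inversion forces the field to be small. -/
theorem card_le_of_ker_inv_closed [Finite F] [Finite K] (h : K →ₗ[F] F) (h0 : h ≠ 0)
    (hinv : ∀ a, h a = 0 → h a⁻¹ = 0) : Nat.card K ≤ 2 * Nat.card F ^ 2 := by
  classical
  obtain ⟨z, hz⟩ : ∃ z, h z ≠ 0 := by
    by_contra! hcon
    exact h0 (LinearMap.ext hcon)
  have hsq : ∀ a, h a = 0 → ∃ c : F, algebraMap F K c = a ^ 2 := by
    intro a ha
    have hstab : ∀ b, h b = 0 → h (a ^ 2 * b) = 0 := by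
      intro b hb
      have := mul_mul_mem_of_inv_mem (S := (LinearMap.ker h).toAddSubgroup)
        (fun a ha => hinv a ha) (a := a) (b := b) ha hb
      have e : a ^ 2 * b = a * b * a := by ring
      rw [e]; exact this
    refine ⟨h (a ^ 2 * z) / h z, ?_⟩
    set c := h (a ^ 2 * z) / h z with hc
    by_contra hne
    have hne' : a ^ 2 - algebraMap F K c ≠ 0 := fun h => hne (sub_eq_zero.mp h).symm
    have hall : ∀ k, h ((a ^ 2 - algebraMap F K c) * k) = 0 := by
      intro k
      have e1 : k = (k - (h k / h z) • z) + (h k / h z) • z := by abel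
      have e2 : h (k - (h k / h z) • z) = 0 := by
        rw [map_sub, map_smul, smul_eq_mul, div_mul_cancel₀ _ hz, sub_self]
      have e3 : h ((a ^ 2 - algebraMap F K c) * z) = 0 := by
        rw [sub_mul, map_sub, ← Algebra.smul_def, map_smul, smul_eq_mul, hc, div_mul_cancel₀ _ hz,
          sub_self]
      rw [e1, mul_add, map_add, mul_smul_comm, map_smul, e3, smul_zero, add_zero, sub_mul, map_sub,
        hstab _ e2, ← Algebra.smul_def, map_smul, e2]
      simp
    apply hz
    have := hall ((a ^ 2 - algebraMap F K c)⁻¹ * z)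
    rwa [mul_inv_cancel_left₀ hne'] at this
  have hker : Nat.card (LinearMap.ker h) ≤ 2 * Nat.card F := by
    have := Fintype.ofFinite F
    have := Fintype.ofFinite K
    have : Fintype (LinearMap.ker h) := Fintype.ofFinite _
    choose f hf using fun a : LinearMap.ker h => hsq a.1 a.2
    rw [Nat.card_eq_fintype_card, Nat.card_eq_fintype_card, ← Finset.card_univ, ← Finset.card_univ]
    refine Finset.card_le_mul_card_image_of_maps_to (f := f)
      (fun _ _ => Finset.mem_univ _) _ fun c _ => ?_
    by_cases hc : ∃ a, f a = c
    · obtain ⟨a, rfl⟩ := hc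
      refine (Finset.card_le_card (t := {a, -a}) ?_).trans Finset.card_le_two
      intro b hb
      have hb' : f b = f a := (Finset.mem_filter.mp hb).2
      have : (b : K) ^ 2 = (a : K) ^ 2 := by rw [← hf, ← hf, hb']
      rcases sq_eq_sq_iff_eq_or_eq_neg.mp this with h | h
      · simp [Subtype.ext h]
      · have : b = -a := Subtype.ext h
        simp [this]
    · rw [Finset.card_eq_zero.mpr]
      · omega
      · rw [Finset.filter_eq_empty_iff]
        exact fun {a} _ h => hc ⟨a, h⟩
  have := FieldSplit.card_mul_ker h h0
  rw [← this]; nlinarith [Nat.zero_le (Nat.card F)]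

end Hua

namespace FieldSplit

variable {F K V : Type*} [Field F] [Field K] [Algebra F K] [AddCommGroup V] [Module F V]
variable {Γ : Subgroup (V ≃ₗ[F] V)} {s : FieldSplit F K V} {P X E : Submodule F V}
variable {T : Subgroup Kˣ} {g M : ℕ}

/-- The subspace spanned by `E` and the summands whose complements contain `E` and `x`. -/
def polar (Γ : Subgroup (V ≃ₗ[F] V)) (s : FieldSplit F K V) (E : Submodule F V) (x : V) :
    Submodule F V := E ⊔ spanW Γ s (E ⊔ Submodule.span F {x})

theorem sup_span_map {γ : V ≃ₗ[F] V} (hfix : ∀ e ∈ E, γ e = e) (x : V) :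
    (E ⊔ Submodule.span F {x}).map γ.toLinearMap = E ⊔ Submodule.span F {γ x} := by
  rw [Submodule.map_sup, map_eq_of_fix hfix, Submodule.map_span, Set.image_singleton]; rfl

theorem polar_map {γ : V ≃ₗ[F] V} (hγ : γ ∈ Γ) (hfix : ∀ e ∈ E, γ e = e) (x : V) :
    polar Γ s E (γ x) = (polar Γ s E x).map γ.toLinearMap := by
  rw [polar, polar, Submodule.map_sup, map_eq_of_fix hfix, ← sup_span_map hfix, spanW_map hγ]

theorem sup_span_eq {x y : V} (hy : y ∉ E) (h : y ∈ E ⊔ Submodule.span F {x}) :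
    E ⊔ Submodule.span F {y} = E ⊔ Submodule.span F {x} := by
  obtain ⟨e, he, z, hz, rfl⟩ := Submodule.mem_sup.mp h
  obtain ⟨c, rfl⟩ := Submodule.mem_span_singleton.mp hz
  have hc : c ≠ 0 := by rintro rfl; simp [he] at hy
  refine le_antisymm (sup_le le_sup_left ?_) (sup_le le_sup_left ?_)
  · rw [Submodule.span_singleton_le_iff_mem]; exact h
  · rw [Submodule.span_singleton_le_iff_mem]
    have h2 : x = c⁻¹ • ((e + c • x) - e) := by rw [add_sub_cancel_left, inv_smul_smul₀ hc]
    suffices h3 : c⁻¹ • ((e + c • x) - e) ∈ E ⊔ Submodule.span F {e + c • x} by rwa [← h2] at h3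
    refine Submodule.smul_mem _ _ (Submodule.sub_mem _ ?_ (Submodule.mem_sup_left he))
    exact Submodule.mem_sup_right (Submodule.mem_span_singleton_self _)

theorem polar_congr {x y : V} (h : E ⊔ Submodule.span F {y} = E ⊔ Submodule.span F {x}) :
    polar Γ s E y = polar Γ s E x := by
  rw [polar, polar, h]

theorem polar_smul {x : V} {c : F} (hc : c ≠ 0) : polar Γ s E (c • x) = polar Γ s E x :=
  polar_congr (by rw [Submodule.span_singleton_smul_eq (IsUnit.mk0 c hc)])

theorem mem_fam_sup_span {r : FieldSplit F K V} {x : V} :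
    r ∈ fam Γ s (E ⊔ Submodule.span F {x}) ↔ r ∈ fam Γ s E ∧ x ∈ r.U := by
  constructor
  · rintro ⟨γ, hγ, rfl, h⟩
    exact ⟨⟨γ, hγ, rfl, le_sup_left.trans h⟩, h (Submodule.mem_sup_right
      (Submodule.mem_span_singleton_self _))⟩
  · rintro ⟨⟨γ, hγ, rfl, h⟩, h'⟩
    exact ⟨γ, hγ, rfl, sup_le h (by rwa [Submodule.span_singleton_le_iff_mem])⟩

theorem W_le_ker_iff [Finite F] [Finite V] [Finite K] (hE : TransOff Γ E) {x : V} (hx : x ∉ E)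
    {l : V →ₗ[F] F} (hl0 : l ≠ 0) (hl : polar Γ s E x ≤ LinearMap.ker l)
    {r : FieldSplit F K V} (hr : r ∈ fam Γ s E) : x ∈ r.U ↔ r.W ≤ LinearMap.ker l := by
  classical
  have := Fintype.ofFinite (FieldSplit F K V)
  have hc := card_fam_U_eq_card_fam_ker (s := s) hE hx hl0
      (fun e he => hl (Submodule.mem_sup_left he))
  have hsub : ∀ r, r ∈ fam Γ s E ∧ x ∈ r.U → r ∈ fam Γ s E ∧ r.W ≤ LinearMap.ker l := by
    intro r hr
    refine ⟨hr.1, le_trans ?_ hl⟩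
    refine le_trans ?_ le_sup_right
    exact le_iSup₂_of_le r (mem_fam_sup_span.mpr hr) le_rfl
  have heq := Finset.eq_of_subset_of_card_le
    (s := (Finset.univ.filter fun r => r ∈ fam Γ s E ∧ x ∈ r.U))
    (t := (Finset.univ.filter fun r => r ∈ fam Γ s E ∧ r.W ≤ LinearMap.ker l))
    (fun r hr => by simpa using hsub r (by simpa using hr)) hc.ge
  have := Finset.ext_iff.mp heq r
  simpa [hr] using this

theorem sup_span_eq_of_common [Finite F] [Finite V] [Finite K] (hE : TransOff Γ E)
    (hC : ∀ x ∉ E, coreU Γ s (E ⊔ Submodule.span F {x}) = E ⊔ Submodule.span F {x})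
    {x y : V} (hx : x ∉ E) (hy : y ∉ E)
    {l : V →ₗ[F] F} (hl0 : l ≠ 0) (hlx : polar Γ s E x ≤ LinearMap.ker l)
    (hly : polar Γ s E y ≤ LinearMap.ker l) : y ∈ E ⊔ Submodule.span F {x} := by
  rw [← hC x hx, coreU]
  simp only [Submodule.mem_iInf]
  intro r hr
  rw [mem_fam_sup_span] at hr
  rw [W_le_ker_iff hE hy hl0 hly hr.1, ← W_le_ker_iff hE hx hl0 hlx hr.1]
  exact hr.2

theorem card_polar_eq [Finite V] (hE : TransOff Γ E) {x y : V} (hx : x ∉ E) (hy : y ∉ E) :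
    Nat.card (polar Γ s E x) = Nat.card (polar Γ s E y) := by
  obtain ⟨γ, hγ, hf, c, hc, e⟩ := hE x hx y hy
  rw [← polar_smul hc (x := y), ← e, polar_map hγ hf]
  exact Nat.card_congr (γ.submoduleMap _).toEquiv

open Finset in
open Classical in
theorem card_le_card_polar_mul [Finite F] [Finite V] [Finite K] (hE : TransOff Γ E)
    (hC : ∀ x ∉ E, coreU Γ s (E ⊔ Submodule.span F {x}) = E ⊔ Submodule.span F {x})
    {x : V} (hx : x ∉ E) : Nat.card V ≤ Nat.card (polar Γ s E x) * Nat.card F := by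
  have := Fintype.ofFinite V
  have : Module.Finite F V := Module.Finite.of_finite
  have : Finite (V →ₗ[F] F) := Module.finite_of_finite F
  have : Fintype (V →ₗ[F] F) := Fintype.ofFinite _
  have hsd : ∀ (A : Submodule F V), #{y | y ∈ A} = Nat.card A := fun A => by
    rw [Nat.card_eq_fintype_card]; exact (Fintype.card_subtype _).symm
  -- cardinality of annihilators
  have hann : ∀ A : Submodule F V, #{l : V →ₗ[F] F | A ≤ LinearMap.ker l} * Nat.card A =
      Nat.card V := by
    intro A
    have e1 : #{l : V →ₗ[F] F | A ≤ LinearMap.ker l} = Nat.card A.dualAnnihilator := by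
      rw [Nat.card_eq_fintype_card, ← Fintype.card_subtype]
      refine Fintype.card_congr (Equiv.subtypeEquivRight fun l => ?_)
      rw [Submodule.mem_dualAnnihilator]
      exact Iff.rfl
    rw [e1, Module.natCard_eq_pow_finrank (K := F), Module.natCard_eq_pow_finrank (K := F) (V := A),
      Module.natCard_eq_pow_finrank (K := F) (V := V), ← pow_add, add_comm,
      Subspace.finrank_add_finrank_dualAnnihilator_eq]
  set R : Finset V := {y | y ∉ E} with hR
  set L : Finset (V →ₗ[F] F) := ({l | E ≤ LinearMap.ker l} : Finset _).erase 0 with hL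
  obtain ⟨N, hN⟩ : ∃ N, #{l : V →ₗ[F] F | polar Γ s E x ≤ LinearMap.ker l} = N := ⟨_, rfl⟩
  have hNc := hann (polar Γ s E x)
  rw [hN] at hNc
  have hNy : ∀ y ∈ R, #{l : V →ₗ[F] F | polar Γ s E y ≤ LinearMap.ker l} = N := by
    intro y hy
    have h1 := hann (polar Γ s E y)
    rw [card_polar_eq hE (by simpa [hR] using hy) hx, ← hNc] at h1
    exact Nat.eq_of_mul_eq_mul_right Nat.card_pos h1
  have hER : #R + Nat.card E = Nat.card V := by
    have := Finset.card_filter_add_card_filter_not (s := (univ : Finset V)) (fun y => y ∈ E)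
    rw [hsd, Finset.card_univ, ← Nat.card_eq_fintype_card, add_comm] at this
    rw [hR, ← this]
  have hq : 1 < Nat.card F := Finite.one_lt_card
  have hdc := Finset.sum_card_bipartiteAbove_eq_sum_card_bipartiteBelow (s := R) (t := L)
    (fun y l => polar Γ s E y ≤ LinearMap.ker l)
  simp only [bipartiteAbove, bipartiteBelow] at hdc
  have h1 : ∀ y ∈ R, #{l ∈ L | polar Γ s E y ≤ LinearMap.ker l} = N - 1 := by
    intro y hy
    rw [← hNy y hy, ← Finset.card_erase_of_mem (a := (0 : V →ₗ[F] F)) (by simp)]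
    congr 1; ext l
    simp only [hL, mem_filter, mem_erase, mem_univ, true_and]
    constructor
    · rintro ⟨⟨h1, _⟩, h2⟩; exact ⟨h1, h2⟩
    · rintro ⟨h1, h2⟩; exact ⟨⟨h1, le_sup_left.trans h2⟩, h2⟩
  have h2 : ∀ l ∈ L, #{y ∈ R | polar Γ s E y ≤ LinearMap.ker l} ≤ Nat.card E *
      (Nat.card F - 1) := by
    intro l hl
    have hl0 : l ≠ 0 := (Finset.mem_erase.mp hl).1
    rcases Finset.eq_empty_or_nonempty ({y ∈ R | polar Γ s E y ≤ LinearMap.ker l} : Finset V) with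
      he | ⟨y, hy⟩
    · rw [he]; simp
    · simp only [hR, mem_filter, mem_univ, true_and] at hy
      have hsub : ({z ∈ R | polar Γ s E z ≤ LinearMap.ker l} : Finset V)
          ⊆ ({z | z ∈ E ⊔ Submodule.span F {y}} : Finset V) \ ({z | z ∈ E} : Finset V) := by
        intro z hz
        simp only [hR, mem_filter, mem_univ, true_and, mem_sdiff] at hz ⊢
        exact ⟨sup_span_eq_of_common hE hC hy.1 hz.1 hl0 hy.2 hz.2, hz.1⟩
      refine (Finset.card_le_card hsub).trans ?_
      rw [Finset.card_sdiff_of_subset, hsd, hsd]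
      · have : Nat.card (E ⊔ Submodule.span F {y} : Submodule F V) ≤ Nat.card E * Nat.card F := by
          have hsur : Function.Surjective (fun p : E × F =>
              (⟨p.1 + p.2 • y, Submodule.add_mem_sup p.1.2
                (Submodule.smul_mem _ _ (Submodule.mem_span_singleton_self _))⟩ :
                (E ⊔ Submodule.span F {y} : Submodule F V))) := by
            rintro ⟨z, hz⟩
            obtain ⟨e, he, w, hw, rfl⟩ := Submodule.mem_sup.mp hz
            obtain ⟨c, rfl⟩ := Submodule.mem_span_singleton.mp hw
            exact ⟨(⟨e, he⟩, c), rfl⟩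
          rw [← Nat.card_prod]
          exact Nat.card_le_card_of_surjective _ hsur
        rw [Nat.mul_sub, mul_one]; omega
      · intro z hz
        simp only [mem_filter, mem_univ, true_and] at hz ⊢
        exact Submodule.mem_sup_left hz
  rw [Finset.sum_congr rfl h1, Finset.sum_const, smul_eq_mul] at hdc
  have h3 := Finset.sum_le_sum h2
  rw [← hdc, Finset.sum_const, smul_eq_mul] at h3
  have h4 : #L * Nat.card E = #R := by
    have := hann E
    rw [hL, Finset.card_erase_of_mem (by simp), Nat.sub_mul, this, one_mul]; omega
  rw [← mul_assoc, h4] at h3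
  have hRpos : 0 < #R := Finset.card_pos.mpr ⟨x, by simpa [hR] using hx⟩
  have h5 := Nat.le_of_mul_le_mul_left h3 hRpos
  have h6 : N ≤ Nat.card F := by omega
  rw [← hNc, mul_comm]
  exact Nat.mul_le_mul_left _ h6

/-- A proper polar space is a hyperplane. -/
theorem exists_polar_eq_ker [Finite F] [Finite V] [Finite K] (hE : TransOff Γ E)
    (hC : ∀ x ∉ E, coreU Γ s (E ⊔ Submodule.span F {x}) = E ⊔ Submodule.span F {x})
    {x : V} (hx : x ∉ E) (hD : polar Γ s E x ≠ ⊤) :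
    ∃ l : V →ₗ[F] F, l ≠ 0 ∧ polar Γ s E x = LinearMap.ker l := by
  obtain ⟨l, hl0, hl⟩ := Submodule.exists_le_ker_of_lt_top _ (lt_top_iff_ne_top.mpr hD)
  refine ⟨l, hl0, ?_⟩
  have h1 := card_le_card_polar_mul hE hC hx
  rw [← card_mul_ker l hl0] at h1
  have h2 := Nat.le_of_mul_le_mul_right h1 Nat.card_pos
  exact SetLike.coe_injective (Set.eq_of_subset_of_ncard_le hl h2 (Set.toFinite _))

theorem polar_symm [Finite F] [Finite V] [Finite K] (h : Setup Γ s P T g M) (hE : TransOff Γ E)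
    (hC : ∀ x ∉ E, coreU Γ s (E ⊔ Submodule.span F {x}) = E ⊔ Submodule.span F {x})
    (hne : ∀ x ∉ E, (markedFam Γ s P (E ⊔ Submodule.span F {x})).Nonempty)
    (hdim : Module.finrank F E + 2 ≤ Module.finrank F s.U)
    {x y : V} (hx : x ∉ E) (hy : y ∉ E) (hxy : y ∈ polar Γ s E x) : x ∈ polar Γ s E y := by
  have : Module.Finite F V := Module.Finite.of_finite
  by_cases hyX : y ∈ E ⊔ Submodule.span F {x}
  · have h1 := sup_span_eq hy hyX
    have hxX : x ∈ E ⊔ Submodule.span F {x} := Submodule.mem_sup_right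
        (Submodule.mem_span_singleton_self _)
    rw [← h1] at hxX
    obtain ⟨e, he, z, hz, hez⟩ := Submodule.mem_sup.mp hxX
    obtain ⟨c, rfl⟩ := Submodule.mem_span_singleton.mp hz
    rw [← hez]
    refine Submodule.add_mem _ (Submodule.mem_sup_left he) (Submodule.smul_mem _ _ ?_)
    rwa [polar_congr h1]
  obtain ⟨e, he, y0, hy0, rfl⟩ := Submodule.mem_sup.mp hxy
  have hy0X : y0 ∉ E ⊔ Submodule.span F {x} := fun h' =>
    hyX (Submodule.add_mem _ (Submodule.mem_sup_left he) h')
  have hy0E : y0 ∉ E := fun h' => hy0X (Submodule.mem_sup_left h')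
  have hpol : polar Γ s E (e + y0) = polar Γ s E y0 := by
    refine polar_congr (sup_span_eq hy ?_)
    exact Submodule.add_mem_sup he (Submodule.mem_span_singleton_self _)
  rw [hpol]
  by_cases htop : polar Γ s E y0 = ⊤
  · rw [htop]; trivial
  obtain ⟨r, hrm, hyr⟩ := h.exists_marked (hC x hx) (hne x hx) hy0 hy0X
  have hr := mem_fam_sup_span.mp (markedFam_subset h.P_le hrm)
  obtain ⟨l, hl0, hl⟩ := exists_polar_eq_ker hE hC hy0E htop
  obtain ⟨u, huU, hul, huE⟩ : ∃ u ∈ r.U, l u = 0 ∧ u ∉ E := by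
    by_contra! hcon
    have hle : r.U ⊓ LinearMap.ker l ≤ E := fun u hu => hcon u hu.1 hu.2
    have h1 := Submodule.finrank_mono hle
    have h2 := Submodule.finrank_sup_add_finrank_inf_eq r.U (LinearMap.ker l)
    have h3 := l.finrank_range_add_finrank_ker
    have h4 : Module.finrank F (LinearMap.range l) ≤ 1 := by
      simpa using Submodule.finrank_le (LinearMap.range l)
    have h5 := Submodule.finrank_le (r.U ⊔ LinearMap.ker l)
    have h6 : Module.finrank F r.U = Module.finrank F s.U := by
      obtain ⟨γ, _, rfl, _⟩ := hr.1
      rw [conj_U]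
      exact LinearEquiv.finrank_map_eq γ s.U
    omega
  obtain ⟨δ, hδ, hfix, c, hc, e1⟩ := hE u huE x hx
  have hr' : r.conj δ ∈ fam Γ s (E ⊔ Submodule.span F {x}) := by
    rw [mem_fam_sup_span]
    refine ⟨conj_mem_fam_of_fix hr.1 hδ hfix, ?_⟩
    rw [conj_U]
    have : δ u ∈ r.U.map δ.toLinearMap := ⟨u, huU, rfl⟩
    rw [e1] at this
    exact (Submodule.smul_mem_iff _ hc).mp this
  have hδW : δ y0 ∈ (r.conj δ).W := by rw [conj_W]; exact ⟨y0, hyr, rfl⟩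
  have hδY : δ y0 ∈ spanW Γ s (E ⊔ Submodule.span F {x}) :=
      (le_iSup₂_of_le _ hr' le_rfl : (r.conj δ).W ≤ _) hδW
  have hδX : δ y0 ∉ E ⊔ Submodule.span F {x} := by
    intro h'
    have hU : E ⊔ Submodule.span F {x} ≤ (r.conj δ).U := by
      obtain ⟨_, _, _, h⟩ := hr'; exact h
    have := eq_zero_of_mem hδW (hU h')
    rw [map_eq_zero_iff δ δ.injective] at this
    exact hy0E (this ▸ E.zero_mem)
  obtain ⟨ε, hε, hεfix, c', hc', e2⟩ := h.transitive_spanW (hC x hx) (hne x hx) hδY hδX hy0 hy0X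
  have h3 : ε (δ u) ∈ polar Γ s E (ε (δ y0)) := by
    rw [polar_map hε (fun z hz => hεfix z (Submodule.mem_sup_left hz)), polar_map hδ hfix]
    refine ⟨_, ⟨u, ?_, rfl⟩, rfl⟩
    rw [hl]; exact hul
  rw [e2, polar_smul hc', e1, map_smul,
    hεfix x (Submodule.mem_sup_right (Submodule.mem_span_singleton_self _))] at h3
  exact (Submodule.smul_mem_iff _ hc).mp h3

theorem polar_eq_top [Finite F] [Finite V] [Finite K] (h : Setup Γ s P T g M) (hE : TransOff Γ E)
    (hC : ∀ x ∉ E, coreU Γ s (E ⊔ Submodule.span F {x}) = E ⊔ Submodule.span F {x})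
    (hne : ∀ x ∉ E, (markedFam Γ s P (E ⊔ Submodule.span F {x})).Nonempty)
    (hdim : Module.finrank F E + 2 ≤ Module.finrank F s.U)
    (hK : 2 * Nat.card F ^ 2 < Nat.card K) {x : V} (hx : x ∉ E) : polar Γ s E x = ⊤ := by
  by_contra hD
  have hDy : ∀ y ∉ E, polar Γ s E y ≠ ⊤ := by
    intro y hy hy'
    obtain ⟨γ, hγ, hf, c, hc, e⟩ := hE x hx y hy
    have h1 : polar Γ s E (γ x) = ⊤ := by rw [e, polar_smul hc, hy']
    rw [polar_map hγ hf] at h1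
    apply hD
    rw [← map_inv_map γ (polar Γ s E x), h1, Submodule.map_top]
    exact LinearEquiv.range γ⁻¹
  obtain ⟨r, γ, hγ, rfl, hEP⟩ := hne x hx
  have hEP' : E ≤ P.map γ.toLinearMap := le_sup_left.trans hEP
  have hrE : s.conj γ ∈ fam Γ s E :=
    ⟨γ, hγ, rfl, hEP'.trans (by rw [conj_U]; exact Submodule.map_mono h.P_le)⟩
  have hEU : E ≤ (s.conj γ).U := by obtain ⟨_, _, _, h⟩ := hrE; exact h
  set r := s.conj γ with hr
  have hnot : ∀ t : K, t ≠ 0 → r.ι t ∉ E := fun t ht h' =>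
    ht (r.iota_injective (by rw [eq_zero_of_mem (r.iota_mem_W t) (hEU h'), map_zero]))
  obtain ⟨l, hl0, hl⟩ := exists_polar_eq_ker hE hC (hnot 1 one_ne_zero) (hDy _ (hnot 1 one_ne_zero))
  have hW : ¬ r.W ≤ LinearMap.ker l := by
    rw [← W_le_ker_iff hE (hnot 1 one_ne_zero) hl0 hl.le hrE]
    intro h'
    exact hnot 1 one_ne_zero ((eq_zero_of_mem (r.iota_mem_W 1) h') ▸ E.zero_mem)
  have hcyc : ∀ t u : K, t ≠ 0 → u ≠ 0 → (r.ι u ∈ polar Γ s E (r.ι t) ↔ l (r.ι (u / t)) = 0) := by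
    intro t u ht hu
    obtain ⟨δ, hδ, c, hc, hfix, hδc⟩ := h.cyc (Units.mk0 t ht)
    have hε : γ * δ * γ⁻¹ ∈ Γ := Γ.mul_mem (Γ.mul_mem hγ hδ) (Γ.inv_mem hγ)
    have hεfix : ∀ e ∈ E, (γ * δ * γ⁻¹) e = e := by
      intro e he
      obtain ⟨p, hp, rfl⟩ := hEP' he
      change γ (δ (γ.symm (γ p))) = γ p
      rw [γ.symm_apply_apply, hfix p hp]
    have hει : ∀ k, (γ * δ * γ⁻¹) (r.ι k) = c • r.ι (t * k) := by
      intro k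
      change γ (δ (γ.symm (γ (s.ι k)))) = c • γ (s.ι (t * k))
      rw [γ.symm_apply_apply, hδc, map_smul]; rfl
    have h1 := polar_map (s := s) hε hεfix (r.ι 1)
    rw [hει, mul_one, polar_smul hc] at h1
    have h2 : r.ι u = c⁻¹ • (γ * δ * γ⁻¹) (r.ι (u / t)) := by
      rw [hει, mul_div_cancel₀ _ ht, inv_smul_smul₀ hc]
    rw [h1, h2, Submodule.smul_mem_iff _ (inv_ne_zero hc), hl]
    constructor
    · rintro ⟨z, hz, he⟩
      rw [← (γ * δ * γ⁻¹).injective he]; exact hz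
    · intro hz; exact ⟨_, hz, rfl⟩
  have := card_le_of_ker_inv_closed (l ∘ₗ r.ι) (fun h0 => hW (by
    rintro _ ⟨k, rfl⟩
    exact LinearMap.congr_fun h0 k)) (fun a ha => by
    by_cases ha0 : a = 0
    · rw [ha0, inv_zero, map_zero]
    have h1 := (hcyc 1 a one_ne_zero ha0).mpr (by rw [div_one]; exact ha)
    have h2 := polar_symm h hE hC hne hdim (hnot 1 one_ne_zero) (hnot a ha0) h1
    have h3 := (hcyc a 1 ha0 one_ne_zero).mp h2
    rw [one_div] at h3
    exact h3)
  omega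

end FieldSplit

namespace FieldSplit

variable {F K V : Type*} [Field F] [Field K] [Algebra F K] [AddCommGroup V] [Module F V]
variable {Γ : Subgroup (V ≃ₗ[F] V)} {s : FieldSplit F K V} {P X E : Submodule F V}
variable {T : Subgroup Kˣ} {g M : ℕ}

theorem exists_le_finrank_eq (A : Submodule F V) {d : ℕ}
    (hd : d ≤ Module.finrank F A) : ∃ E ≤ A, Module.finrank F E = d := by
  obtain ⟨f, hf⟩ := exists_linearIndependent_of_le_finrank hd
  refine ⟨(Submodule.span F (Set.range f)).map A.subtype, Submodule.map_subtype_le _ _, ?_⟩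
  rw [← (Submodule.equivMapOfInjective A.subtype A.injective_subtype _).finrank_eq,
    finrank_span_eq_card hf, Fintype.card_fin]

theorem finrank_sup_span_singleton [Module.Finite F V] {x : V} (hx : x ∉ E) :
    Module.finrank F (E ⊔ Submodule.span F {x} : Submodule F V) = Module.finrank F E + 1 := by
  have h1 := Submodule.finrank_sup_add_finrank_inf_eq E (Submodule.span F {x})
  have hx0 : x ≠ 0 := fun h => hx (h ▸ E.zero_mem)
  rw [finrank_span_singleton hx0] at h1
  have h2 : E ⊓ Submodule.span F {x} = ⊥ := by
    rw [← disjoint_iff, Submodule.disjoint_span_singleton' hx0]; exact hx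
  rw [h2, finrank_bot] at h1
  exact h1

theorem exists_sup_span [Module.Finite F V] {d : ℕ} (hX : Module.finrank F X = d + 1) :
    ∃ (E : Submodule F V) (x : V), x ∉ E ∧ Module.finrank F E = d ∧ X = E ⊔ Submodule.span F
      {x} := by
  obtain ⟨E, hEX, hE⟩ := exists_le_finrank_eq X (d := d) (by omega)
  obtain ⟨x, hxX, hxE⟩ : ∃ x ∈ X, x ∉ E := by
    by_contra! h
    have := Submodule.finrank_mono (show X ≤ E from h)
    omega
  refine ⟨E, x, hxE, hE, ?_⟩
  refine (Submodule.eq_of_le_of_finrank_eq (sup_le hEX ?_) ?_).symm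
  · rwa [Submodule.span_singleton_le_iff_mem]
  · rw [finrank_sup_span_singleton hxE, hE, hX]

/-- Transitivity on subspaces of a given dimension. -/
def TransDim (Γ : Subgroup (V ≃ₗ[F] V)) (d : ℕ) : Prop :=
  ∀ X Y : Submodule F V, Module.finrank F X = d → Module.finrank F Y = d →
    ∃ γ ∈ Γ, X.map γ.toLinearMap = Y

/-- There is no invariant closure operation on subspaces of dimension `f + 1` with larger values
of dimension at most `u`. -/
def NoSystem (Γ : Subgroup (V ≃ₗ[F] V)) (u f : ℕ) : Prop :=
  ∀ (S : Submodule F V → Submodule F V) (σ : ℕ), f + 2 ≤ σ → σ ≤ u →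
    (∀ X : Submodule F V, Module.finrank F X = f + 1 → X ≤ S X ∧ Module.finrank F (S X) = σ) →
    (∀ X X' : Submodule F V, Module.finrank F X = f + 1 → Module.finrank F X' = f + 1 → X' ≤ S X →
      S X' = S X) →
    (∀ γ ∈ Γ, ∀ X : Submodule F V, Module.finrank F X = f + 1 →
      S (X.map γ.toLinearMap) = (S X).map γ.toLinearMap) → False

/-- No proper nonzero invariant subspace. -/
def IrredOn (Γ : Subgroup (V ≃ₗ[F] V)) : Prop :=
  ∀ Q : Submodule F V, (∀ γ ∈ Γ, Q.map γ.toLinearMap = Q) → Q = ⊥ ∨ Q = ⊤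

theorem transDim_succ [Module.Finite F V] {d : ℕ}
    (h1 : ∀ X : Submodule F V, Module.finrank F X = d → TransOff Γ X) (h2 : TransDim Γ d) :
    TransDim Γ (d + 1) := by
  intro X Y hX hY
  obtain ⟨E, x, hx, hE, rfl⟩ := exists_sup_span hX
  obtain ⟨E', y, hy, hE', rfl⟩ := exists_sup_span hY
  obtain ⟨γ, hγ, rfl⟩ := h2 E E' hE hE'
  have hγx : γ x ∉ E.map γ.toLinearMap := by
    rintro ⟨z, hz, hzx⟩
    exact hx (γ.injective hzx ▸ hz)
  obtain ⟨δ, hδ, hfix, c, hc, e⟩ := h1 _ hE' _ hγx y hy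
  refine ⟨δ * γ, Γ.mul_mem hδ hγ, ?_⟩
  rw [map_mul_equiv, Submodule.map_sup _ _ γ.toLinearMap, Submodule.map_span, Set.image_singleton]
  change (E.map γ.toLinearMap ⊔ Submodule.span F {γ x}).map δ.toLinearMap = _
  rw [sup_span_map hfix, e, Submodule.span_singleton_smul_eq (IsUnit.mk0 c hc)]

theorem markedFam_nonempty (htr : TransDim Γ (Module.finrank F X))
    (hP : Module.finrank F X ≤ Module.finrank F P) :
    (markedFam Γ s P X).Nonempty := by
  obtain ⟨Y, hYP, hY⟩ := exists_le_finrank_eq P hP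
  obtain ⟨γ, hγ, rfl⟩ := htr Y X hY rfl
  exact ⟨s.conj γ, γ, hγ, rfl, Submodule.map_mono hYP⟩

theorem U_ne_top (s : FieldSplit F K V) : s.U ≠ ⊤ := by
  intro h
  have h1 : s.ι 1 ∈ s.U := h ▸ Submodule.mem_top
  rw [mem_U, s.proj] at h1
  exact one_ne_zero h1

theorem finrank_conj_U (s : FieldSplit F K V) (γ : V ≃ₗ[F] V) :
    Module.finrank F (s.conj γ).U = Module.finrank F s.U := by
  rw [conj_U]; exact LinearEquiv.finrank_map_eq γ s.U

theorem coreU_eq_self [Module.Finite F V] {f : ℕ} (hP : P ≤ s.U)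
    (hns : NoSystem Γ (Module.finrank F s.U) f)
    (hf : f + 1 ≤ Module.finrank F P) (htr : TransDim Γ (f + 1)) (hX : Module.finrank F X = f + 1) :
    coreU Γ s X = X := by
  by_contra hne
  have hσ : ∀ Y : Submodule F V, Module.finrank F Y = f + 1 →
      Module.finrank F (coreU Γ s Y) = Module.finrank F (coreU Γ s X) := by
    intro Y hY
    obtain ⟨γ, hγ, rfl⟩ := htr X Y hX hY
    rw [coreU_map hγ]
    exact LinearEquiv.finrank_map_eq γ _
  refine hns (coreU Γ s) (Module.finrank F (coreU Γ s X)) ?_ ?_ (fun Y hY => ⟨le_coreU, hσ Y hY⟩) ?_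
    (fun γ hγ Y _ => coreU_map hγ Y)
  · have := Submodule.finrank_lt_finrank_of_lt (lt_of_le_of_ne (le_coreU (Γ := Γ) (s := s))
    (Ne.symm hne))
    omega
  · obtain ⟨r, hr⟩ := markedFam_nonempty (s := s) (X := X) (by rwa [hX]) (hX ▸ hf)
    have hr' := markedFam_subset hP hr
    obtain ⟨γ, _, rfl, _⟩ := id hr'
    rw [← finrank_conj_U s γ]
    exact Submodule.finrank_mono (iInf₂_le _ hr')
  · intro Y Y' hY hY' hle
    refine Submodule.eq_of_le_of_finrank_eq ?_ (by rw [hσ _ hY, hσ _ hY'])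
    refine le_iInf₂ fun r hr => iInf₂_le r ?_
    obtain ⟨γ, hγ, rfl, h⟩ := id hr
    exact ⟨γ, hγ, rfl, hle.trans (iInf₂_le _ hr)⟩

theorem Setup.transOff_bot [Finite F] [Finite V] [Finite K] (h : Setup Γ s P T g M)
    (hirr : IrredOn Γ) : TransOff Γ (⊥ : Submodule F V) := by
  have hs : s ∈ markedFam Γ s P (⊥ : Submodule F V) := ⟨1, Γ.one_mem, rfl, bot_le⟩
  have hC : coreU Γ s (⊥ : Submodule F V) = ⊥ := by
    refine (hirr _ fun γ hγ => ?_).resolve_right fun htop => ?_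
    · rw [← coreU_map hγ, Submodule.map_bot]
    · exact U_ne_top s (top_le_iff.mp (htop ▸ iInf₂_le s (markedFam_subset h.P_le hs)))
  have hY : spanW Γ s (⊥ : Submodule F V) = ⊤ := by
    refine (hirr _ fun γ hγ => ?_).resolve_left fun hbot => ?_
    · rw [← spanW_map hγ, Submodule.map_bot]
    · have h1 : s.ι 1 ∈ spanW Γ s (⊥ : Submodule F V) :=
        (le_iSup₂_of_le s (markedFam_subset h.P_le hs) le_rfl : s.W ≤ _) (s.iota_mem_W 1)
      rw [hbot, Submodule.mem_bot, map_eq_zero_iff s.ι s.iota_injective] at h1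
      exact one_ne_zero h1
  intro v hv w hw
  obtain ⟨γ, hγ, hf, c, hc, e⟩ := h.transitive_spanW hC ⟨s, hs⟩ (hY ▸ Submodule.mem_top) hv
    (hY ▸ Submodule.mem_top) hw
  exact ⟨γ, hγ, hf, c, hc, e⟩

/-- The main induction: pointwise stabilisers of small subspaces are transitive off them. -/
theorem Setup.transOff [Finite F] [Finite V] [Finite K] (h : Setup Γ s P T g M)
    (hirr : IrredOn Γ) (hK : 2 * Nat.card F ^ 2 < Nat.card K)
    (hns : ∀ f, f + 2 ≤ Module.finrank F P → NoSystem Γ (Module.finrank F s.U) f) (d : ℕ)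
    (hd : d < Module.finrank F P) :
    (∀ X : Submodule F V, Module.finrank F X = d → TransOff Γ X) ∧ TransDim Γ d := by
  have hfin : Module.Finite F V := Module.Finite.of_finite
  have hPU := Submodule.finrank_mono h.P_le
  induction d with
  | zero =>
    refine ⟨fun X hX => ?_, fun X Y hX hY => ⟨1, Γ.one_mem, ?_⟩⟩
    · rw [Submodule.finrank_eq_zero] at hX
      rw [hX]; exact h.transOff_bot hirr
    · rw [Submodule.finrank_eq_zero] at hX hY
      rw [hX, hY, Submodule.map_bot]
  | succ f ih =>
    obtain ⟨hgood, htr⟩ := ih (by omega)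
    have htr' := transDim_succ hgood htr
    refine ⟨fun X hX => ?_, htr'⟩
    have hC : ∀ X : Submodule F V, Module.finrank F X = f + 1 → coreU Γ s X = X := fun X hX =>
      coreU_eq_self h.P_le (hns f (by omega)) (by omega) htr' hX
    have hne : ∀ X : Submodule F V, Module.finrank F X = f + 1 → (markedFam Γ s P X).Nonempty :=
      fun X hX => markedFam_nonempty (hX ▸ htr') (by omega)
    have hY : spanW Γ s X = ⊤ := by
      by_contra hYne
      obtain ⟨l, hl0, hl⟩ := Submodule.exists_le_ker_of_lt_top _ (lt_top_iff_ne_top.mpr hYne)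
      obtain ⟨E, hE, hEf⟩ := exists_le_finrank_eq (X ⊓ LinearMap.ker l) (d := f) (by
        have h2 := Submodule.finrank_sup_add_finrank_inf_eq X (LinearMap.ker l)
        have h3 := l.finrank_range_add_finrank_ker
        have h4 : Module.finrank F (LinearMap.range l) ≤ 1 := by
          simpa using Submodule.finrank_le (LinearMap.range l)
        have h5 := Submodule.finrank_le (X ⊔ LinearMap.ker l)
        omega)
      obtain ⟨x, hxX, hxE⟩ : ∃ x ∈ X, x ∉ E := by
        by_contra! hcon
        have := Submodule.finrank_mono (show X ≤ E from hcon)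
        omega
      have hXE : E ⊔ Submodule.span F {x} = X := by
        refine Submodule.eq_of_le_of_finrank_eq (sup_le (hE.trans inf_le_left) ?_) ?_
        · rwa [Submodule.span_singleton_le_iff_mem]
        · rw [finrank_sup_span_singleton hxE, hEf, hX]
      have htop := polar_eq_top h (hgood E hEf)
        (fun y hy => hC _ (by rw [finrank_sup_span_singleton hy, hEf]))
        (fun y hy => hne _ (by rw [finrank_sup_span_singleton hy, hEf])) (by omega) hK hxE
      rw [polar, hXE] at htop
      have : (⊤ : Submodule F V) ≤ LinearMap.ker l := htop ▸ sup_le (hE.trans inf_le_right) hl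
      exact hl0 (LinearMap.ext fun v => this (Submodule.mem_top))
    intro v hv w hw
    obtain ⟨γ, hγ, hf, c, hc, e⟩ := h.transitive_spanW (hC X hX) (hne X hX)
      (hY ▸ Submodule.mem_top) hv (hY ▸ Submodule.mem_top) hw
    exact ⟨γ, hγ, hf, c, hc, e⟩

end FieldSplit

namespace FieldSplit

variable {F V : Type*} [Field F] [AddCommGroup V] [Module F V]
variable {Γ : Subgroup (V ≃ₗ[F] V)} {P W' : Submodule F V}

theorem inv_eq_of_apply_eq {γ : V ≃ₗ[F] V} {z y : V} (h : γ z = y) : γ⁻¹ y = z := by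
  rw [← h]; exact γ.symm_apply_apply z

theorem apply_inv_apply (γ : V ≃ₗ[F] V) (v : V) : γ (γ⁻¹ v) = v := γ.apply_symm_apply v

theorem inv_apply_apply (γ : V ≃ₗ[F] V) (v : V) : γ⁻¹ (γ v) = v := γ.symm_apply_apply v

/-- A pointwise stabiliser that is transitive up to scalars realises every translation. -/
theorem TransOff.exists_translate {X : Submodule F V} (h : TransOff Γ X) {u t : V} (hu : u ∉ X)
    (ht : t ∈ X) : ∃ l ∈ Γ, (∀ x ∈ X, l x = x) ∧ l u = u + t := by
  have hadd : ∀ t ∈ X, u + t ∉ X := fun t ht h' => hu ((Submodule.add_mem_iff_left X ht).mp h')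
  obtain ⟨l, hl, lfix, c, hc, el⟩ := h u hu (u + t) (hadd t ht)
  by_cases hc1 : c = 1
  · exact ⟨l, hl, lfix, by rw [el, hc1, one_smul]⟩
  have hc1' : c - 1 ≠ 0 := sub_ne_zero.mpr hc1
  obtain ⟨k, hk, kfix, b, hb, ek⟩ := h u hu (u + (c / (c - 1)) • t) (hadd _ (X.smul_mem _ ht))
  obtain ⟨j, hj, jfix, a, ha, ej⟩ := h u hu (u + (c - 1)⁻¹ • t) (hadd _ (X.smul_mem _ ht))
  have e0 : (k⁻¹ * l * k) u = c • u := by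
    change k⁻¹ (l (k u)) = _
    apply inv_eq_of_apply_eq
    rw [map_smul, ek, map_smul, map_add, map_smul, lfix t ht, el]
    rw [smul_comm]
    congr 1
    have h1 : c * (c / (c - 1)) = c + c / (c - 1) := by field_simp; ring
    rw [smul_add, smul_smul, h1]
    module
  have f0 : ∀ x ∈ X, (k⁻¹ * l * k) x = x := fun x hx => by
    change k⁻¹ (l (k x)) = _
    rw [kfix x hx, lfix x hx, inv_fix kfix x hx]
  set m := k⁻¹ * l * k with hm
  have hmΓ : m ∈ Γ := Γ.mul_mem (Γ.mul_mem (Γ.inv_mem hk) hl) hk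
  refine ⟨m⁻¹ * j * m * j⁻¹, Γ.mul_mem (Γ.mul_mem (Γ.mul_mem (Γ.inv_mem hmΓ) hj) hmΓ)
    (Γ.inv_mem hj), fun x hx => ?_, ?_⟩
  · change m⁻¹ (j (m (j⁻¹ x))) = x
    rw [inv_fix jfix x hx, f0 x hx, jfix x hx, inv_fix f0 x hx]
  · change m⁻¹ (j (m (j⁻¹ u))) = _
    apply inv_eq_of_apply_eq
    have e1 : j⁻¹ u = a⁻¹ • u - (c - 1)⁻¹ • t := by
      apply inv_eq_of_apply_eq
      rw [map_sub, map_smul, map_smul, ej, jfix t ht, smul_smul, inv_mul_cancel₀ ha, one_smul]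
      abel
    rw [e1, map_sub, map_smul, e0, map_smul, f0 t ht, map_sub, map_smul, map_smul, map_smul, ej,
      jfix t ht, map_add, e0, f0 t ht]
    have e2 : t = (c - 1) • (c - 1)⁻¹ • t := by rw [smul_smul, mul_inv_cancel₀ hc1', one_smul]
    have e3 : a⁻¹ • c • a • (u + (c - 1)⁻¹ • t) = c • (u + (c - 1)⁻¹ • t) := by
      rw [smul_comm c a, smul_smul, inv_mul_cancel₀ ha, one_smul]
    rw [e3]
    conv_lhs => rw [e2]
    module

/-- Elements of `Γ` inducing every transvection on `P`. -/
theorem exists_transvection_on [Module.Finite F V]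
    (hT : ∀ X : Submodule F V, Module.finrank F X < Module.finrank F P → TransOff Γ X)
    (μ : V →ₗ[F] F) {p z : V} (hp : p ∈ P) (hμp : μ p = 0) (hz : z ∈ P) (hμz : μ z ≠ 0) :
    ∃ l ∈ Γ, ∀ v ∈ P, l v = v + μ v • p := by
  have hlt : P ⊓ LinearMap.ker μ < P :=
    lt_of_le_of_ne inf_le_left fun h => hμz (by
      have : z ∈ P ⊓ LinearMap.ker μ := h.ge hz
      exact this.2)
  have hX := hT _ (Submodule.finrank_lt_finrank_of_lt hlt)
  obtain ⟨l, hl, lfix, el⟩ := hX.exists_translate (u := z) (t := μ z • p) (fun h => hμz h.2)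
    (Submodule.smul_mem _ _ ⟨hp, hμp⟩)
  refine ⟨l, hl, fun v hv => ?_⟩
  have h1 : v - (μ v / μ z) • z ∈ P ⊓ LinearMap.ker μ :=
    ⟨P.sub_mem hv (P.smul_mem _ hz), by
      simp only [SetLike.mem_coe, LinearMap.mem_ker, map_sub, map_smul, smul_eq_mul]
      field_simp; ring⟩
  have h2 := lfix _ h1
  rw [map_sub, map_smul, el] at h2
  have h3 : l v = v - (μ v / μ z) • z + (μ v / μ z) • (z + μ z • p) := by
    rw [← h2]; abel
  rw [h3, smul_add, smul_smul, div_mul_cancel₀ _ hμz]; abel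

/-- `γ` preserves `P` and acts trivially modulo `P`. -/
def TrivMod (P : Submodule F V) (γ : V ≃ₗ[F] V) : Prop := ∀ v, γ v - v ∈ P

theorem TrivMod.mul {γ δ : V ≃ₗ[F] V} (h : TrivMod P γ) (h' : TrivMod P δ) :
    TrivMod P (γ * δ) := fun v => by
  have := P.add_mem (h (δ v)) (h' v)
  rwa [sub_add_sub_cancel] at this

theorem TrivMod.inv {γ : V ≃ₗ[F] V} (h : TrivMod P γ) : TrivMod P γ⁻¹ := fun v => by
  have := P.neg_mem (h (γ⁻¹ v))
  rwa [apply_inv_apply, neg_sub] at this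

theorem TrivMod.conj {γ δ : V ≃ₗ[F] V} (h : TrivMod P γ) (hδ : ∀ v ∈ P, δ v ∈ P) :
    TrivMod P (δ * γ * δ⁻¹) := fun v => by
  have := hδ _ (h (δ⁻¹ v))
  rwa [map_sub, apply_inv_apply] at this

theorem TrivMod.mem {γ : V ≃ₗ[F] V} (h : TrivMod P γ) {v : V} (hv : v ∈ P) : γ v ∈ P := by
  have := P.add_mem (h v) hv
  rwa [sub_add_cancel] at this

theorem exists_mem_notMem_of_finrank_lt {A B : Submodule F V} [Module.Finite F V]
    (h : Module.finrank F B < Module.finrank F A) : ∃ x ∈ A, x ∉ B := by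
  by_contra! hc
  exact absurd (Submodule.finrank_mono (show A ≤ B from hc)) (not_le.mpr h)

theorem finrank_le_inf_ker_add_one [Module.Finite F V] (A : Submodule F V) (μ : V →ₗ[F] F) :
    Module.finrank F A ≤ Module.finrank F (A ⊓ LinearMap.ker μ : Submodule F V) + 1 := by
  have h1 := Submodule.finrank_sup_add_finrank_inf_eq A (LinearMap.ker μ)
  have h2 := LinearMap.finrank_range_add_finrank_ker μ
  have h3 : Module.finrank F (LinearMap.range μ) ≤ 1 := by
    simpa using Submodule.finrank_le (LinearMap.range μ)
  have h4 := Submodule.finrank_le (A ⊔ LinearMap.ker μ)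
  omega

theorem exists_transvection_trivMod [Module.Finite F V]
    (hT : ∀ X : Submodule F V, Module.finrank F X < Module.finrank F P → TransOff Γ X)
    (hP5 : 5 ≤ Module.finrank F P) {a : V ≃ₗ[F] V} (ha : a ∈ Γ) (haP : ∀ v, a v ∈ P ↔ v ∈ P)
    (hamod : TrivMod P a) (hafix : ∀ v ∈ P, v ≠ 0 → ∀ c : F, a v ≠ c • v) {y : V} (hy : y ∈ P)
    (hy0 : y ≠ 0) :
    ∃ p ∈ P, p ≠ 0 ∧ ∃ ν : V →ₗ[F] F, ν p = 0 ∧ ν y ≠ 0 ∧ ∀ c : F, ∃ m ∈ Γ,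
      (∀ v ∈ P, m v = v + (c * ν v) • p) ∧ TrivMod P m := by
  have haP' : ∀ v ∈ P, a⁻¹ v ∈ P := fun v hv => (haP _).mp (by rwa [apply_inv_apply])
  have hy' : a⁻¹ y ≠ 0 := fun h => hy0 (by rw [← apply_inv_apply a y, h, map_zero])
  obtain ⟨p₀, hp₀, hp₀y⟩ := exists_mem_notMem_of_finrank_lt (A := P)
    (B := Submodule.span F {a⁻¹ y}) (by rw [finrank_span_singleton hy']; omega)
  have hyp : a⁻¹ y ∉ Submodule.span F {p₀} := fun h => by
    obtain ⟨c, hc⟩ := Submodule.mem_span_singleton.mp h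
    refine hp₀y (Submodule.mem_span_singleton.mpr ⟨c⁻¹, ?_⟩)
    have hc0 : c ≠ 0 := by rintro rfl; exact hy' (by rw [← hc, zero_smul])
    rw [← hc, smul_smul, inv_mul_cancel₀ hc0, one_smul]
  have hp₀0 : p₀ ≠ 0 := by rintro rfl; exact hp₀y (Submodule.zero_mem _)
  obtain ⟨μ, hμy, hμ⟩ := Submodule.exists_dual_map_eq_bot_of_notMem hyp inferInstance
  have kill : ∀ {S : Submodule F V} {μ : V →ₗ[F] F}, S.map μ = ⊥ → ∀ v ∈ S, μ v = 0 :=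
    fun h v hv => (Submodule.mem_bot F).mp (h ▸ Submodule.mem_map_of_mem hv)
  have hμp : μ p₀ = 0 := kill hμ _ (Submodule.mem_span_singleton_self _)
  let μ' : V →ₗ[F] F := μ ∘ₗ (a⁻¹).toLinearMap
  have hμ'p : μ' (a p₀) = 0 := by change μ (a⁻¹ (a p₀)) = 0; rw [inv_apply_apply, hμp]
  obtain ⟨p, ⟨⟨hpP, hpμ⟩, hpμ'⟩, hpS⟩ := exists_mem_notMem_of_finrank_lt
    (A := (P ⊓ LinearMap.ker μ) ⊓ LinearMap.ker μ') (B := Submodule.span F {p₀, a p₀}) (by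
      have h1 := finrank_le_inf_ker_add_one P μ
      have h2 := finrank_le_inf_ker_add_one (P ⊓ LinearMap.ker μ) μ'
      have h3 : Module.finrank F (Submodule.span F {p₀, a p₀}) ≤ 2 := by
        classical
        have := finrank_span_finset_le_card (R := F) ({p₀, a p₀} : Finset V)
        rw [Set.finrank, Finset.coe_pair] at this
        exact this.trans Finset.card_le_two
      omega)
  have hpμ : μ p = 0 := hpμ
  have hpμ' : μ' p = 0 := hpμ'
  have hap : a p₀ ∉ Submodule.span F {p₀, p} := fun h => by
    obtain ⟨c, d, hcd⟩ := Submodule.mem_span_pair.mp h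
    by_cases hd : d = 0
    · rw [hd, zero_smul, add_zero] at hcd
      exact hafix p₀ hp₀ hp₀0 c hcd.symm
    · refine hpS (Submodule.mem_span_pair.mpr ⟨-(d⁻¹ * c), d⁻¹, ?_⟩)
      rw [← hcd, smul_add, smul_smul, smul_smul, inv_mul_cancel₀ hd]; module
  obtain ⟨ρ, hρap, hρ⟩ := Submodule.exists_dual_map_eq_bot_of_notMem hap inferInstance
  have hρ₀ : ρ p₀ = 0 := kill hρ _ (Submodule.subset_span (by simp))
  have hρp : ρ p = 0 := kill hρ _ (Submodule.subset_span (by simp))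
  have hapP : a p₀ ∈ P := (haP _).mpr hp₀
  refine ⟨p, hpP, by rintro rfl; exact hpS (Submodule.zero_mem _), μ', hpμ', hμy, fun c => ?_⟩
  obtain ⟨t, ht, et⟩ := exists_transvection_on hT μ hp₀ hμp (haP' y hy) hμy
  obtain ⟨s, hs, es⟩ := exists_transvection_on hT ρ (P.smul_mem (-c * (ρ (a p₀))⁻¹) hpP)
    (by rw [map_smul, hρp, smul_zero]) hapP hρap
  have ht' : ∀ v ∈ P, t v ∈ P := fun v hv => by
    rw [et v hv]; exact P.add_mem hv (P.smul_mem _ hp₀)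
  have hs' : ∀ v ∈ P, s v ∈ P := fun v hv => by
    rw [es v hv]; exact P.add_mem hv (P.smul_mem _ (P.smul_mem _ hpP))
  have ti : ∀ v ∈ P, t⁻¹ v = v - μ v • p₀ := fun v hv => inv_eq_of_apply_eq (by
    rw [et _ (P.sub_mem hv (P.smul_mem _ hp₀)), map_sub, map_smul, hμp, smul_zero, sub_zero,
      sub_add_cancel])
  have si : ∀ v ∈ P, s⁻¹ v = v - ρ v • (-c * (ρ (a p₀))⁻¹) • p := fun v hv => inv_eq_of_apply_eq (by
    rw [es _ (P.sub_mem hv (P.smul_mem _ (P.smul_mem _ hpP))), map_sub, map_smul, map_smul, hρp,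
      smul_zero, smul_zero, sub_zero, sub_add_cancel])
  have wmod : TrivMod P (a * (t * a⁻¹ * t⁻¹)) := hamod.mul (hamod.inv.conj ht')
  set w := a * (t * a⁻¹ * t⁻¹) with hw
  have ew : ∀ v ∈ P, w v = v - μ v • p₀ + (μ' v - μ v * μ' p₀) • a p₀ := fun v hv => by
    change a (t (a⁻¹ (t⁻¹ v))) = _
    have h1 : μ (a⁻¹ v) = μ' v := rfl
    have h2 : μ (a⁻¹ p₀) = μ' p₀ := rfl
    have h3 : a⁻¹ (v - μ v • p₀) = a⁻¹ v - μ v • a⁻¹ p₀ := by rw [map_sub, map_smul]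
    rw [ti v hv, et _ (haP' _ (P.sub_mem hv (P.smul_mem _ hp₀))), h3, map_add, map_sub, map_smul,
      apply_inv_apply, apply_inv_apply, map_smul, map_sub, map_smul, h1, h2, smul_eq_mul]
  refine ⟨w * (s * w⁻¹ * s⁻¹), ?_, fun v hv => ?_, wmod.mul (wmod.inv.conj hs')⟩
  · have hwΓ : w ∈ Γ := Γ.mul_mem ha (Γ.mul_mem (Γ.mul_mem ht (Γ.inv_mem ha)) (Γ.inv_mem ht))
    exact Γ.mul_mem hwΓ (Γ.mul_mem (Γ.mul_mem hs (Γ.inv_mem hwΓ)) (Γ.inv_mem hs))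
  · have hx : s⁻¹ v ∈ P := by
      rw [si v hv]; exact P.sub_mem hv (P.smul_mem _ (P.smul_mem _ hpP))
    have hx2 : w⁻¹ (s⁻¹ v) ∈ P := wmod.inv.mem hx
    obtain ⟨x, hxe⟩ : ∃ x, x = w⁻¹ (s⁻¹ v) := ⟨_, rfl⟩
    have hv' : v = s (w x) := by rw [hxe, apply_inv_apply, apply_inv_apply]
    rw [← hxe] at hx2
    change w (s (w⁻¹ (s⁻¹ v))) = _
    rw [← hxe, hv']
    have ewp : w p = p := by rw [ew p hpP, hpμ, hpμ']; simp
    have hwx : w x ∈ P := wmod.mem hx2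
    rw [es x hx2, es _ hwx, map_add, map_smul, map_smul, ewp]
    have h1 : ρ (w x) = ρ x + (μ' x - μ x * μ' p₀) * ρ (a p₀) := by
      rw [ew x hx2]; simp [hρ₀]
    have h2 : μ' (w x + ρ (w x) • (-c * (ρ (a p₀))⁻¹) • p) = μ' x - μ x * μ' p₀ := by
      rw [map_add, map_smul, map_smul, hpμ', ew x hx2]; simp [hμ'p]
    rw [h2, h1, smul_smul, smul_smul, add_assoc, ← add_smul]
    congr 2
    field_simp
    ring

/-- Some vector `u ≠ 0` and functional `l ≠ 0` with all transvections `1 + c l u` in `Γ`. -/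
theorem exists_transvection_line [Module.Finite F V] (hPW : IsCompl P W')
    (hT : ∀ X : Submodule F V, Module.finrank F X < Module.finrank F P → TransOff Γ X)
    (hP5 : 5 ≤ Module.finrank F P) {a e : V ≃ₗ[F] V} (ha : a ∈ Γ) (haP : ∀ v, a v ∈ P ↔ v ∈ P)
    (haW : ∀ w ∈ W', a w = w) (hafix : ∀ v ∈ P, v ≠ 0 → ∀ c : F, a v ≠ c • v)
    (he : e ∈ Γ) (heP : ∀ v ∈ P, e v = v) (heW : ∀ w ∈ W', e w ∈ W')
    (hefix : ∀ w ∈ W', e w = w → w = 0) :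
    ∃ u : V, ∃ l : V →ₗ[F] F, u ≠ 0 ∧ l ≠ 0 ∧ l u = 0 ∧
      ∀ c : F, ∃ γ ∈ Γ, ∀ v, γ v = v + (c * l v) • u := by
  have dec : ∀ v, ∃ p ∈ P, ∃ w ∈ W', p + w = v := fun v => by
    have : v ∈ P ⊔ W' := by rw [hPW.sup_eq_top]; trivial
    exact Submodule.mem_sup.mp this
  have hamod : TrivMod P a := fun v => by
    obtain ⟨p, hp, w, hw, rfl⟩ := dec v
    rw [map_add, haW w hw, add_sub_add_right_eq_sub]
    exact P.sub_mem ((haP _).mpr hp) hp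
  by_cases hcase : ∀ g ∈ Γ, (∀ v ∈ P, g v ∈ P) → ∀ w ∈ W', g w ∈ W'
  · obtain ⟨y, hy, hy0⟩ := P.ne_bot_iff.mp (by rintro rfl; simp at hP5)
    obtain ⟨p, hp, hp0, ν, hνp, hνy, hm⟩ :=
      exists_transvection_trivMod hT hP5 ha haP hamod hafix hy hy0
    have pr1 : ∀ x ∈ P, P.projectionOnto W' hPW x = x := fun x hx =>
      congrArg Subtype.val (Submodule.projectionOnto_apply_left hPW ⟨x, hx⟩)
    have pr2 : ∀ x ∈ W', P.projectionOnto W' hPW x = 0 := fun x hx =>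
      (Submodule.projectionOnto_apply_eq_zero_iff hPW).mpr hx
    refine ⟨p, ν ∘ₗ P.subtype ∘ₗ P.projectionOnto W' hPW, hp0, fun h => hνy ?_, ?_, fun c => ?_⟩
    · have := LinearMap.congr_fun h y
      simpa [pr1 y hy] using this
    · simp [pr1 p hp, hνp]
    · obtain ⟨m, hm, em, mmod⟩ := hm c
      refine ⟨m, hm, fun v => ?_⟩
      obtain ⟨x, hx, w, hw, rfl⟩ := dec v
      have hw' : m w = w := by
        have h1 := hcase m hm (fun v hv => mmod.mem hv) w hw
        exact sub_eq_zero.mp (Submodule.disjoint_def.mp hPW.disjoint _ (mmod w)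
          (W'.sub_mem h1 hw))
      rw [map_add, em x hx, hw']
      simp only [LinearMap.comp_apply, map_add, Submodule.subtype_apply, pr1 x hx, pr2 w hw,
        map_zero, add_zero]
      abel
  push Not at hcase
  obtain ⟨g, hg, hgP, w₀, hw₀, hgw₀⟩ := hcase
  have hgP' : ∀ v ∈ P, g⁻¹ v ∈ P := by
    have h1 : P.map g.toLinearMap = P := by
      refine Submodule.eq_of_le_of_finrank_eq (Submodule.map_le_iff_le_comap.mpr hgP) ?_
      exact LinearEquiv.finrank_map_eq g P
    intro v hv
    rw [← h1] at hv
    obtain ⟨z, hz, rfl⟩ := hv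
    change g⁻¹ (g z) ∈ P
    rwa [inv_apply_apply]
  set b := g * e * g⁻¹ with hb
  have hbΓ : b ∈ Γ := Γ.mul_mem (Γ.mul_mem hg he) (Γ.inv_mem hg)
  have hbP : ∀ v ∈ P, b v = v := fun v hv => by
    change g (e (g⁻¹ v)) = v
    rw [heP _ (hgP' v hv), apply_inv_apply]
  have rmod : TrivMod P (a * (b * a⁻¹ * b⁻¹)) :=
    hamod.mul (hamod.inv.conj fun v hv => by rwa [hbP v hv])
  have haP' : ∀ v ∈ P, a⁻¹ v ∈ P := fun v hv => (haP _).mp (by rwa [apply_inv_apply])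
  have hrP : ∀ v ∈ P, (a * (b * a⁻¹ * b⁻¹)) v = v := fun v hv => by
    change a (b (a⁻¹ (b⁻¹ v))) = v
    rw [inv_eq_of_apply_eq (hbP v hv), hbP _ (haP' v hv), apply_inv_apply]
  have hrΓ : a * (b * a⁻¹ * b⁻¹) ∈ Γ :=
    Γ.mul_mem ha (Γ.mul_mem (Γ.mul_mem hbΓ (Γ.inv_mem ha)) (Γ.inv_mem hbΓ))
  have hr1 : ∃ v, (a * (b * a⁻¹ * b⁻¹)) v ≠ v := by
    by_contra! hcon
    have hcomm : ∀ v, a (b v) = b (a v) := fun v => by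
      have h1 := hcon (b (a v))
      change a (b (a⁻¹ (b⁻¹ (b (a v))))) = _ at h1
      rwa [inv_apply_apply, inv_apply_apply] at h1
    have hbW : ∀ w ∈ W', b w ∈ W' := fun w hw => by
      obtain ⟨p, hp, w', hw', h1⟩ := dec (b w)
      have h2 := hcomm w
      rw [haW w hw, ← h1, map_add, haW w' hw', add_left_inj] at h2
      have : p = 0 := by
        by_contra hp0
        exact hafix p hp hp0 1 (by rw [one_smul, h2])
      rw [← h1, this, zero_add]; exact hw'
    let f : V →ₗ[F] V := b.toLinearMap - LinearMap.id
    have hf : ∀ v, f v = b v - v := fun v => rfl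
    have hfg : ∀ v, f v ∈ W'.map g.toLinearMap := fun v => by
      obtain ⟨p, hp, w, hw, h1⟩ := dec (g⁻¹ v)
      have h2 : v = g p + g w := by rw [← map_add, h1, apply_inv_apply]
      have h3 : f v = g (e w - w) := by
        rw [hf, h2, map_add, hbP _ (hgP p hp)]
        change g p + g (e (g⁻¹ (g w))) - _ = _
        rw [inv_apply_apply, map_sub]; abel
      rw [h3]
      exact ⟨_, W'.sub_mem (heW w hw) hw, rfl⟩
    have hfinj : ∀ v ∈ W', f v = 0 → v = 0 := fun v hv h0 => by
      obtain ⟨p, hp, w, hw, h1⟩ := dec (g⁻¹ v)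
      have h2 : b v = v := sub_eq_zero.mp h0
      have h3 : e (g⁻¹ v) = g⁻¹ v := by
        have h4 : g (e (g⁻¹ v)) = v := h2
        exact (inv_eq_of_apply_eq h4).symm
      rw [← h1, map_add, heP p hp, add_right_inj] at h3
      rw [hefix w hw h3, add_zero] at h1
      have h5 : v ∈ P := by rw [← apply_inv_apply g v, ← h1]; exact hgP p hp
      exact Submodule.disjoint_def.mp hPW.disjoint _ h5 hv
    have h6 : Module.finrank F (W'.map f) = Module.finrank F W' := by
      have h7 : Function.Injective (f.domRestrict W') :=
        (injective_iff_map_eq_zero _).mpr fun x hx => Subtype.ext (hfinj x x.2 hx)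
      rw [← LinearMap.finrank_range_of_inj h7, LinearMap.range_domRestrict]
    have h8 : W'.map f ≤ W' := Submodule.map_le_iff_le_comap.mpr fun v hv =>
      W'.sub_mem (hbW v hv) hv
    have h9 := Submodule.eq_of_le_of_finrank_eq h8 h6
    have h10 : W'.map f ≤ W'.map g.toLinearMap := Submodule.map_le_iff_le_comap.mpr fun v _ => hfg v
    rw [h9] at h10
    have h11 := Submodule.eq_of_le_of_finrank_eq h10 (LinearEquiv.finrank_map_eq g W').symm
    exact hgw₀ (h11.ge ⟨w₀, hw₀, rfl⟩)
  obtain ⟨r, hr⟩ : ∃ r, r = a * (b * a⁻¹ * b⁻¹) := ⟨_, rfl⟩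
  rw [← hr] at rmod hrP hrΓ hr1
  obtain ⟨v₀, hv₀⟩ := hr1
  let φ : V →ₗ[F] V := r.toLinearMap - LinearMap.id
  have hφ : ∀ v, φ v = r v - v := fun v => rfl
  have hφP : ∀ v ∈ P, φ v = 0 := fun v hv => by rw [hφ, hrP v hv, sub_self]
  obtain ⟨p, hp, hp0, ν, hνp, hνy, hm⟩ :=
    exists_transvection_trivMod hT hP5 ha haP hamod hafix (rmod v₀) (sub_ne_zero.mpr hv₀)
  refine ⟨p, ν ∘ₗ φ, hp0, fun h => hνy (LinearMap.congr_fun h v₀), ?_, fun c => ?_⟩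
  · rw [LinearMap.comp_apply, hφP p hp, map_zero]
  obtain ⟨m, hm, em, mmod⟩ := hm c
  refine ⟨m * r * m⁻¹ * r⁻¹, Γ.mul_mem (Γ.mul_mem (Γ.mul_mem hm hrΓ) (Γ.inv_mem hm))
    (Γ.inv_mem hrΓ), fun v => ?_⟩
  obtain ⟨x, hx⟩ : ∃ x, x = m⁻¹ (r⁻¹ v) := ⟨_, rfl⟩
  have hv : v = r (m x) := by rw [hx, apply_inv_apply, apply_inv_apply]
  change m (r (m⁻¹ (r⁻¹ v))) = _
  rw [← hx, hv, LinearMap.comp_apply]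
  have e1 : ∀ z, r z = z + φ z := fun z => by rw [hφ]; abel
  have e2 : φ (m x) = φ x := by
    have := hφP _ (mmod x)
    rwa [map_sub, sub_eq_zero] at this
  have e3 : φ (r (m x)) = φ x := by
    have := hφP _ (rmod (m x))
    rwa [map_sub, sub_eq_zero, e2] at this
  rw [e3, e1 x, e1 (m x), e2, map_add, em (φ x) (rmod x)]
  abel

/-- `Γ` contains all transvections. -/
theorem exists_transvection [Module.Finite F V] (hPW : IsCompl P W')
    (hT : ∀ X : Submodule F V, Module.finrank F X < Module.finrank F P → TransOff Γ X)
    (hP5 : 5 ≤ Module.finrank F P) {a e : V ≃ₗ[F] V} (ha : a ∈ Γ) (haP : ∀ v, a v ∈ P ↔ v ∈ P)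
    (haW : ∀ w ∈ W', a w = w) (hafix : ∀ v ∈ P, v ≠ 0 → ∀ c : F, a v ≠ c • v)
    (he : e ∈ Γ) (heP : ∀ v ∈ P, e v = v) (heW : ∀ w ∈ W', e w ∈ W')
    (hefix : ∀ w ∈ W', e w = w → w = 0) (u : V) (l : V →ₗ[F] F) (hlu : l u = 0) :
    ∃ γ ∈ Γ, ∀ v, γ v = v + l v • u := by
  obtain ⟨u₀, l₀, hu₀, hl₀, hl₀u, hΓ⟩ :=
    exists_transvection_line hPW hT hP5 ha haP haW hafix he heP heW hefix
  let Φ : Submodule F (Module.Dual F V) :=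
    { carrier := {μ | μ u₀ = 0 ∧ ∀ c : F, ∃ γ ∈ Γ, ∀ v, γ v = v + (c * μ v) • u₀}
      zero_mem' := ⟨rfl, fun c => ⟨1, Γ.one_mem, fun v => by
        rw [LinearMap.zero_apply, mul_zero, zero_smul, add_zero]; rfl⟩⟩
      add_mem' := by
        rintro μ ν ⟨h1, h2⟩ ⟨h3, h4⟩
        refine ⟨by rw [LinearMap.add_apply, h1, h3, add_zero], fun c => ?_⟩
        obtain ⟨γ, hγ, eγ⟩ := h2 c
        obtain ⟨δ, hδ, eδ⟩ := h4 c
        refine ⟨γ * δ, Γ.mul_mem hγ hδ, fun v => ?_⟩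
        change γ (δ v) = _
        rw [eγ, eδ, map_add, map_smul, h1, smul_zero, add_zero, LinearMap.add_apply]
        module
      smul_mem' := by
        rintro d μ ⟨h1, h2⟩
        refine ⟨by rw [LinearMap.smul_apply, h1, smul_zero], fun c => ?_⟩
        obtain ⟨γ, hγ, eγ⟩ := h2 (c * d)
        exact ⟨γ, hγ, fun v => by rw [eγ, LinearMap.smul_apply, smul_eq_mul, mul_assoc]⟩ }
  have hl₀Φ : l₀ ∈ Φ := ⟨hl₀u, hΓ⟩
  have hD : Φ.dualCoannihilator ≤ Submodule.span F {u₀} := by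
    intro w hw
    by_contra hwu
    obtain ⟨v, hv⟩ : ∃ v, l₀ v ≠ 0 := by
      by_contra! h; exact hl₀ (LinearMap.ext h)
    have hvu : v ∉ Submodule.span F {u₀} := fun h => by
      obtain ⟨c, rfl⟩ := Submodule.mem_span_singleton.mp h
      exact hv (by rw [map_smul, hl₀u, smul_zero])
    obtain ⟨γ, hγ, γfix, c, hc, eγ⟩ := hT (Submodule.span F {u₀})
      (by rw [finrank_span_singleton hu₀]; omega) v hvu w hwu
    have hγu : γ u₀ = u₀ := γfix _ (Submodule.mem_span_singleton_self _)
    have h1 : l₀ ∘ₗ (γ⁻¹).toLinearMap ∈ Φ := by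
      refine ⟨?_, fun c => ?_⟩
      · change l₀ (γ⁻¹ u₀) = 0
        rw [inv_eq_of_apply_eq hγu, hl₀u]
      · obtain ⟨τ, hτ, eτ⟩ := hΓ c
        refine ⟨γ * τ * γ⁻¹, Γ.mul_mem (Γ.mul_mem hγ hτ) (Γ.inv_mem hγ), fun v => ?_⟩
        change γ (τ (γ⁻¹ v)) = v + (c * l₀ (γ⁻¹ v)) • u₀
        rw [eτ, map_add, map_smul, hγu, apply_inv_apply]
    have h2 : l₀ (γ⁻¹ w) = 0 := (Submodule.mem_dualCoannihilator _).mp hw _ h1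
    have h3 : w = c⁻¹ • γ v := by rw [eγ, smul_smul, inv_mul_cancel₀ hc, one_smul]
    have h4 : γ⁻¹ w = c⁻¹ • v := by
      rw [h3, map_smul, inv_apply_apply]
    rw [h4, map_smul, smul_eq_mul] at h2
    exact hv ((mul_eq_zero.mp h2).resolve_left (inv_ne_zero hc))
  have hΦ : ∀ μ : Module.Dual F V, μ u₀ = 0 → μ ∈ Φ := fun μ hμ => by
    rw [← Subspace.dualCoannihilator_dualAnnihilator_eq (W := Φ)]
    refine (Submodule.mem_dualAnnihilator _).mpr fun w hw => ?_
    obtain ⟨c, rfl⟩ := Submodule.mem_span_singleton.mp (hD hw)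
    rw [map_smul, hμ, smul_zero]
  by_cases hu : u = 0
  · exact ⟨1, Γ.one_mem, fun v => by rw [hu, smul_zero, add_zero]; rfl⟩
  obtain ⟨γ, hγ, -, c, hc, eγ⟩ := hT ⊥ (by rw [finrank_bot]; omega) u₀ (by simpa using hu₀) u
    (by simpa using hu)
  have h1 : l (γ u₀) = 0 := by rw [eγ, map_smul, hlu, smul_zero]
  obtain ⟨τ, hτ, eτ⟩ := (hΦ (l ∘ₗ γ.toLinearMap) h1).2 c⁻¹
  refine ⟨γ * τ * γ⁻¹, Γ.mul_mem (Γ.mul_mem hγ hτ) (Γ.inv_mem hγ), fun v => ?_⟩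
  change γ (τ (γ⁻¹ v)) = _
  have h2 : (l ∘ₗ γ.toLinearMap) (γ⁻¹ v) = l v := by
    change l (γ (γ⁻¹ v)) = _
    rw [apply_inv_apply]
  rw [eτ, map_add, map_smul, h2, eγ, apply_inv_apply, smul_smul, mul_right_comm,
    inv_mul_cancel₀ hc, one_mul]

end FieldSplit

namespace FieldSplit

variable {F K A B V : Type*} [Field F] [Field K] [Algebra F K] [Field A] [Algebra F A]
  [Field B] [Algebra F B] [AddCommGroup V] [Module F V]
variable {Γ : Subgroup (V ≃ₗ[F] V)} {s : FieldSplit F K V} {sA : FieldSplit F A V}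
  {sB : FieldSplit F B V}

/-- `Γ` contains enough multiplications on the summand `K` to act irreducibly on it. -/
def Rich (Γ : Subgroup (V ≃ₗ[F] V)) (s : FieldSplit F K V) : Prop :=
  Submodule.span F {x : K | ∃ t ∈ Γ.comap s.B, x = (t : K) - 1} = ⊤

theorem Rich.dichotomy (h : Rich Γ s) {N : Submodule F V}
    (hN : ∀ t : Kˣ, s.B t ∈ Γ → N.map (s.B t).toLinearMap = N) : s.W ≤ N ∨ N ≤ s.U := by
  by_cases hc : N ≤ s.U
  · exact Or.inr hc
  · obtain ⟨v, hv, hvU⟩ := Set.not_subset.mp hc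
    refine Or.inl (s.W_le_of_forall h N (w := s.π v) (fun h0 => hvU (mem_U.mpr h0)) fun t ht => ?_)
    have h1 : s.B t v ∈ N := by
      rw [← hN t ht]; exact ⟨v, hv, rfl⟩
    rw [B_apply] at h1
    exact (Submodule.add_mem_iff_right N hv).mp h1

theorem sub_dvd_sub_of_pow_sub_dvd {q a b f : ℕ} (hq : 2 ≤ q) (ha : f ≤ a)
    (hb : f ≤ b) (h : q ^ a - q ^ f ∣ q ^ b - q ^ f) : a - f ∣ b - f := by
  have e : ∀ {c}, f ≤ c → q ^ c - q ^ f = q ^ f * (q ^ (c - f) - 1) := fun {c} hc => by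
    rw [Nat.mul_sub, ← pow_add, Nat.add_sub_cancel' hc, mul_one]
  rw [e ha, e hb] at h
  have h1 := Nat.dvd_of_mul_dvd_mul_left (by positivity) h
  have h2 := Nat.pow_sub_one_gcd_pow_sub_one q (a - f) (b - f)
  rw [Nat.gcd_eq_left h1] at h2
  have h3 : q ^ (a - f) = q ^ (a - f).gcd (b - f) := by
    have p1 : 1 ≤ q ^ (a - f) := Nat.one_le_pow _ _ (by omega)
    have p2 : 1 ≤ q ^ (a - f).gcd (b - f) := Nat.one_le_pow _ _ (by omega)
    omega
  have h4 := Nat.pow_right_injective hq h3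
  rw [h4]; exact Nat.gcd_dvd_right _ _

/-- The data of an equivariant closure operation on the subspaces of dimension `f + 1`. -/
structure IsSystem (Γ : Subgroup (V ≃ₗ[F] V)) (S : Submodule F V → Submodule F V) (σ f : ℕ) :
    Prop where
  lt : f + 2 ≤ σ
  le : ∀ X : Submodule F V, Module.finrank F X = f + 1 → X ≤ S X
  rank : ∀ X : Submodule F V, Module.finrank F X = f + 1 → Module.finrank F (S X) = σ
  eq : ∀ X X' : Submodule F V, Module.finrank F X = f + 1 → Module.finrank F X' = f + 1 →
    X' ≤ S X → S X' = S X
  equiv : ∀ γ ∈ Γ, ∀ X : Submodule F V, Module.finrank F X = f + 1 →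
    S (X.map γ.toLinearMap) = (S X).map γ.toLinearMap

variable {S : Submodule F V → Submodule F V} {σ f : ℕ} {X Q : Submodule F V}

open Finset in
open Classical in
theorem IsSystem.dvd [Finite F] [Finite V] (h : IsSystem Γ S σ f)
    (hQ : ∀ X ≤ Q, Module.finrank F X = f + 1 → S X ≤ Q) (hf : f ≤ Module.finrank F Q) :
    σ - f ∣ Module.finrank F Q - f := by
  have : Module.Finite F V := Module.Finite.of_finite
  have := Fintype.ofFinite V
  obtain ⟨E, hEQ, hE⟩ := exists_le_finrank_eq Q hf
  have hσ := h.lt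
  refine sub_dvd_sub_of_pow_sub_dvd (q := Nat.card F) Finite.one_lt_card (by omega) hf ?_
  have hX : ∀ v ∉ E, Module.finrank F (E ⊔ Submodule.span F {v} : Submodule F V) = f + 1 :=
    fun v hv => by rw [finrank_sup_span_singleton hv, hE]
  have card_sdiff : ∀ R : Submodule F V, E ≤ R →
      #{v : V | v ∈ R ∧ v ∉ E} = Nat.card F ^ Module.finrank F R - Nat.card F ^ f := by
    intro R hR
    have h1 : ({v : V | v ∈ R ∧ v ∉ E} : Finset V) =
        ({v : V | v ∈ R} : Finset V) \ ({v : V | v ∈ E} : Finset V) := by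
      ext v; simp
    rw [h1, Finset.card_sdiff_of_subset (fun v hv => by
      simp only [mem_filter, mem_univ, true_and] at hv ⊢; exact hR hv),
      ← Module.natCard_eq_pow_finrank (K := F) (V := R), ← hE,
      ← Module.natCard_eq_pow_finrank (K := F) (V := E)]
    simp only [Nat.card_eq_fintype_card, Fintype.card_subtype]
  rw [← card_sdiff Q hEQ, Finset.card_eq_sum_card_image (fun v => S (E ⊔ Submodule.span F {v}))]
  refine Finset.dvd_sum fun R hR => ?_
  obtain ⟨v, hv, rfl⟩ := Finset.mem_image.mp hR
  simp only [mem_filter, mem_univ, true_and] at hv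
  have hle : ∀ w ∉ E, E ⊔ Submodule.span F {w} ≤ S (E ⊔ Submodule.span F {w}) := fun w hw =>
    h.le _ (hX w hw)
  have h2 : ({a ∈ ({v : V | v ∈ Q ∧ v ∉ E} : Finset V) |
      S (E ⊔ Submodule.span F {a}) = S (E ⊔ Submodule.span F {v})} : Finset V) =
      ({a : V | a ∈ S (E ⊔ Submodule.span F {v}) ∧ a ∉ E} : Finset V) := by
    ext a
    simp only [mem_filter, mem_univ, true_and]
    constructor
    · rintro ⟨⟨h1, h2⟩, h3⟩
      refine ⟨?_, h2⟩
      rw [← h3]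
      exact hle a h2 (Submodule.mem_sup_right (Submodule.mem_span_singleton_self a))
    · rintro ⟨h1, h2⟩
      have h3 : E ⊔ Submodule.span F {v} ≤ Q :=
        sup_le hEQ (by rw [Submodule.span_singleton_le_iff_mem]; exact hv.1)
      refine ⟨⟨hQ _ h3 (hX v hv.2) h1, h2⟩, h.eq _ _ (hX v hv.2) (hX a h2) ?_⟩
      exact sup_le (le_sup_left.trans (hle v hv.2))
        (by rw [Submodule.span_singleton_le_iff_mem]; exact h1)
  rw [h2, card_sdiff _ (le_sup_left.trans (hle v hv.2)), h.rank _ (hX v hv.2)]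

theorem IsSystem.dichotomy (h : IsSystem Γ S σ f) (hs : Rich Γ s)
    (hX : Module.finrank F X = f + 1) (hXU : X ≤ s.U) : s.W ≤ S X ∨ S X ≤ s.U :=
  hs.dichotomy fun t ht => by
    rw [← h.equiv _ ht X hX, map_eq_of_fix fun x hx => B_of_mem_U t (hXU hx)]

theorem finrank_W (s : FieldSplit F K V) : Module.finrank F s.W = Module.finrank F K :=
  LinearMap.finrank_range_of_inj s.iota_injective

theorem finrank_K_add_finrank_U [Module.Finite F V] (s : FieldSplit F K V) :
    Module.finrank F K + Module.finrank F s.U = Module.finrank F V := by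
  rw [← finrank_W s]; exact Submodule.finrank_add_eq_of_isCompl s.isCompl

theorem IsSystem.le_U [Module.Finite F V] (h : IsSystem Γ S σ f) (hs : Rich Γ s)
    (hσ : σ < Module.finrank F K)
    (hX : Module.finrank F X = f + 1) (hXU : X ≤ s.U) : S X ≤ s.U := by
  refine (h.dichotomy hs hX hXU).resolve_left fun hW => ?_
  have := Submodule.finrank_mono hW
  rw [h.rank X hX, finrank_W] at this
  omega

/-- No system for a group containing multiplications on two complementary summands of coprime
dimensions. -/
theorem noSystem_of_two [Finite F] [Finite V] (hs : Rich Γ s) (hA : Rich Γ sA)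
    (h1 : sA.W = s.U) (h2 : sA.U = s.W)
    (hcop : Nat.Coprime (Module.finrank F A) (Module.finrank F K))
    (hlt : Module.finrank F A < Module.finrank F K)
    (hf : f + 2 ≤ Module.finrank F A) : NoSystem Γ (Module.finrank F s.U) f := by
  intro S σ hσ hσu ha hb hc
  have : Module.Finite F V := Module.Finite.of_finite
  have h : IsSystem Γ S σ f :=
    ⟨hσ, fun X hX => (ha X hX).1, fun X hX => (ha X hX).2, hb, hc⟩
  have eU : Module.finrank F s.U = Module.finrank F A := by rw [← h1, finrank_W]
  have eV := finrank_K_add_finrank_U s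
  have d1 := h.dvd (Q := ⊤) (fun _ _ _ => le_top) (by rw [finrank_top]; omega)
  have d2 := h.dvd (Q := s.U) (fun X hX hr => h.le_U hs (by omega) hr hX) (by omega)
  have d3 := h.dvd (Q := s.W) (fun X hX hr => by
    rw [← h2] at hX ⊢
    refine (h.dichotomy hA hr hX).resolve_left fun hle => ?_
    have l1 : sA.W ⊔ X ≤ S X := sup_le hle (h.le X hr)
    have l2 := Submodule.finrank_mono l1
    have l3 := Submodule.finrank_sup_add_finrank_inf_eq sA.W X
    have l4 : sA.W ⊓ X = ⊥ := by
      rw [← disjoint_iff]; exact sA.isCompl.disjoint.mono_right hX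
    rw [l4, finrank_bot, finrank_W, hr] at l3
    rw [h.rank X hr] at l2
    omega) (by rw [finrank_W]; omega)
  rw [finrank_top] at d1
  rw [finrank_W] at d3
  rw [eU] at d2 eV
  have k1 : σ - f ∣ Module.finrank F K := by
    have := Nat.dvd_sub d1 d2
    rwa [← eV, show Module.finrank F K + Module.finrank F A - f - (Module.finrank F A - f) =
      Module.finrank F K by omega] at this
  have k2 : σ - f ∣ Module.finrank F A := by
    have := Nat.dvd_sub d1 d3
    rwa [← eV, show Module.finrank F K + Module.finrank F A - f - (Module.finrank F K - f) =
      Module.finrank F A by omega] at this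
  have := Nat.eq_one_of_dvd_coprimes hcop k2 k1
  omega

/-- Three pairwise complementary summands. -/
structure Triple (sA : FieldSplit F A V) (sB : FieldSplit F B V) (s : FieldSplit F K V) :
    Prop where
  AB : sA.W ≤ sB.U
  BA : sB.W ≤ sA.U
  AK : sA.W ≤ s.U
  KA : s.W ≤ sA.U
  BK : sB.W ≤ s.U
  KB : s.W ≤ sB.U
  rank : Module.finrank F A + Module.finrank F B + Module.finrank F K = Module.finrank F V

theorem Triple.finrank_U [Module.Finite F V] (h : Triple sA sB s) :
    Module.finrank F s.U = Module.finrank F A + Module.finrank F B := by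
  have := finrank_K_add_finrank_U s
  have := h.rank
  omega

theorem Triple.swap (h : Triple sA sB s) : Triple sB sA s :=
  ⟨h.BA, h.AB, h.BK, h.KB, h.AK, h.KA, by have := h.rank; omega⟩

theorem Triple.inf_eq [Module.Finite F V] (h : Triple sA sB s) : sA.U ⊓ s.U = sB.W := by
  refine (Submodule.eq_of_le_of_finrank_le (le_inf h.BA h.BK) ?_).symm
  rw [finrank_W]
  have h1 := Submodule.finrank_sup_add_finrank_inf_eq sA.U s.U
  have h2 : sA.U ⊔ s.U = ⊤ := by
    rw [eq_top_iff, ← s.isCompl.sup_eq_top]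
    exact sup_le_sup_right h.KA _
  rw [h2, finrank_top] at h1
  have := finrank_K_add_finrank_U s
  have := finrank_K_add_finrank_U sA
  have := h.rank
  omega

theorem Triple.sup_eq [Module.Finite F V] (h : Triple sA sB s) : sA.W ⊔ sB.W = s.U := by
  refine Submodule.eq_of_le_of_finrank_le (sup_le h.AK h.BK) ?_
  have h1 := Submodule.finrank_sup_add_finrank_inf_eq sA.W sB.W
  have h2 : sA.W ⊓ sB.W = ⊥ := by
    rw [← disjoint_iff]; exact (sA.isCompl.disjoint.mono_right h.BA)
  rw [h2, finrank_bot, finrank_W, finrank_W] at h1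
  rw [h.finrank_U]; omega

theorem IsSystem.le_W_or [Module.Finite F V] (h : IsSystem Γ S σ f) (ht : Triple sA sB s)
    (hs : Rich Γ s) (hB : Rich Γ sB) {x : V ≃ₗ[F] V} (hx : x ∈ Γ)
      (hxB : sB.W.map x.toLinearMap = sB.W)
    (hσ : σ < Module.finrank F K) (hfB : f + 1 ≤ Module.finrank F B)
    (hX : Module.finrank F X = f + 1) (hXA : X ≤ sA.W)
    (hirr : ∀ N : Submodule F V, N.map x.toLinearMap = N → sA.W ≤ N ∨ N ≤ sA.U) :
    S X ≤ sA.W ∨ σ = Module.finrank F A + Module.finrank F B := by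
  have hU : S X ≤ s.U := h.le_U hs hσ hX (hXA.trans ht.AK)
  rcases h.dichotomy hB hX (hXA.trans ht.AB) with h1 | h1
  · right
    obtain ⟨Y, hYB, hY⟩ := exists_le_finrank_eq sB.W (d := f + 1) (by rwa [finrank_W])
    have e1 : S Y = S X := h.eq X Y hX hY (hYB.trans h1)
    have hYx : Module.finrank F (Y.map x.toLinearMap) = f + 1 := by
      rw [← hY]; exact LinearEquiv.finrank_map_eq x Y
    have e2 : S (Y.map x.toLinearMap) = S X := by
      refine h.eq X _ hX hYx (le_trans ?_ h1)
      rw [← hxB]; exact Submodule.map_mono hYB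
    have e3 : (S X).map x.toLinearMap = S X := by
      rw [← e1, ← h.equiv x hx Y hY, e2, e1]
    have h2 : sA.W ≤ S X := by
      refine (hirr _ e3).resolve_right fun h3 => ?_
      have h4 : X ≤ ⊥ := by
        rw [← sA.isCompl.inf_eq_bot]
        exact le_inf hXA ((h.le X hX).trans h3)
      rw [le_bot_iff] at h4
      rw [h4, finrank_bot] at hX
      omega
    have h5 : S X = s.U := le_antisymm hU (by rw [← ht.sup_eq]; exact sup_le h2 h1)
    rw [← h.rank X hX, h5, ht.finrank_U]
  · left
    rw [← ht.swap.inf_eq]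
    exact le_inf h1 hU

/-- A system for a group acting on three summands has the obvious rank. -/
theorem IsSystem.rank_eq [Finite F] [Finite V] (h : IsSystem Γ S σ f) (ht : Triple sA sB s)
    (hs : Rich Γ s) (hA : Rich Γ sA) (hB : Rich Γ sB) {x : V ≃ₗ[F] V} (hx : x ∈ Γ)
    (hxA : sA.W.map x.toLinearMap = sA.W) (hxB : sB.W.map x.toLinearMap = sB.W)
    (hirrA : ∀ N : Submodule F V, N.map x.toLinearMap = N → sA.W ≤ N ∨ N ≤ sA.U)
    (hirrB : ∀ N : Submodule F V, N.map x.toLinearMap = N → sB.W ≤ N ∨ N ≤ sB.U)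
    (hσ : σ < Module.finrank F K)
    (hfA : f + 1 ≤ Module.finrank F A) (hfB : f + 1 ≤ Module.finrank F B)
    (hcop : Nat.Coprime (Nat.gcd (Module.finrank F A) (Module.finrank F B)) (Module.finrank F V)) :
    σ = Module.finrank F A + Module.finrank F B := by
  have : Module.Finite F V := Module.Finite.of_finite
  by_contra hne
  have eV := finrank_K_add_finrank_U s
  have eU := ht.finrank_U
  have hlt := h.lt
  have d1 := h.dvd (Q := ⊤) (fun _ _ _ => le_top) (by rw [finrank_top]; omega)
  have d2 := h.dvd (Q := s.U) (fun X hX hr => h.le_U hs hσ hr hX) (by omega)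
  have d3 := h.dvd (Q := sA.W) (fun X hX hr =>
    (h.le_W_or ht hs hB hx hxB hσ hfB hr hX hirrA).resolve_right hne) (by rw [finrank_W]; omega)
  have d4 := h.dvd (Q := sB.W) (fun X hX hr =>
    (h.le_W_or ht.swap hs hA hx hxA hσ hfA hr hX hirrB).resolve_right (by omega))
    (by rw [finrank_W]; omega)
  rw [finrank_top] at d1
  rw [finrank_W] at d3 d4
  rw [eU] at d2 eV
  have k1 : σ - f ∣ Module.finrank F B := by
    have := Nat.dvd_sub d2 d3
    rwa [show Module.finrank F A + Module.finrank F B - f - (Module.finrank F A - f) =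
      Module.finrank F B by omega] at this
  have k2 : σ - f ∣ Module.finrank F A := by
    have := Nat.dvd_sub d2 d4
    rwa [show Module.finrank F A + Module.finrank F B - f - (Module.finrank F B - f) =
      Module.finrank F A by omega] at this
  have k3 : σ - f ∣ f := by
    have := Nat.dvd_sub k1 d4
    rwa [show Module.finrank F B - (Module.finrank F B - f) = f by omega] at this
  have k4 : σ - f ∣ Module.finrank F V := by
    have := Nat.dvd_add d1 k3
    rwa [Nat.sub_add_cancel (by omega)] at this
  have := Nat.eq_one_of_dvd_coprimes hcop (Nat.dvd_gcd k2 k1) k4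
  omega

end FieldSplit

namespace FieldSplit

variable {F K A B V : Type*} [Field F] [Field K] [Algebra F K] [Field A] [Algebra F A]
  [Field B] [Algebra F B] [AddCommGroup V] [Module F V]
variable {Γ : Subgroup (V ≃ₗ[F] V)} {s : FieldSplit F K V} {sA : FieldSplit F A V}
  {sB : FieldSplit F B V} {g M : ℕ} {N : Submodule F V}

theorem Triple.rotate (h : Triple sA sB s) : Triple sB s sA :=
  ⟨h.BK, h.KB, h.BA, h.AB, h.KA, h.AK, by have := h.rank; omega⟩

theorem Triple.W_le_N_le (h : Triple sA sB s) [Module.Finite F V] (h1 : sA.W ≤ N)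
    (h2 : N ≤ sB.U) (h3 : N ≤ s.U) : N = sA.W :=
  le_antisymm (by rw [← h.swap.inf_eq]; exact le_inf h2 h3) h1

theorem Triple.sup_le_N_le (h : Triple sA sB s) [Module.Finite F V] (h1 : sA.W ≤ N)
    (h2 : sB.W ≤ N) (h3 : N ≤ s.U) : N = s.U :=
  le_antisymm h3 (by rw [← h.sup_eq]; exact sup_le h1 h2)

theorem Triple.finrank_eq [Module.Finite F V] (h : Triple sA sB s)
    (hA : sA.W ≤ N ∨ N ≤ sA.U) (hB : sB.W ≤ N ∨ N ≤ sB.U) (hs : s.W ≤ N ∨ N ≤ s.U) :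
    N = ⊥ ∨ N = ⊤ ∨ Module.finrank F N = Module.finrank F A ∨
      Module.finrank F N = Module.finrank F B ∨ Module.finrank F N = Module.finrank F K ∨
      Module.finrank F N + Module.finrank F A = Module.finrank F V ∨
      Module.finrank F N + Module.finrank F B = Module.finrank F V ∨
      Module.finrank F N + Module.finrank F K = Module.finrank F V := by
  have rA := finrank_K_add_finrank_U sA
  have rB := finrank_K_add_finrank_U sB
  have rs := finrank_K_add_finrank_U s
  rcases hA with hA | hA <;> rcases hB with hB | hB <;> rcases hs with hs | hs
  · right; left
    rw [eq_top_iff, ← s.isCompl.sup_eq_top, ← h.sup_eq]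
    exact sup_le hs (sup_le hA hB)
  · have := h.sup_le_N_le hA hB hs
    have : Module.finrank F N = Module.finrank F s.U := by rw [this]
    omega
  · have := h.rotate.rotate.sup_le_N_le hs hA hB
    have : Module.finrank F N = Module.finrank F sB.U := by rw [this]
    omega
  · have := h.W_le_N_le hA hB hs
    have : Module.finrank F N = Module.finrank F A := by rw [this, finrank_W]
    omega
  · have := h.rotate.sup_le_N_le hB hs hA
    have : Module.finrank F N = Module.finrank F sA.U := by rw [this]
    omega
  · have := h.rotate.W_le_N_le hB hs hA
    have : Module.finrank F N = Module.finrank F B := by rw [this, finrank_W]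
    omega
  · have := h.rotate.rotate.W_le_N_le hs hA hB
    have : Module.finrank F N = Module.finrank F K := by rw [this, finrank_W]
    omega
  · left
    have h1 : N ≤ sB.W := by rw [← h.inf_eq]; exact le_inf hA hs
    rw [eq_bot_iff, ← sB.isCompl.inf_eq_bot]
    exact le_inf h1 hB

theorem finrank_eq_of_two [Module.Finite F V] (h1 : sA.W = s.U) (h2 : sA.U = s.W)
    (hA : sA.W ≤ N ∨ N ≤ sA.U) (hs : s.W ≤ N ∨ N ≤ s.U) :
    N = ⊥ ∨ N = ⊤ ∨ Module.finrank F N = Module.finrank F A ∨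
      Module.finrank F N + Module.finrank F A = Module.finrank F V := by
  have rA := finrank_K_add_finrank_U sA
  rcases hA with hA | hA <;> rcases hs with hs | hs
  · right; left
    rw [eq_top_iff, ← s.isCompl.sup_eq_top]
    exact sup_le hs (by rwa [← h1])
  · have := le_antisymm hs (h1 ▸ hA)
    have : Module.finrank F N = Module.finrank F A := by rw [this, ← h1, finrank_W]
    omega
  · have := le_antisymm hA (by rwa [h2])
    have : Module.finrank F N = Module.finrank F sA.U := by rw [this]
    omega
  · left
    rw [eq_bot_iff, ← s.isCompl.inf_eq_bot]
    exact le_inf (by rwa [h2] at hA) hs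

theorem Rich.exists_not_scalar (h : Rich Γ s) (hK : 2 ≤ Module.finrank F K) :
    ∃ t : Kˣ, s.B t ∈ Γ ∧ ∀ c : F, (t : K) ≠ algebraMap F K c := by
  by_contra! hcon
  have h1 : (⊤ : Submodule F K) ≤ Submodule.span F {1} := by
    rw [← h, Submodule.span_le]
    rintro x ⟨t, ht, rfl⟩
    obtain ⟨c, hc⟩ := hcon t ht
    refine Submodule.mem_span_singleton.mpr ⟨c - 1, ?_⟩
    rw [hc, Algebra.smul_def, map_sub, map_one, mul_one]
  have h2 := finrank_span_singleton (K := F) (one_ne_zero (α := K))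
  rw [top_le_iff] at h1
  rw [h1, finrank_top] at h2
  omega

theorem Rich.exists_ne_one (h : Rich Γ s) : ∃ t : Kˣ, s.B t ∈ Γ ∧ t ≠ 1 := by
  by_contra! hcon
  have h1 : (⊤ : Submodule F K) ≤ ⊥ := by
    rw [← h, Submodule.span_le]
    rintro x ⟨t, ht, rfl⟩
    rw [hcon t ht]; simp
  have : (1 : K) ∈ (⊥ : Submodule F K) := h1 trivial
  simp at this

/-- The conditions needed of `Γ` on the large summand. -/
structure Core (Γ : Subgroup (V ≃ₗ[F] V)) (s : FieldSplit F K V) (P : Submodule F V) : Prop where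
  thick : ∃ g M, Thick V (Γ.comap s.B) g M
  cyc : ∀ t : Kˣ, ∃ γ ∈ Γ, ∃ c : F, c ≠ 0 ∧ (∀ v ∈ P, γ v = v) ∧
    ∀ k, γ (s.ι k) = c • s.ι (t * k)
  rich : Rich Γ s

theorem transvections_of_core [Finite F] [Finite V] [Finite K] (hc : Core Γ s sA.W)
    (hA : Rich Γ sA) (hAU : sA.W ≤ s.U) (hirr : IrredOn Γ)
    (hK : 2 * Nat.card F ^ 2 < Nat.card K)
    (hns : ∀ f, f + 2 ≤ Module.finrank F A → NoSystem Γ (Module.finrank F s.U) f)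
    (hA5 : 5 ≤ Module.finrank F A) {e : V ≃ₗ[F] V}
    (he : e ∈ Γ) (heP : ∀ v ∈ sA.W, e v = v) (heW : ∀ w ∈ sA.U, e w ∈ sA.U)
    (hefix : ∀ w ∈ sA.U, e w = w → w = 0) (u : V) (l : V →ₗ[F] F) (hlu : l u = 0) :
    ∃ γ ∈ Γ, ∀ v, γ v = v + l v • u := by
  have : Module.Finite F V := Module.Finite.of_finite
  obtain ⟨g, M, hthick⟩ := hc.thick
  have hset : Setup Γ s sA.W (Γ.comap s.B) g M := ⟨fun t ht => ht, hc.rich, hthick, hAU, hc.cyc⟩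
  obtain ⟨t, ht, htc⟩ := hA.exists_not_scalar (by omega)
  refine exists_transvection (P := sA.W) (W' := sA.U) sA.isCompl (fun X hX =>
    (hset.transOff hirr hK (fun f hf => hns f (by rwa [finrank_W] at hf)) _ hX).1 X rfl)
    (by rwa [finrank_W]) ht (fun v => ?_) (fun w hw => B_of_mem_U t hw) ?_ he heP heW hefix u l hlu
  · rw [B_apply]
    exact Submodule.add_mem_iff_left _ (sA.iota_mem_W _)
  · rintro v ⟨k, rfl⟩ hv c hcv
    rw [B_iota, ← map_smul] at hcv
    have h1 := sA.iota_injective hcv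
    have hk : k ≠ 0 := by rintro rfl; exact hv (map_zero _)
    rw [Algebra.smul_def] at h1
    exact htc c (mul_right_cancel₀ hk h1)

theorem transvections_of_two [Finite F] [Finite V] [Finite K] (hc : Core Γ s sA.W)
    (hA : Rich Γ sA) (h1 : sA.W = s.U) (h2 : sA.U = s.W) (hirr : IrredOn Γ)
    (hK : 2 * Nat.card F ^ 2 < Nat.card K)
    (hcop : Nat.Coprime (Module.finrank F A) (Module.finrank F K))
    (hlt : Module.finrank F A < Module.finrank F K)
    (hA5 : 5 ≤ Module.finrank F A) (u : V) (l : V →ₗ[F] F) (hlu : l u = 0) :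
    ∃ γ ∈ Γ, ∀ v, γ v = v + l v • u := by
  obtain ⟨t, ht, ht1⟩ := hc.rich.exists_ne_one
  refine transvections_of_core hc hA h1.le hirr hK
    (fun f hf => noSystem_of_two hc.rich hA h1 h2 hcop hlt hf) hA5 ht
    (fun v hv => B_of_mem_U t (h1 ▸ hv)) ?_ ?_ u l hlu
  · rw [h2]
    rintro v ⟨k, rfl⟩
    rw [B_iota]; exact s.iota_mem_W _
  · rw [h2]
    rintro v ⟨k, rfl⟩ hk
    rw [B_iota] at hk
    have h3 := s.iota_injective hk
    by_contra h0
    have hk0 : k ≠ 0 := by rintro rfl; exact h0 (map_zero _)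
    exact ht1 (Units.ext (mul_right_cancel₀ hk0 (by rw [h3, Units.val_one, one_mul])))

theorem transvections_of_triple [Finite F] [Finite V] [Finite K] (hc : Core Γ s sA.W)
    (hA : Rich Γ sA) (hB : Rich Γ sB) (ht : Triple sA sB s) (hirr : IrredOn Γ)
    (hK : 2 * Nat.card F ^ 2 < Nat.card K)
    (hns : ∀ f, f + 2 ≤ Module.finrank F A → NoSystem Γ (Module.finrank F s.U) f)
    (hA5 : 5 ≤ Module.finrank F A) (u : V) (l : V →ₗ[F] F) (hlu : l u = 0) :
    ∃ γ ∈ Γ, ∀ v, γ v = v + l v • u := by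
  have : Module.Finite F V := Module.Finite.of_finite
  obtain ⟨b, hb, hb1⟩ := hB.exists_ne_one
  obtain ⟨t, htΓ, ht1⟩ := hc.rich.exists_ne_one
  have hsup : sB.W ⊔ s.W = sA.U := ht.rotate.sup_eq
  have ev : ∀ v, (sB.B b * s.B t) v = sB.B b (s.B t v) := fun _ => rfl
  refine transvections_of_core hc hA ht.AK hirr hK hns hA5 (Γ.mul_mem hb htΓ)
    (fun v hv => ?_) (fun w hw => ?_) (fun w hw hfix => ?_) u l hlu
  · rw [ev, B_of_mem_U t (ht.AK hv), B_of_mem_U b (ht.AB hv)]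
  · rw [ev, B_apply, B_apply]
    exact Submodule.add_mem _ (Submodule.add_mem _ hw (ht.KA (s.iota_mem_W _)))
      (ht.BA (sB.iota_mem_W _))
  · have hBK : ∀ k, s.π (sB.ι k) = 0 := fun k => mem_U.mp (ht.BK (sB.iota_mem_W k))
    have hKB : ∀ k, sB.π (s.ι k) = 0 := fun k => mem_U.mp (ht.KB (s.iota_mem_W k))
    have p1 := congrArg s.π hfix
    have p2 := congrArg sB.π hfix
    rw [ev, B_apply sB, map_add, hBK, add_zero, pi_B] at p1
    rw [ev, pi_B, B_apply, map_add, hKB, add_zero] at p2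
    have z1 : s.π w = 0 := by
      by_contra h0
      exact ht1 (Units.ext (mul_right_cancel₀ h0 (by rw [p1, Units.val_one, one_mul])))
    have z2 : sB.π w = 0 := by
      by_contra h0
      exact hb1 (Units.ext (mul_right_cancel₀ h0 (by rw [p2, Units.val_one, one_mul])))
    have h3 : w ∈ sB.W := by rw [← ht.inf_eq]; exact ⟨hw, mem_U.mpr z1⟩
    exact eq_zero_of_mem h3 (mem_U.mpr z2)

end FieldSplit

/-- The number `1 + q + ⋯ + q ^ (m - 1)`. -/
def repunit (q m : ℕ) : ℕ := ∑ i ∈ Finset.range m, q ^ i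

theorem repunit_mul {q : ℕ} (hq : 2 ≤ q) (m : ℕ) : repunit q m * (q - 1) = q ^ m - 1 := by
  have := geom_sum_mul_of_one_le (x := q) (by omega) m
  exact this

theorem pow_pred_le_repunit {q m : ℕ} (hm : 0 < m) : q ^ (m - 1) ≤ repunit q m :=
  Finset.single_le_sum (f := fun i => q ^ i) (fun _ _ => Nat.zero_le _)
    (Finset.mem_range.mpr (by omega))

theorem repunit_pos {q m : ℕ} (hq : 0 < q) (hm : 0 < m) : 0 < repunit q m :=
  lt_of_lt_of_le (pow_pos hq _) (pow_pred_le_repunit hm)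

theorem pow_pred_add_le_repunit {q m : ℕ} (hm : 2 ≤ m) :
    q ^ (m - 1) + q ^ (m - 2) ≤ repunit q m := by
  obtain ⟨k, rfl⟩ : ∃ k, m = k + 2 := ⟨m - 2, by omega⟩
  rw [repunit, Finset.sum_range_succ, Finset.sum_range_succ]
  simp only [Nat.add_sub_cancel]
  have : k + 2 - 1 = k + 1 := rfl
  rw [this]
  omega

theorem exists_mul_modEq {N R : ℕ} (h : N.Coprime R) (hR : 0 < R) (i : ℕ) :
    ∃ j, N * j ≡ i [MOD R] := by
  have : NeZero R := ⟨hR.ne'⟩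
  refine ⟨((N : ZMod R)⁻¹ * i).val, ?_⟩
  rw [← ZMod.natCast_eq_natCast_iff]
  push_cast
  rw [ZMod.natCast_zmod_val, ← mul_assoc, ZMod.coe_mul_inv_eq_one _ h, one_mul]

theorem thick_arith {q m n t g z : ℕ} (hq : 2 ≤ q) (hmn : m ≤ n) (h9 : n + 9 ≤ 2 * m)
    (ht : q ^ (m - 1) + q ^ (m - 2) ≤ t) (hg : g ≤ q - 1)
    (hz : (q ^ m) ^ 2 ≤ q ^ n * z) :
    g ≤ z ∧ (g ^ 2 * (q ^ m : ℕ) * (q ^ 2 : ℕ) * z : ℤ) <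
      ((t : ℤ) - (q ^ 2 : ℕ)) * ((z : ℤ) - g) ^ 2 := by
  have hq0 : 0 < q := by omega
  have hz9 : q ^ 9 ≤ z := by
    have h1 : q ^ n * q ^ 9 ≤ q ^ n * z := by
      rw [← pow_add]
      refine le_trans ?_ hz
      rw [← pow_mul]
      exact Nat.pow_le_pow_right hq0 (by omega)
    exact Nat.le_of_mul_le_mul_left h1 (by positivity)
  have h4 : 16 ≤ q ^ 4 := by
    calc 16 = 2 ^ 4 := by norm_num
      _ ≤ q ^ 4 := Nat.pow_le_pow_left hq 4
  have hz5 : 16 * q ^ 5 ≤ z := by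
    calc 16 * q ^ 5 ≤ q ^ 4 * q ^ 5 := Nat.mul_le_mul_right _ h4
      _ = q ^ 9 := by ring
      _ ≤ z := hz9
  have hq5 : q ≤ q ^ 5 := Nat.le_self_pow (by norm_num) q
  have h2g : 2 * g ≤ z := by omega
  refine ⟨by omega, ?_⟩
  have hm4 : q ^ 2 ≤ q ^ (m - 2) := Nat.pow_le_pow_right hq0 (by omega)
  have hpm : q ^ m = q ^ (m - 1) * q := by rw [← pow_succ]; congr 1; omega
  have hgq : g < q := by omega
  set A : ℕ := q ^ (m - 1) with hA
  have hA0 : 0 < A := by positivity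
  have htA : (A : ℤ) ≤ (t : ℤ) - (q ^ 2 : ℕ) := by
    have : A + q ^ 2 ≤ t := by omega
    zify at this ⊢; linarith
  have hzg : (z : ℤ) ≤ 2 * ((z : ℤ) - g) := by zify at h2g; linarith
  have hz0 : 0 < z := lt_of_lt_of_le (by positivity) hz9
  have h7 : (z : ℤ) ^ 2 ≤ 4 * ((z : ℤ) - g) ^ 2 := by
    have h0 : (0 : ℤ) ≤ z := by positivity
    nlinarith
  have h8 : (g ^ 2 * (q ^ m : ℕ) * (q ^ 2 : ℕ) * z : ℕ) * 4 < A * z ^ 2 := by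
    rw [hpm]
    have hg2 : g ^ 2 ≤ q ^ 2 := Nat.pow_le_pow_left hgq.le 2
    calc g ^ 2 * (A * q) * q ^ 2 * z * 4 ≤ q ^ 2 * (A * q) * q ^ 2 * z * 4 := by gcongr
      _ = A * z * (4 * q ^ 5) := by ring
      _ < A * z * z := by
          apply Nat.mul_lt_mul_of_pos_left _ (by positivity)
          have : 0 < q ^ 5 := by positivity
          omega
      _ = A * z ^ 2 := by ring
  have h9 : ((g : ℤ) ^ 2 * (q ^ m : ℕ) * (q ^ 2 : ℕ) * z) * 4 < A * (z : ℤ) ^ 2 := by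
    exact_mod_cast h8
  have h10 : (A : ℤ) * (4 * ((z : ℤ) - g) ^ 2) ≤
      ((t : ℤ) - (q ^ 2 : ℕ)) * (4 * ((z : ℤ) - g) ^ 2) :=
    mul_le_mul_of_nonneg_right htA (by positivity)
  have h11 : (A : ℤ) * (z : ℤ) ^ 2 ≤ A * (4 * ((z : ℤ) - g) ^ 2) :=
    mul_le_mul_of_nonneg_left h7 (by positivity)
  linarith

namespace FieldSplit

variable {F K V : Type*} [Field F] [Field K] [Algebra F K] [AddCommGroup V] [Module F V]
variable {Γ : Subgroup (V ≃ₗ[F] V)} {s : FieldSplit F K V} {P : Submodule F V}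

/-- Elements of a finite extension of `F` fixed by the Frobenius of `F` are in `F`. -/
theorem mem_base_of_pow_eq [Finite F] {t : Kˣ} (ht : t ^ (Nat.card F - 1) = 1) :
    ∃ d : F, d ≠ 0 ∧ (t : K) = algebraMap F K d := by
  classical
  have := Fintype.ofFinite F
  have hc : 1 < Fintype.card F := Fintype.one_lt_card
  have h1 : (t : K) ^ Fintype.card F = t := by
    have h2 : (t : K) ^ (Nat.card F - 1) = 1 := by
      rw [← Units.val_pow_eq_pow_val, ht, Units.val_one]
    have h3 : 1 ≤ Nat.card F := Nat.card_pos
    rw [← Nat.card_eq_fintype_card, ← Nat.sub_add_cancel h3, pow_succ, h2, one_mul]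
  have h2 : (t : K) ∈ Set.range (algebraMap F K) := by
    set p : Polynomial K := Polynomial.X ^ Fintype.card F - Polynomial.X with hp
    have hp0 : p ≠ 0 := FiniteField.X_pow_card_sub_X_ne_zero K hc
    have hroot : ∀ y : K, y ∈ p.roots.toFinset ↔ y ^ Fintype.card F = y := fun y => by
      rw [Multiset.mem_toFinset, Polynomial.mem_roots hp0, Polynomial.IsRoot, hp]
      simp [sub_eq_zero]
    have hsub : Finset.univ.image (algebraMap F K) ⊆ p.roots.toFinset := by
      intro y hy
      obtain ⟨d, -, rfl⟩ := Finset.mem_image.mp hy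
      rw [hroot, ← map_pow, FiniteField.pow_card]
    have hcard : p.roots.toFinset.card ≤ (Finset.univ.image (algebraMap F K)).card := by
      rw [Finset.card_image_of_injective _ (algebraMap F K).injective, Finset.card_univ]
      refine (Multiset.toFinset_card_le _).trans ((Polynomial.card_roots' _).trans ?_)
      rw [hp, FiniteField.X_pow_card_sub_X_natDegree_eq K hc]
    have h3 := (hroot t).mpr h1
    rw [← Finset.eq_of_subset_of_card_le hsub hcard] at h3
    obtain ⟨d, -, h⟩ := Finset.mem_image.mp h3
    exact ⟨d, h⟩
  obtain ⟨d, hd⟩ := h2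
  refine ⟨d, ?_, hd.symm⟩
  rintro rfl
  exact t.ne_zero (by rw [← hd, map_zero])

theorem _root_.natCard_field_eq_pow [Finite F] [Finite K] :
    Nat.card K = Nat.card F ^ Module.finrank F K :=
  Module.natCard_eq_pow_finrank

/-- Powers of `β` represent all units modulo the units of `F`. -/
def ProjGen (F : Type*) {K : Type*} [Field F] [Field K] [Algebra F K] (β : Kˣ) : Prop :=
  ∀ t : Kˣ, ∃ i : ℕ, ∃ d : F, d ≠ 0 ∧ (t : K) = algebraMap F K d * β ^ i

/-- The group contains all nonzero scalars. -/
def HasScalars (Γ : Subgroup (V ≃ₗ[F] V)) : Prop :=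
  ∀ c : F, c ≠ 0 → ∃ γ ∈ Γ, ∀ v, γ v = c • v

theorem pow_card_sub_one_eq_one [Finite F] [Finite K] (t : Kˣ) :
    t ^ (Nat.card F ^ Module.finrank F K - 1) = 1 := by
  have := Fintype.ofFinite K
  rw [← natCard_field_eq_pow, Nat.card_eq_fintype_card]
  exact Units.ext (by simpa using FiniteField.pow_card_sub_one_eq_one (t : K) t.ne_zero)

theorem algebraMap_pow_card [Finite F] {d : F} (hd : d ≠ 0) :
    (algebraMap F K d) ^ (Nat.card F - 1) = 1 := by
  have := Fintype.ofFinite F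
  rw [← map_pow, Nat.card_eq_fintype_card, FiniteField.pow_card_sub_one_eq_one d hd, map_one]

theorem pow_iota {x : V ≃ₗ[F] V} {β : Kˣ} (hx : ∀ k, x (s.ι k) = s.ι (β * k)) (j : ℕ) (k : K) :
    (x ^ j) (s.ι k) = s.ι (β ^ j * k) := by
  induction j generalizing k with
  | zero => simp
  | succ j ih => rw [pow_succ, LinearEquiv.mul_apply, hx, ih, pow_succ, mul_assoc]

theorem pow_apply_of_fix {x : V ≃ₗ[F] V} {v : V} (hx : x v = v) (j : ℕ) : (x ^ j) v = v := by
  induction j with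
  | zero => simp
  | succ j ih => rw [pow_succ, LinearEquiv.mul_apply, hx, ih]

theorem pow_apply_of_smul {x : V ≃ₗ[F] V} {v : V} {c : F} (hx : x v = c • v) (j : ℕ) :
    (x ^ j) v = c ^ j • v := by
  induction j with
  | zero => simp
  | succ j ih => rw [pow_succ, LinearEquiv.mul_apply, hx, map_smul, ih, smul_smul, pow_succ']

/-- A power of `x` which is trivial off the summand is a multiplication. -/
theorem eq_B_of_fix {x : V ≃ₗ[F] V} {t : Kˣ} (hx : ∀ k, x (s.ι k) = s.ι (t * k))
    (hU : ∀ v ∈ s.U, x v = v) : x = s.B t := by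
  ext v
  have h1 := hU _ (s.sub_iota_mem_U v)
  have h2 : v = (v - s.ι (s.π v)) + s.ι (s.π v) := by abel
  rw [h2, map_add, h1, hx, map_add, B_of_mem_U t (s.sub_iota_mem_U v), B_iota]

theorem B_pow_mem [Finite F] [Finite K] {x : V ≃ₗ[F] V} {β : Kˣ} (hxΓ : x ∈ Γ)
    (hx : ∀ k, x (s.ι k) = s.ι (β * k)) (hβ : ProjGen F β) {N : ℕ}
    (hN : N.Coprime (repunit (Nat.card F) (Module.finrank F K)))
    (hU : ∀ v ∈ s.U, (x ^ (N * (Nat.card F - 1))) v = v) (t : Kˣ) :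
    s.B (t ^ (Nat.card F - 1)) ∈ Γ := by
  have hq : 2 ≤ Nat.card F := Finite.one_lt_card
  have : Module.Finite F K := Module.Finite.of_finite
  obtain ⟨i, d, hd, htd⟩ := hβ t
  obtain ⟨j, hj⟩ := exists_mul_modEq hN (repunit_pos (by omega) Module.finrank_pos) i
  have h1 : β ^ (N * (Nat.card F - 1) * j) = t ^ (Nat.card F - 1) := by
    have h2 : t ^ (Nat.card F - 1) = β ^ (i * (Nat.card F - 1)) := by
      apply Units.ext
      push_cast
      rw [htd, mul_pow, algebraMap_pow_card hd, one_mul, ← pow_mul]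
    rw [h2, pow_eq_pow_iff_modEq]
    refine Nat.ModEq.of_dvd (orderOf_dvd_of_pow_eq_one (pow_card_sub_one_eq_one (F := F) β)) ?_
    rw [← repunit_mul hq, mul_right_comm]
    exact hj.mul_right' _
  have h3 : x ^ (N * (Nat.card F - 1) * j) = s.B (t ^ (Nat.card F - 1)) := by
    refine eq_B_of_fix (fun k => ?_) fun v hv => ?_
    · rw [pow_iota hx, ← Units.val_pow_eq_pow_val, h1]
    · rw [pow_mul]; exact pow_apply_of_fix (hU v hv) j
  rw [← h3]
  exact Γ.pow_mem hxΓ _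

theorem thick_of_pow_mem [Finite F] [Finite K] [Finite V]
    (h : ∀ t : Kˣ, s.B (t ^ (Nat.card F - 1)) ∈ Γ)
    (hdim : Module.finrank F V + 9 ≤ 2 * Module.finrank F K) :
    ∃ g M, Thick V (Γ.comap s.B) g M := by
  have hq : 2 ≤ Nat.card F := Finite.one_lt_card
  have : Module.Finite F K := Module.Finite.of_finite
  have : Module.Finite F V := Module.Finite.of_finite
  set q := Nat.card F with hqdef
  set m := Module.finrank F K with hm
  have hKc : Nat.card K = q ^ m := natCard_field_eq_pow
  have hVc : Nat.card V = q ^ Module.finrank F V := Module.natCard_eq_pow_finrank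
  have hmn : m ≤ Module.finrank F V := by
    have := finrank_K_add_finrank_U s
    omega
  set T := Γ.comap s.B with hT
  have hKu : Nat.card Kˣ = q ^ m - 1 := by rw [Nat.card_units, hKc]
  have hpow : 0 < q ^ m := by positivity
  have hker : Nat.card (powMonoidHom (q - 1) : Kˣ →* Kˣ).ker ≤ q - 1 := by
    classical
    have := Fintype.ofFinite Kˣ
    rw [Nat.card_eq_fintype_card, Fintype.card_subtype]
    refine le_trans (Finset.card_le_card fun u hu => ?_)
      (IsCyclic.card_pow_eq_one_le (α := Kˣ) (n := q - 1) (by omega))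
    simpa [MonoidHom.mem_ker] using hu
  have hrange : Nat.card (powMonoidHom (q - 1) : Kˣ →* Kˣ).range ≤ Nat.card T := by
    apply Nat.card_mono (Set.toFinite _)
    rintro _ ⟨t, rfl⟩
    exact h t
  have hmul : Nat.card (powMonoidHom (q - 1) : Kˣ →* Kˣ).ker *
      Nat.card (powMonoidHom (q - 1) : Kˣ →* Kˣ).range = q ^ m - 1 := by
    rw [← hKu, ← Subgroup.index_ker]
    exact Subgroup.card_mul_index _
  have hTge : repunit q m ≤ Nat.card T := by
    have h1 : repunit q m * (q - 1) ≤ Nat.card T * (q - 1) := by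
      rw [repunit_mul hq, ← hmul, mul_comm]
      exact Nat.mul_le_mul hrange hker
    exact Nat.le_of_mul_le_mul_right h1 (by omega)
  obtain ⟨g, hg⟩ : Nat.card T ∣ q ^ m - 1 := hKu ▸ Subgroup.card_subgroup_dvd_card T
  have hgq : g ≤ q - 1 := by
    have h1 : repunit q m * g ≤ repunit q m * (q - 1) := by
      rw [repunit_mul hq, hg]
      exact Nat.mul_le_mul_right _ hTge
    exact Nat.le_of_mul_le_mul_left h1 (repunit_pos (by omega) (by omega))
  refine ⟨g, q ^ 2, ⟨?_, ?_, ?_, ?_⟩⟩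
  · rw [hKc, mul_comm, ← hg]; omega
  · nlinarith [Nat.sub_add_cancel (show 1 ≤ q by omega)]
  · rw [hKc, hVc, ← pow_mul]
    exact Nat.pow_lt_pow_right (by omega) (by omega)
  · intro z hz
    rw [hKc, hVc] at hz
    rw [hKc]
    exact thick_arith hq hmn hdim ((pow_pred_add_le_repunit (by omega)).trans hTge) hgq hz

theorem cyc_of_pow [Finite F] [Finite K] {x : V ≃ₗ[F] V} {β : Kˣ} (hxΓ : x ∈ Γ)
    (hsc : HasScalars Γ) (hx : ∀ k, x (s.ι k) = s.ι (β * k)) (hβ : ProjGen F β) {N : ℕ}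
    (hN : N.Coprime (repunit (Nat.card F) (Module.finrank F K))) {c : F} (hc : c ≠ 0)
    (hP : ∀ v ∈ P, (x ^ N) v = c • v) (t : Kˣ) :
    ∃ γ ∈ Γ, ∃ c : F, c ≠ 0 ∧ (∀ v ∈ P, γ v = v) ∧ ∀ k, γ (s.ι k) = c • s.ι (t * k) := by
  have hq : 2 ≤ Nat.card F := Finite.one_lt_card
  have : Module.Finite F K := Module.Finite.of_finite
  obtain ⟨i, d, hd, htd⟩ := hβ t
  obtain ⟨j, hj⟩ := exists_mul_modEq hN (repunit_pos (by omega) Module.finrank_pos) i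
  obtain ⟨e, he0, he⟩ : ∃ e : F, e ≠ 0 ∧ ((β ^ (N * j) * (β ^ i)⁻¹ : Kˣ) : K) =
      algebraMap F K e := by
    apply mem_base_of_pow_eq
    rw [mul_pow, inv_pow, mul_inv_eq_one, ← pow_mul, ← pow_mul, pow_eq_pow_iff_modEq]
    refine Nat.ModEq.of_dvd (orderOf_dvd_of_pow_eq_one (pow_card_sub_one_eq_one (F := F) β)) ?_
    rw [← repunit_mul hq]
    exact hj.mul_right' _
  obtain ⟨γ, hγ, hγc⟩ := hsc ((c ^ j)⁻¹) (inv_ne_zero (pow_ne_zero _ hc))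
  refine ⟨γ * x ^ (N * j), Γ.mul_mem hγ (Γ.pow_mem hxΓ _), (c ^ j)⁻¹ * (e * d⁻¹),
    by positivity, fun v hv => ?_, fun k => ?_⟩
  · rw [LinearEquiv.mul_apply, pow_mul, pow_apply_of_smul (hP v hv), hγc, smul_smul,
      inv_mul_cancel₀ (pow_ne_zero _ hc), one_smul]
  · rw [LinearEquiv.mul_apply, pow_iota hx, hγc, mul_smul]
    congr 1
    rw [← map_smul, Algebra.smul_def, htd, map_mul (algebraMap F K), map_inv₀, ← he]
    congr 1
    have hd' : algebraMap F K d ≠ 0 := by simpa using hd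
    push_cast
    field_simp
    try ring

theorem rich_of_orderOf [Finite F] [Finite K] {t : Kˣ} (ht : s.B t ∈ Γ)
    (hm : 2 ≤ Module.finrank F K)
    (hord : ∀ d, 0 < d → d ∣ Module.finrank F K → d < Module.finrank F K →
      ¬ orderOf t ∣ Nat.card F ^ d - 1) : Rich Γ s := by
  have : Module.Finite F K := Module.Finite.of_finite
  have htop : IntermediateField.adjoin F {(t : K)} = ⊤ := by
    set L := IntermediateField.adjoin F {(t : K)} with hL
    by_contra hne
    have hd : Module.finrank F L ∣ Module.finrank F K :=
        ⟨_, (Module.finrank_mul_finrank F L K).symm⟩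
    have hlt : Module.finrank F L < Module.finrank F K := by
      refine lt_of_le_of_ne (Nat.le_of_dvd (by omega) hd) fun h => hne ?_
      exact IntermediateField.eq_of_le_of_finrank_eq le_top
        (by rw [h, IntermediateField.finrank_top'])
    refine hord _ Module.finrank_pos hd hlt (orderOf_dvd_of_pow_eq_one ?_)
    have htL : (t : K) ∈ L := IntermediateField.mem_adjoin_simple_self F (t : K)
    let t' : Lˣ := Units.mk0 ⟨t, htL⟩ (fun h => t.ne_zero (congrArg Subtype.val h))
    have h1 := pow_card_sub_one_eq_one (F := F) t'
    apply Units.ext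
    have h2 := congrArg (fun u : Lˣ => ((u : L) : K)) h1
    simpa [t'] using h2
  set S := Submodule.span F {x : K | ∃ u ∈ Γ.comap s.B, x = (u : K) - 1} with hS
  have hmulS : ∀ y ∈ S, (t : K) * y ∈ S := by
    intro y hy
    induction hy using Submodule.span_induction with
    | mem y hy =>
      obtain ⟨u, hu, rfl⟩ := hy
      have e : (t : K) * ((u : K) - 1) = (((t * u : Kˣ) : K) - 1) - ((t : K) - 1) := by
        push_cast; ring
      rw [e]
      exact S.sub_mem (Submodule.subset_span ⟨t * u, Subgroup.mul_mem _ ht hu, rfl⟩)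
        (Submodule.subset_span ⟨t, ht, rfl⟩)
    | zero => rw [mul_zero]; exact S.zero_mem
    | add a b _ _ h1 h2 => rw [mul_add]; exact S.add_mem h1 h2
    | smul c a _ h1 => rw [mul_smul_comm]; exact S.smul_mem c h1
  have hall : ∀ y ∈ Algebra.adjoin F {(t : K)}, ∀ z ∈ S, y * z ∈ S := by
    intro y hy
    induction hy using Algebra.adjoin_induction with
    | mem y hy => rw [Set.mem_singleton_iff.mp hy]; exact hmulS
    | algebraMap r => intro z hz; rw [← Algebra.smul_def]; exact S.smul_mem r hz
    | add a b _ _ h1 h2 => intro z hz; rw [add_mul]; exact S.add_mem (h1 z hz) (h2 z hz)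
    | mul a b _ _ h1 h2 => intro z hz; rw [mul_assoc]; exact h1 _ (h2 _ hz)
  have htop' : Algebra.adjoin F {(t : K)} = ⊤ := by
    rw [← IntermediateField.adjoin_simple_toSubalgebra_of_isAlgebraic
      (Algebra.IsAlgebraic.isAlgebraic (t : K)), htop]
    rfl
  have ht1 : (t : K) - 1 ≠ 0 := by
    intro h
    have : t = 1 := Units.ext (by rw [Units.val_one]; exact sub_eq_zero.mp h)
    refine hord 1 one_pos (one_dvd _) (by omega) ?_
    rw [this, orderOf_one]
    exact one_dvd _
  rw [Rich, ← hS, eq_top_iff]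
  intro y _
  have h := hall (y * ((t : K) - 1)⁻¹) (by rw [htop']; trivial) _
    (Submodule.subset_span ⟨t, ht, rfl⟩)
  rwa [inv_mul_cancel_right₀ ht1] at h

end FieldSplit

theorem repunit_coprime {q k m : ℕ} (hq : 2 ≤ q) (h : k.Coprime m) :
    (repunit q k).Coprime (repunit q m) := by
  have h1 : Nat.gcd (repunit q k) (repunit q m) * (q - 1) = 1 * (q - 1) := by
    rw [← Nat.gcd_mul_right, repunit_mul hq, repunit_mul hq, Nat.pow_sub_one_gcd_pow_sub_one,
      h, pow_one, one_mul]
  exact Nat.eq_of_mul_eq_mul_right (by omega) h1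

namespace FieldSplit

variable {F K A B V W' : Type*} [Field F] [Field K] [Algebra F K] [Field A] [Algebra F A]
  [Field B] [Algebra F B] [AddCommGroup V] [Module F V] [AddCommGroup W'] [Module F W']
variable {Γ : Subgroup (V ≃ₗ[F] V)} {s : FieldSplit F K V} {P : Submodule F V}

/-- The decomposition given by an identification of `V` with a product of `K` and another space. -/
def ofEquiv (e : V ≃ₗ[F] K × W') : FieldSplit F K V where
  ι := e.symm.toLinearMap ∘ₗ LinearMap.inl F K W'
  π := LinearMap.fst F K W' ∘ₗ e.toLinearMap
  proj k := by simp

theorem ofEquiv_iota (e : V ≃ₗ[F] K × W') (k : K) : (ofEquiv e).ι k = e.symm (k, 0) := rfl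

theorem mem_ofEquiv_U {e : V ≃ₗ[F] K × W'} {v : V} : v ∈ (ofEquiv e).U ↔ (e v).1 = 0 := mem_U

theorem mem_ofEquiv_W {e : V ≃ₗ[F] K × W'} {v : V} : v ∈ (ofEquiv e).W ↔ (e v).2 = 0 := by
  rw [mem_W, ofEquiv_iota, LinearEquiv.symm_apply_eq]
  constructor
  · intro h; rw [← h]
  · intro h; exact Prod.ext rfl h.symm

theorem rich_of_pow [Finite F] [Finite K] {x : V ≃ₗ[F] V} (hxΓ : x ∈ Γ) {α η : Kˣ}
    (hx : ∀ k, x (s.ι k) = s.ι (α * k)) {c : F} (hc : c ≠ 0) (hα : (α : K) = algebraMap F K c * η)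
    {R : ℕ} (hR : Nat.card F - 1 ∣ R) (hU : ∀ v ∈ s.U, (x ^ R) v = v)
    (hm : 2 ≤ Module.finrank F K)
    (hord : ∀ d, 0 < d → d ∣ Module.finrank F K → d < Module.finrank F K →
      ¬ orderOf η ∣ R * (Nat.card F ^ d - 1)) : Rich Γ s := by
  obtain ⟨r, rfl⟩ := hR
  have h1 : α ^ ((Nat.card F - 1) * r) = η ^ ((Nat.card F - 1) * r) := by
    apply Units.ext
    push_cast
    rw [hα, mul_pow, pow_mul (algebraMap F K c), algebraMap_pow_card hc, one_pow, one_mul]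
  have h2 : x ^ ((Nat.card F - 1) * r) = s.B (η ^ ((Nat.card F - 1) * r)) :=
    eq_B_of_fix (fun k => by rw [pow_iota hx, ← Units.val_pow_eq_pow_val, h1]) hU
  refine rich_of_orderOf (t := η ^ ((Nat.card F - 1) * r)) (by rw [← h2]; exact Γ.pow_mem hxΓ _) hm
    fun d h0 hd hlt hdvd => hord d h0 hd hlt ?_
  rw [orderOf_dvd_iff_pow_eq_one] at hdvd ⊢
  rw [pow_mul, hdvd]

theorem rich_of_projGen [Finite F] [Finite K] {x : V ≃ₗ[F] V} {β : Kˣ} (hxΓ : x ∈ Γ)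
    (hx : ∀ k, x (s.ι k) = s.ι (β * k)) (hβ : ProjGen F β) {N : ℕ}
    (hN : N.Coprime (repunit (Nat.card F) (Module.finrank F K)))
    (hU : ∀ v ∈ s.U, (x ^ (N * (Nat.card F - 1))) v = v) (hm : 2 ≤ Module.finrank F K) :
    Rich Γ s := by
  have hq : 2 ≤ Nat.card F := Finite.one_lt_card
  obtain ⟨t, ht⟩ := IsCyclic.exists_generator (α := Kˣ)
  have hord : orderOf t = Nat.card F ^ Module.finrank F K - 1 := by
    rw [orderOf_eq_card_of_forall_mem_zpowers ht, Nat.card_units, natCard_field_eq_pow (F := F)]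
  refine rich_of_orderOf (B_pow_mem hxΓ hx hβ hN hU t) hm fun d h0 _ hlt hdvd => ?_
  rw [orderOf_dvd_iff_pow_eq_one, ← pow_mul, ← orderOf_dvd_iff_pow_eq_one, hord] at hdvd
  have hqd : 2 ≤ Nat.card F ^ d := hq.trans (Nat.le_self_pow (by omega) _)
  have h1 := Nat.le_of_dvd (Nat.mul_pos (by omega) (by omega)) hdvd
  have h2 : Nat.card F ^ d * Nat.card F ≤ Nat.card F ^ Module.finrank F K := by
    rw [← pow_succ]; exact Nat.pow_le_pow_right (by omega) hlt
  have h3 : (Nat.card F - 1) * (Nat.card F ^ d - 1) + Nat.card F ^ d + Nat.card F =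
      Nat.card F ^ d * Nat.card F + 1 := by
    zify [show 1 ≤ Nat.card F by omega, show 1 ≤ Nat.card F ^ d by omega]
    ring
  omega

theorem scalar_mul_pow [Finite F] {α η : Kˣ} {c : F} (hc : c ≠ 0)
    (hα : (α : K) = algebraMap F K c * η) {l R : ℕ} (hη : η ^ l = 1) (hl : l ∣ R)
    (hR : Nat.card F - 1 ∣ R) : α ^ R = 1 := by
  obtain ⟨r, rfl⟩ := hR
  apply Units.ext
  push_cast
  rw [hα, mul_pow, pow_mul (algebraMap F K c), algebraMap_pow_card hc, one_pow, one_mul,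
    ← Units.val_pow_eq_pow_val]
  obtain ⟨k, hk⟩ := hl
  rw [hk, pow_mul, hη, one_pow, Units.val_one]

theorem fix_of_pow_eq_one {x : V ≃ₗ[F] V} {α : Kˣ} (hx : ∀ k, x (s.ι k) = s.ι (α * k)) {R : ℕ}
    (h : α ^ R = 1) {v : V} (hv : v ∈ s.W) : (x ^ R) v = v := by
  obtain ⟨k, rfl⟩ := hv
  rw [pow_iota hx, ← Units.val_pow_eq_pow_val, h, Units.val_one, one_mul]

theorem smul_of_pow {x : V ≃ₗ[F] V} {α η : Kˣ} (hx : ∀ k, x (s.ι k) = s.ι (α * k)) {c : F}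
    (hα : (α : K) = algebraMap F K c * η) {l : ℕ} (hη : η ^ l = 1) {v : V} (hv : v ∈ s.W) :
    (x ^ l) v = c ^ l • v := by
  obtain ⟨k, rfl⟩ := hv
  rw [pow_iota hx, ← map_smul, Algebra.smul_def, hα, mul_pow, ← Units.val_pow_eq_pow_val, hη,
    Units.val_one, mul_one, map_pow]

theorem map_pow_eq {x : V ≃ₗ[F] V} {N : Submodule F V} (hN : N.map x.toLinearMap = N) :
    ∀ γ ∈ Subgroup.zpowers x, N.map γ.toLinearMap = N := by
  intro γ hγ
  rw [Subgroup.zpowers_eq_closure] at hγ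
  induction hγ using Subgroup.closure_induction with
  | mem y hy => rw [Set.mem_singleton_iff.mp hy]; exact hN
  | one => exact Submodule.map_id N
  | mul a b _ _ h1 h2 => rw [map_mul_equiv, h2, h1]
  | inv a _ h1 =>
    conv_lhs => rw [← h1]
    rw [map_inv_map]

/-- Conditions on multipliers giving an element with two blocks of coprime sizes. -/
structure TwoAdm (F : Type*) {A K : Type*} [Field F] [Field A] [Field K] [Algebra F A]
    [Algebra F K] (α : Aˣ) (β : Kˣ) : Prop where
  gen : ProjGen F β
  cop : Nat.Coprime (Module.finrank F A) (Module.finrank F K)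
  dim : 5 ≤ Module.finrank F A
  gap : Module.finrank F A + 9 ≤ Module.finrank F K
  ord : ∃ c : F, c ≠ 0 ∧ ∃ η : Aˣ, (α : A) = algebraMap F A c * η ∧
    orderOf η = repunit (Nat.card F) (Module.finrank F A)

/-- `x` acts as multiplication by `α` and `β` on two summands. -/
def ActsTwo (x : V ≃ₗ[F] V) (e : V ≃ₗ[F] A × K) (α : Aˣ) (β : Kˣ) : Prop :=
  ∀ v, e (x v) = ((α : A) * (e v).1, (β : K) * (e v).2)

section two

variable {x : V ≃ₗ[F] V} {e : V ≃ₗ[F] A × K} {α : Aˣ} {β : Kˣ}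

/-- The first summand. -/
abbrev two1 (e : V ≃ₗ[F] A × K) : FieldSplit F A V := ofEquiv e

/-- The second summand. -/
abbrev two2 (e : V ≃ₗ[F] A × K) : FieldSplit F K V := ofEquiv (e.trans (LinearEquiv.prodComm F A K))

theorem two_WU (e : V ≃ₗ[F] A × K) : (two1 e).W = (two2 e).U := by
  ext v; rw [mem_ofEquiv_W, mem_ofEquiv_U]; rfl

theorem two_UW (e : V ≃ₗ[F] A × K) : (two1 e).U = (two2 e).W := by
  ext v; rw [mem_ofEquiv_W, mem_ofEquiv_U]; rfl

theorem ActsTwo.fst (h : ActsTwo x e α β) (a : A) : x ((two1 e).ι a) = (two1 e).ι (α * a) := by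
  apply e.injective
  rw [h, ofEquiv_iota, ofEquiv_iota]
  simp

theorem ActsTwo.snd (h : ActsTwo x e α β) (a : K) : x ((two2 e).ι a) = (two2 e).ι (β * a) := by
  apply e.injective
  rw [h, ofEquiv_iota, ofEquiv_iota]
  simp

theorem finrank_eq_add [Module.Finite F A] [Module.Finite F K] (e : V ≃ₗ[F] A × K) :
    Module.finrank F V = Module.finrank F A + Module.finrank F K := by
  rw [e.finrank_eq, Module.finrank_prod]

variable [Finite F] [Finite K]

theorem TwoAdm.rich2 (h : TwoAdm F α β) (hx : ActsTwo x e α β) (hxΓ : x ∈ Γ) :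
    Rich Γ (two2 e) := by
  have hq : 2 ≤ Nat.card F := Finite.one_lt_card
  obtain ⟨c, hc, η, hα, hη⟩ := h.ord
  refine rich_of_projGen hxΓ hx.snd h.gen (repunit_coprime hq h.cop) (fun v hv => ?_)
    (by have := h.gap; omega)
  rw [← two_WU] at hv
  exact fix_of_pow_eq_one hx.fst (scalar_mul_pow hc hα (hη ▸ pow_orderOf_eq_one η)
    (dvd_mul_right _ _) (dvd_mul_left _ _)) hv

variable [Finite A]

theorem TwoAdm.rich1 (h : TwoAdm F α β) (hx : ActsTwo x e α β) (hxΓ : x ∈ Γ) :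
    Rich Γ (two1 e) := by
  have hq : 2 ≤ Nat.card F := Finite.one_lt_card
  have h5 := h.dim
  obtain ⟨c, hc, η, hα, hη⟩ := h.ord
  have hR := repunit_mul hq (Module.finrank F K)
  refine rich_of_pow (R := repunit (Nat.card F) (Module.finrank F K) * (Nat.card F - 1)) hxΓ hx.fst
    hc hα (dvd_mul_left _ _) (fun v hv => ?_) (by omega) fun d h0 hd hlt hdvd => ?_
  · rw [two_UW] at hv
    exact fix_of_pow_eq_one hx.snd (by rw [hR]; exact pow_card_sub_one_eq_one β) hv
  · rw [hη, mul_assoc] at hdvd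
    have h1 := (repunit_coprime hq h.cop).dvd_of_dvd_mul_left hdvd
    have hqd : 2 ≤ Nat.card F ^ d := hq.trans (Nat.le_self_pow (by omega) _)
    have h2 := Nat.le_of_dvd (Nat.mul_pos (by omega) (by omega)) h1
    have h3 : (Nat.card F - 1) * (Nat.card F ^ d - 1) < Nat.card F * Nat.card F ^ d :=
      Nat.mul_lt_mul'' (by omega) (by omega)
    rw [← pow_succ'] at h3
    have h4 : d + 1 ≤ Module.finrank F A - 1 := by
      obtain ⟨k, hk⟩ := hd
      have hk2 : 2 ≤ k := by
        by_contra hcon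
        interval_cases k <;> omega
      have : d * 2 ≤ d * k := Nat.mul_le_mul_left _ hk2
      omega
    have h6 : Nat.card F ^ (d + 1) ≤ Nat.card F ^ (Module.finrank F A - 1) :=
      Nat.pow_le_pow_right (by omega) h4
    have h7 := pow_pred_le_repunit (q := Nat.card F) (m := Module.finrank F A) (by omega)
    omega

theorem TwoAdm.core [Finite V] (h : TwoAdm F α β) (hx : ActsTwo x e α β) (hxΓ : x ∈ Γ)
    (hsc : HasScalars Γ) : Core Γ (two2 e) (two1 e).W := by
  have hq : 2 ≤ Nat.card F := Finite.one_lt_card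
  have : Module.Finite F A := Module.Finite.of_finite
  have : Module.Finite F K := Module.Finite.of_finite
  obtain ⟨c, hc, η, hα, hη⟩ := h.ord
  have hη' := hη ▸ pow_orderOf_eq_one η
  refine ⟨thick_of_pow_mem (B_pow_mem hxΓ hx.snd h.gen (repunit_coprime hq h.cop) fun v hv => ?_)
    ?_,
    cyc_of_pow hxΓ hsc hx.snd h.gen (repunit_coprime hq h.cop) (pow_ne_zero _ hc)
      fun v hv => smul_of_pow hx.fst hα hη' hv, h.rich2 hx hxΓ⟩
  · rw [← two_WU] at hv
    exact fix_of_pow_eq_one hx.fst (scalar_mul_pow hc hα hη'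
      (dvd_mul_right _ _) (dvd_mul_left _ _)) hv
  · rw [finrank_eq_add e]
    have := h.gap
    omega

theorem TwoAdm.invariant [Finite V] (h : TwoAdm F α β) (hx : ActsTwo x e α β)
    {N : Submodule F V} (hN : N.map x.toLinearMap = N) :
    N = ⊥ ∨ N = ⊤ ∨ Module.finrank F N = Module.finrank F A ∨
      Module.finrank F N + Module.finrank F A = Module.finrank F V := by
  have : Module.Finite F V := Module.Finite.of_finite
  have hxΓ := Subgroup.mem_zpowers x
  exact finrank_eq_of_two (two_WU e) (two_UW e)
    ((h.rich1 hx hxΓ).dichotomy fun t ht => map_pow_eq hN _ ht)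
    ((h.rich2 hx hxΓ).dichotomy fun t ht => map_pow_eq hN _ ht)

theorem TwoAdm.transvections [Finite V] (h : TwoAdm F α β) (hx : ActsTwo x e α β) (hxΓ : x ∈ Γ)
    (hsc : HasScalars Γ) (hirr : IrredOn Γ) (u : V) (l : V →ₗ[F] F) (hlu : l u = 0) :
    ∃ γ ∈ Γ, ∀ v, γ v = v + l v • u := by
  have hq : 2 ≤ Nat.card F := Finite.one_lt_card
  have h5 := h.dim
  have h9 := h.gap
  refine transvections_of_two (h.core hx hxΓ hsc) (h.rich1 hx hxΓ) (two_WU e) (two_UW e) hirr ?_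
    h.cop (by omega) (by omega) u l hlu
  rw [natCard_field_eq_pow (F := F) (K := K)]
  calc 2 * Nat.card F ^ 2 ≤ Nat.card F * Nat.card F ^ 2 := Nat.mul_le_mul_right _ hq
    _ = Nat.card F ^ 3 := by ring
    _ < Nat.card F ^ Module.finrank F K := Nat.pow_lt_pow_right (by omega) (by omega)

end two

end FieldSplit

namespace FieldSplit

variable {F K A B V : Type*} [Field F] [Field K] [Algebra F K] [Field A] [Algebra F A]
  [Field B] [Algebra F B] [AddCommGroup V] [Module F V]
variable {Γ : Subgroup (V ≃ₗ[F] V)}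

/-- Conditions on multipliers giving an element with three blocks, two of them controlled by the
primes `l₁` and `l₂`. -/
structure ThreeAdm (F : Type*) {A B K : Type*} [Field F] [Field A] [Field B] [Field K]
    [Algebra F A] [Algebra F B] [Algebra F K] (l₁ l₂ : ℕ) (α : Aˣ) (α' : Bˣ) (β : Kˣ) : Prop where
  gen : ProjGen F β
  prime₁ : l₁.Prime
  prime₂ : l₂.Prime
  ord₁ : ∃ c : F, c ≠ 0 ∧ ∃ η : Aˣ, (α : A) = algebraMap F A c * η ∧ orderOf η = l₁
  ord₂ : ∃ c : F, c ≠ 0 ∧ ∃ η : Bˣ, (α' : B) = algebraMap F B c * η ∧ orderOf η = l₂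
  dvd₁ : ∀ d, l₁ ∣ Nat.card F ^ d - 1 ↔ Module.finrank F A ∣ d
  dvd₂ : ∀ d, l₂ ∣ Nat.card F ^ d - 1 ↔ Module.finrank F B ∣ d
  not_dvd₁ : ¬ Module.finrank F A ∣ Module.finrank F K
  not_dvd₂ : ¬ Module.finrank F B ∣ Module.finrank F K
  lt : Module.finrank F A < Module.finrank F B
  dim : 5 ≤ Module.finrank F A
  gap : Module.finrank F A + Module.finrank F B + 9 ≤ Module.finrank F K
  cop : Nat.Coprime (Nat.gcd (Module.finrank F A) (Module.finrank F B))
    (Module.finrank F A + (Module.finrank F B + Module.finrank F K))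

/-- `x` acts as multiplication on three summands. -/
def ActsThree (x : V ≃ₗ[F] V) (e : V ≃ₗ[F] A × B × K) (α : Aˣ) (α' : Bˣ) (β : Kˣ) : Prop :=
  ∀ v, e (x v) = ((α : A) * (e v).1, (α' : B) * (e v).2.1, (β : K) * (e v).2.2)

variable {x : V ≃ₗ[F] V} {e : V ≃ₗ[F] A × B × K} {α : Aˣ} {α' : Bˣ} {β : Kˣ} {l₁ l₂ : ℕ}

/-- The first of three summands. -/
abbrev three1 (e : V ≃ₗ[F] A × B × K) : FieldSplit F A V := ofEquiv e

/-- The second of three summands. -/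
abbrev three2 (e : V ≃ₗ[F] A × B × K) : FieldSplit F B V :=
  ofEquiv (e.trans ((LinearEquiv.prodComm F A (B × K)).trans (LinearEquiv.prodAssoc F B K A)))

/-- The third of three summands. -/
abbrev three3 (e : V ≃ₗ[F] A × B × K) : FieldSplit F K V :=
  ofEquiv (e.trans ((LinearEquiv.prodAssoc F A B K).symm.trans (LinearEquiv.prodComm F (A × B) K)))

theorem mem_three1_W {v : V} : v ∈ (three1 e).W ↔ (e v).2.1 = 0 ∧ (e v).2.2 = 0 := by
  rw [mem_ofEquiv_W, Prod.ext_iff]; rfl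

theorem mem_three2_W {v : V} : v ∈ (three2 e).W ↔ (e v).2.2 = 0 ∧ (e v).1 = 0 := by
  rw [mem_ofEquiv_W, Prod.ext_iff]; rfl

theorem mem_three3_W {v : V} : v ∈ (three3 e).W ↔ (e v).1 = 0 ∧ (e v).2.1 = 0 := by
  rw [mem_ofEquiv_W, Prod.ext_iff]; rfl

theorem mem_three1_U {v : V} : v ∈ (three1 e).U ↔ (e v).1 = 0 := mem_ofEquiv_U

theorem mem_three2_U {v : V} : v ∈ (three2 e).U ↔ (e v).2.1 = 0 := mem_ofEquiv_U

theorem mem_three3_U {v : V} : v ∈ (three3 e).U ↔ (e v).2.2 = 0 := mem_ofEquiv_U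

theorem finrank_eq_add_add [Module.Finite F A] [Module.Finite F B] [Module.Finite F K]
    (e : V ≃ₗ[F] A × B × K) :
    Module.finrank F V = Module.finrank F A + (Module.finrank F B + Module.finrank F K) := by
  rw [e.finrank_eq, Module.finrank_prod, Module.finrank_prod]

theorem triple_three [Module.Finite F A] [Module.Finite F B] [Module.Finite F K]
    (e : V ≃ₗ[F] A × B × K) : Triple (three1 e) (three2 e) (three3 e) where
  AB v h := mem_three2_U.mpr (mem_three1_W.mp h).1
  BA v h := mem_three1_U.mpr (mem_three2_W.mp h).2
  AK v h := mem_three3_U.mpr (mem_three1_W.mp h).2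
  KA v h := mem_three1_U.mpr (mem_three3_W.mp h).1
  BK v h := mem_three3_U.mpr (mem_three2_W.mp h).1
  KB v h := mem_three2_U.mpr (mem_three3_W.mp h).2
  rank := by rw [finrank_eq_add_add e, add_assoc]

theorem ActsThree.fst (h : ActsThree x e α α' β) (a : A) :
    x ((three1 e).ι a) = (three1 e).ι (α * a) := by
  apply e.injective
  rw [h, ofEquiv_iota, ofEquiv_iota]
  simp

theorem ActsThree.snd (h : ActsThree x e α α' β) (a : B) :
    x ((three2 e).ι a) = (three2 e).ι (α' * a) := by
  apply e.injective
  rw [h, ofEquiv_iota, ofEquiv_iota]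
  simp
  change ((α : A) * 0, (α' : B) * a, (β : K) * 0) = (0, (α' : B) * a, 0)
  simp

theorem ActsThree.thd (h : ActsThree x e α α' β) (a : K) :
    x ((three3 e).ι a) = (three3 e).ι (β * a) := by
  apply e.injective
  rw [h, ofEquiv_iota, ofEquiv_iota]
  simp

/-- An automorphism fixing two of three summands fixes their sum. -/
theorem Triple.fix [Module.Finite F V] {sA : FieldSplit F A V} {sB : FieldSplit F B V}
    {s : FieldSplit F K V} (h : Triple sA sB s) {y : V ≃ₗ[F] V} (hA : ∀ v ∈ sA.W, y v = v)
    (hB : ∀ v ∈ sB.W, y v = v) : ∀ v ∈ s.U, y v = v := by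
  intro v hv
  rw [← h.sup_eq] at hv
  obtain ⟨a, ha, b, hb, rfl⟩ := Submodule.mem_sup.mp hv
  rw [map_add, hA a ha, hB b hb]

theorem ThreeAdm.ne (h : ThreeAdm F l₁ l₂ α α' β) : l₁ ≠ l₂ := by
  rintro rfl
  have h1 := (h.dvd₁ _).mp ((h.dvd₂ _).mpr dvd_rfl)
  have h2 := (h.dvd₂ _).mp ((h.dvd₁ _).mpr dvd_rfl)
  exact h.lt.ne (Nat.dvd_antisymm h1 h2)

theorem map_W_of_mul {s : FieldSplit F A V} (hx : ∀ k, x (s.ι k) = s.ι (α * k)) :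
    s.W.map x.toLinearMap = s.W := by
  ext v
  constructor
  · rintro ⟨_, ⟨k, rfl⟩, rfl⟩
    exact ⟨α * k, (hx k).symm⟩
  · rintro ⟨k, rfl⟩
    refine ⟨s.ι (((α⁻¹ : Aˣ) : A) * k), s.iota_mem_W _, ?_⟩
    change x (s.ι _) = _
    rw [hx, ← mul_assoc, Units.mul_inv, one_mul]

variable [Finite F]

theorem ThreeAdm.coprime (h : ThreeAdm F l₁ l₂ α α' β) :
    (l₁ * l₂).Coprime (repunit (Nat.card F) (Module.finrank F K)) := by
  have hq : 2 ≤ Nat.card F := Finite.one_lt_card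
  have hR := repunit_mul hq (Module.finrank F K)
  refine Nat.Coprime.mul_left ?_ ?_
  · rw [h.prime₁.coprime_iff_not_dvd]
    intro hd
    exact h.not_dvd₁ ((h.dvd₁ _).mp (hR ▸ hd.mul_right _))
  · rw [h.prime₂.coprime_iff_not_dvd]
    intro hd
    exact h.not_dvd₂ ((h.dvd₂ _).mp (hR ▸ hd.mul_right _))

theorem rich_of_prime [Finite A] {s : FieldSplit F A V} {l l' m : ℕ} (hxΓ : x ∈ Γ)
    (hx : ∀ k, x (s.ι k) = s.ι (α * k)) (hl : l.Prime) (hl' : l'.Prime) (hne : l ≠ l')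
    (hα : ∃ c : F, c ≠ 0 ∧ ∃ η : Aˣ, (α : A) = algebraMap F A c * η ∧ orderOf η = l)
    (hdvd : ∀ d, l ∣ Nat.card F ^ d - 1 ↔ Module.finrank F A ∣ d)
    (hm : ¬ Module.finrank F A ∣ m) (h2 : 2 ≤ Module.finrank F A)
    (hU : ∀ v ∈ s.U, (x ^ (l' * (Nat.card F ^ m - 1))) v = v) : Rich Γ s := by
  obtain ⟨c, hc, η, hα, hη⟩ := hα
  refine rich_of_pow hxΓ hx hc hα ((Nat.sub_one_dvd_pow_sub_one _ _).mul_left _) hU h2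
    fun d h0 _ hlt hd => ?_
  rw [hη, hl.dvd_mul, hl.dvd_mul, hdvd, hdvd] at hd
  rcases hd with (hd | hd) | hd
  · exact hne ((Nat.prime_dvd_prime_iff_eq hl hl').mp hd)
  · exact hm hd
  · exact absurd (Nat.le_of_dvd h0 hd) (by omega)

variable [Finite K]

section finiteV

variable [Finite V] [Finite A] [Finite B]

theorem ThreeAdm.fix_U (h : ThreeAdm F l₁ l₂ α α' β) (hx : ActsThree x e α α' β) :
    ∀ v ∈ (three3 e).U, (x ^ (l₁ * l₂ * (Nat.card F - 1))) v = v := by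
  have : Module.Finite F V := Module.Finite.of_finite
  obtain ⟨c, hc, η, hα, hη⟩ := h.ord₁
  obtain ⟨c', hc', η', hα', hη'⟩ := h.ord₂
  exact (triple_three e).fix
    (fun v => fix_of_pow_eq_one hx.fst (scalar_mul_pow hc hα (hη ▸ pow_orderOf_eq_one η)
      (Dvd.intro _ (by ring : l₁ * (l₂ * (Nat.card F - 1)) = _)) (dvd_mul_left _ _)))
    (fun v => fix_of_pow_eq_one hx.snd (scalar_mul_pow hc' hα' (hη' ▸ pow_orderOf_eq_one η')
      (Dvd.intro _ (by ring : l₂ * (l₁ * (Nat.card F - 1)) = _)) (dvd_mul_left _ _)))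

theorem ThreeAdm.rich3 (h : ThreeAdm F l₁ l₂ α α' β) (hx : ActsThree x e α α' β) (hxΓ : x ∈ Γ) :
    Rich Γ (three3 e) :=
  rich_of_projGen hxΓ hx.thd h.gen h.coprime (h.fix_U hx) (by have := h.gap; omega)

theorem ThreeAdm.rich1 (h : ThreeAdm F l₁ l₂ α α' β) (hx : ActsThree x e α α' β) (hxΓ : x ∈ Γ) :
    Rich Γ (three1 e) := by
  have : Module.Finite F V := Module.Finite.of_finite
  obtain ⟨c, hc, η, hα, hη⟩ := h.ord₂
  exact rich_of_prime hxΓ hx.fst h.prime₁ h.prime₂ h.ne h.ord₁ h.dvd₁ h.not_dvd₁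
    (by have := h.dim; omega) ((triple_three e).rotate.fix
      (fun v => fix_of_pow_eq_one hx.snd (scalar_mul_pow hc hα (hη ▸ pow_orderOf_eq_one η)
        (dvd_mul_right _ _) ((Nat.sub_one_dvd_pow_sub_one _ _).mul_left _)))
      (fun v => fix_of_pow_eq_one hx.thd (by rw [mul_comm, pow_mul, pow_card_sub_one_eq_one,
        one_pow])))

theorem ThreeAdm.rich2 (h : ThreeAdm F l₁ l₂ α α' β) (hx : ActsThree x e α α' β) (hxΓ : x ∈ Γ) :
    Rich Γ (three2 e) := by
  have : Module.Finite F V := Module.Finite.of_finite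
  obtain ⟨c, hc, η, hα, hη⟩ := h.ord₁
  exact rich_of_prime hxΓ hx.snd h.prime₂ h.prime₁ h.ne.symm h.ord₂ h.dvd₂ h.not_dvd₂
    (by have := h.dim; have := h.lt; omega) ((triple_three e).swap.rotate.fix
      (fun v => fix_of_pow_eq_one hx.fst (scalar_mul_pow hc hα (hη ▸ pow_orderOf_eq_one η)
        (dvd_mul_right _ _) ((Nat.sub_one_dvd_pow_sub_one _ _).mul_left _)))
      (fun v => fix_of_pow_eq_one hx.thd (by rw [mul_comm, pow_mul, pow_card_sub_one_eq_one,
        one_pow])))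

theorem ThreeAdm.core (h : ThreeAdm F l₁ l₂ α α' β) (hx : ActsThree x e α α' β) (hxΓ : x ∈ Γ)
    (hsc : HasScalars Γ) : Core Γ (three3 e) (three1 e).W := by
  have : Module.Finite F A := Module.Finite.of_finite
  have : Module.Finite F B := Module.Finite.of_finite
  have : Module.Finite F K := Module.Finite.of_finite
  obtain ⟨c, hc, η, hα, hη⟩ := h.ord₁
  refine ⟨thick_of_pow_mem (B_pow_mem hxΓ hx.thd h.gen h.coprime (h.fix_U hx)) ?_,
    cyc_of_pow hxΓ hsc hx.thd h.gen h.coprime.coprime_mul_right (pow_ne_zero _ hc)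
      fun v hv => smul_of_pow hx.fst hα (hη ▸ pow_orderOf_eq_one η) hv, h.rich3 hx hxΓ⟩
  rw [finrank_eq_add_add e]
  have := h.gap
  omega

theorem ThreeAdm.invariant (h : ThreeAdm F l₁ l₂ α α' β) (hx : ActsThree x e α α' β)
    {N : Submodule F V} (hN : N.map x.toLinearMap = N) :
    N = ⊥ ∨ N = ⊤ ∨ Module.finrank F N = Module.finrank F A ∨
      Module.finrank F N = Module.finrank F B ∨ Module.finrank F N = Module.finrank F K ∨
      Module.finrank F N + Module.finrank F A = Module.finrank F V ∨
      Module.finrank F N + Module.finrank F B = Module.finrank F V ∨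
      Module.finrank F N + Module.finrank F K = Module.finrank F V := by
  have : Module.Finite F V := Module.Finite.of_finite
  have hxΓ := Subgroup.mem_zpowers x
  exact (triple_three e).finrank_eq
    ((h.rich1 hx hxΓ).dichotomy fun t ht => map_pow_eq hN _ ht)
    ((h.rich2 hx hxΓ).dichotomy fun t ht => map_pow_eq hN _ ht)
    ((h.rich3 hx hxΓ).dichotomy fun t ht => map_pow_eq hN _ ht)

/-- The rank of a system is determined by any three-block element of the group. -/
theorem ThreeAdm.system_rank (h : ThreeAdm F l₁ l₂ α α' β) (hx : ActsThree x e α α' β)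
    (hxΓ : x ∈ Γ) {S : Submodule F V → Submodule F V} {σ f : ℕ} (hS : IsSystem Γ S σ f)
    (hσ : σ < Module.finrank F K) (hf : f + 1 ≤ Module.finrank F A) :
    σ = Module.finrank F A + Module.finrank F B := by
  have : Module.Finite F A := Module.Finite.of_finite
  have : Module.Finite F B := Module.Finite.of_finite
  have : Module.Finite F K := Module.Finite.of_finite
  have hxz := Subgroup.mem_zpowers x
  have hlt := h.lt
  exact hS.rank_eq (triple_three e) (h.rich3 hx hxΓ) (h.rich1 hx hxΓ) (h.rich2 hx hxΓ) hxΓ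
    (map_W_of_mul hx.fst) (map_W_of_mul hx.snd)
    (fun N hN => (h.rich1 hx hxz).dichotomy fun t ht => map_pow_eq hN _ ht)
    (fun N hN => (h.rich2 hx hxz).dichotomy fun t ht => map_pow_eq hN _ ht)
    hσ hf (by omega) (by rw [finrank_eq_add_add e]; exact h.cop)

end finiteV

theorem ThreeAdm.transvections [Finite V] [Finite A] [Finite B]
    {K₂ A₂ B₂ : Type*} [Field K₂] [Algebra F K₂] [Field A₂] [Algebra F A₂] [Field B₂] [Algebra F B₂]
    [Finite K₂] [Finite A₂] [Finite B₂]
    {y : V ≃ₗ[F] V} {e₂ : V ≃ₗ[F] A₂ × B₂ × K₂} {α₂ : A₂ˣ} {α₂' : B₂ˣ} {β₂ : K₂ˣ} {l₃ l₄ : ℕ}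
    (h : ThreeAdm F l₁ l₂ α α' β) (hx : ActsThree x e α α' β) (hxΓ : x ∈ Γ)
    (h₂ : ThreeAdm F l₃ l₄ α₂ α₂' β₂) (hy : ActsThree y e₂ α₂ α₂' β₂) (hyΓ : y ∈ Γ)
    (hA : Module.finrank F A ≤ Module.finrank F A₂)
    (hz : Module.finrank F A + Module.finrank F B ≠ Module.finrank F A₂ + Module.finrank F B₂)
    (hz' : Module.finrank F A + Module.finrank F B < Module.finrank F K₂)
    (hsc : HasScalars Γ) (hirr : IrredOn Γ) (u : V) (l : V →ₗ[F] F) (hlu : l u = 0) :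
    ∃ γ ∈ Γ, ∀ v, γ v = v + l v • u := by
  have : Module.Finite F V := Module.Finite.of_finite
  have : Module.Finite F A := Module.Finite.of_finite
  have : Module.Finite F B := Module.Finite.of_finite
  have : Module.Finite F K := Module.Finite.of_finite
  have hq : 2 ≤ Nat.card F := Finite.one_lt_card
  have h5 := h.dim
  have h9 := h.gap
  have hU := (triple_three e).finrank_U
  refine transvections_of_triple (h.core hx hxΓ hsc) (h.rich1 hx hxΓ) (h.rich2 hx hxΓ)
    (triple_three e) hirr ?_ (fun f hf => ?_) h5 u l hlu
  · rw [natCard_field_eq_pow (F := F) (K := K)]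
    calc 2 * Nat.card F ^ 2 ≤ Nat.card F * Nat.card F ^ 2 := Nat.mul_le_mul_right _ hq
      _ = Nat.card F ^ 3 := by ring
      _ < Nat.card F ^ Module.finrank F K := Nat.pow_lt_pow_right (by omega) (by omega)
  · intro S σ hσ hσu ha hb hc
    have hS : IsSystem Γ S σ f :=
      ⟨hσ, fun X hX => (ha X hX).1, fun X hX => (ha X hX).2, hb, hc⟩
    have e1 := h.system_rank hx hxΓ hS (by omega) (by omega)
    have e2 := h₂.system_rank hy hyΓ hS (by omega) (by omega)
    exact hz (e1.symm.trans e2)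

end FieldSplit

theorem exists_coprime_add_mul {j A R : ℕ} (hR : R ≠ 0)
    (h : ∀ p : ℕ, p.Prime → p ∣ j → p ∣ A → ¬ p ∣ R) : ∃ r, Nat.Coprime (j + A * r) R := by
  classical
  refine ⟨∏ p ∈ R.primeFactors.filter (fun p => ¬ p ∣ j), p, ?_⟩
  refine Nat.coprime_of_dvd fun p hp hpj hpR => ?_
  by_cases hj : p ∣ j
  · rcases hp.dvd_mul.1 ((Nat.dvd_add_right hj).1 hpj) with hA | hr
    · exact h p hp hj hA hpR
    · obtain ⟨r, hr, hpr⟩ := (Nat.Prime.prime hp).exists_mem_finset_dvd hr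
      obtain ⟨hr, hrj⟩ := Finset.mem_filter.1 hr
      rw [(Nat.prime_dvd_prime_iff_eq hp (Nat.prime_of_mem_primeFactors hr)).1 hpr] at hj
      exact hrj hj
  · refine hj ((Nat.dvd_add_left ?_).1 hpj)
    exact Dvd.dvd.mul_left (Finset.dvd_prod_of_mem _
      (Finset.mem_filter.2 ⟨Nat.mem_primeFactors.2 ⟨hp, hpR, hR⟩, hj⟩)) _

theorem repunit_modEq {q : ℕ} (hq : 2 ≤ q) (m : ℕ) {p : ℕ} (hp : p ∣ q - 1) :
    p ∣ repunit q m ↔ p ∣ m := by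
  have h : repunit q m ≡ m [MOD p] := by
    have hq1 : q ≡ 1 [MOD p] := ((Nat.modEq_iff_dvd' (by lia)).2 hp).symm
    unfold repunit
    calc (∑ i ∈ Finset.range m, q ^ i) ≡ ∑ i ∈ Finset.range m, 1 [MOD p] := by
          refine Nat.ModEq.sum fun i _ => ?_
          simpa using hq1.pow i
      _ = m := by simp
  exact h.dvd_iff dvd_rfl

namespace FieldSplit

variable {F K A B V : Type*} [Field F] [Field K] [Algebra F K] [Field A] [Algebra F A]
  [Field B] [Algebra F B] [AddCommGroup V] [Module F V]

theorem projGen_of_pow [Finite F] [Finite K] {g : Kˣ} (hg : ∀ t : Kˣ, t ∈ Submonoid.powers g)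
    {j : ℕ} (hj : j.Coprime (repunit (Nat.card F) (Module.finrank F K))) :
    ProjGen F (g ^ j) := by
  have hq : 2 ≤ Nat.card F := Finite.one_lt_card
  intro t
  obtain ⟨s, rfl⟩ := hg t
  obtain ⟨i, hi⟩ := exists_mul_modEq hj (repunit_pos (by lia) Module.finrank_pos) s
  have key : (g ^ s * (g ^ (j * i))⁻¹) ^ (Nat.card F - 1) = 1 := by
    rw [mul_pow, inv_pow, mul_inv_eq_one, ← pow_mul, ← pow_mul]
    refine pow_eq_pow_iff_modEq.2 ?_
    have h1 : s * (Nat.card F - 1) ≡ j * i * (Nat.card F - 1)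
        [MOD repunit (Nat.card F) (Module.finrank F K) * (Nat.card F - 1)] :=
      hi.symm.mul_right' _
    rw [repunit_mul hq] at h1
    exact h1.of_dvd (orderOf_dvd_of_pow_eq_one (pow_card_sub_one_eq_one g))
  obtain ⟨d, hd, h⟩ := mem_base_of_pow_eq key
  refine ⟨i, d, hd, ?_⟩
  rw [← h]
  simp [pow_mul]

theorem norm_unit_pow [Finite F] [Finite K] (t : K) :
    algebraMap F K (Algebra.norm F t) = t ^ repunit (Nat.card F) (Module.finrank F K) := by
  have hq : 2 ≤ Nat.card F := Finite.one_lt_card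
  rw [FiniteField.algebraMap_norm_eq_pow, natCard_field_eq_pow (F := F) (K := K), ← repunit_mul hq,
    Nat.mul_div_cancel _ (by lia)]

theorem norm_eq_one_of_pow [Finite F] [Finite K] {t : Kˣ}
    (h : t ^ repunit (Nat.card F) (Module.finrank F K) = 1) : Algebra.norm F (t : K) = 1 := by
  refine (algebraMap F K).injective ?_
  rw [norm_unit_pow, ← Units.val_pow_eq_pow_val, h]; simp

theorem exists_orderOf [Finite F] [Finite K] {l : ℕ}
    (hl : l ∣ Nat.card F ^ Module.finrank F K - 1) :
    ∃ η : Kˣ, orderOf η = l := by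
  obtain ⟨g, hg⟩ := IsCyclic.exists_ofOrder_eq_natCard (α := Kˣ)
  rw [Nat.card_units, natCard_field_eq_pow (F := F) (K := K)] at hg
  obtain ⟨r, hr⟩ := hl
  have h0 : 0 < Nat.card F ^ Module.finrank F K - 1 := by
    have := Nat.one_lt_pow (Module.finrank_pos (R := F) (M := K)).ne' (Finite.one_lt_card (α := F))
    lia
  refine ⟨g ^ r, ?_⟩
  have hr0 : r ≠ 0 := by rintro rfl; simp at hr; lia
  rw [orderOf_pow_of_dvd hr0 (by rw [hg, hr]; exact dvd_mul_left _ _), hg, hr,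
    Nat.mul_div_cancel _ (Nat.pos_of_ne_zero hr0)]

/-- Prescribing the norm of a projective generator up to `k`-th powers. -/
theorem exists_projGen_norm [Finite F] [Finite K] {k : ℕ} (hk : k.Coprime (Module.finrank F K))
    (δ : Fˣ) : ∃ c : Fˣ, ∃ β : Kˣ, ProjGen F β ∧ (c : F) ^ k * Algebra.norm F (β : K) = δ := by
  have hq : 2 ≤ Nat.card F := Finite.one_lt_card
  have hm : 0 < Module.finrank F K := Module.finrank_pos
  obtain ⟨g, hg⟩ := IsCyclic.exists_monoid_generator (α := Kˣ)
  set N := Units.map (Algebra.norm F (S := K)) with hN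
  have hω : ∀ d : Fˣ, ∃ e : ℕ, d = N g ^ e := fun d => by
    obtain ⟨t, ht⟩ := FiniteField.unitsMap_norm_surjective F K d
    obtain ⟨s, rfl⟩ := hg t
    exact ⟨s, by rw [← map_pow]; exact ht.symm⟩
  obtain ⟨e, rfl⟩ := hω δ
  obtain ⟨t, ht⟩ := exists_mul_modEq hk hm (1 + (Module.finrank F K - 1) * e)
  have h1 : e + k * t ≡ 1 [MOD Module.finrank F K] := by
    have := ht.add_left e
    refine this.trans ?_
    have h2 : e + (1 + (Module.finrank F K - 1) * e) = 1 + Module.finrank F K * e := by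
      obtain ⟨m', hm'⟩ := Nat.exists_eq_add_of_lt hm
      rw [hm']; simp; ring
    rw [h2]
    simp [Nat.ModEq]
  obtain ⟨r, hr⟩ := exists_coprime_add_mul (j := e + k * t) (A := Nat.card F - 1)
    (R := repunit (Nat.card F) (Module.finrank F K)) (repunit_pos (by lia) hm).ne' (by
      intro p hp hpj hpA hpR
      rw [repunit_modEq hq _ hpA] at hpR
      have := (h1.of_dvd hpR).dvd_iff dvd_rfl
      exact hp.one_lt.ne' (Nat.dvd_one.1 (this.1 hpj)))
  refine ⟨(N g ^ t)⁻¹, g ^ (e + k * t + (Nat.card F - 1) * r), projGen_of_pow hg hr, ?_⟩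
  have hc : N g ^ (Nat.card F - 1) = 1 := by
    rw [← Nat.card_units]; exact pow_card_eq_one'
  have : (N g ^ t)⁻¹ ^ k * N (g ^ (e + k * t + (Nat.card F - 1) * r)) = N g ^ e := by
    rw [map_pow, pow_add, pow_mul _ (Nat.card F - 1), hc, one_pow, mul_one, pow_add, inv_pow,
      ← pow_mul, mul_comm t k]
    group
  have h3 := congrArg (Units.val) this
  simpa [hN] using h3


/-- Multiplication by a unit. -/
def mulEquiv (F : Type*) {A : Type*} [Field F] [Field A] [Algebra F A] (α : Aˣ) : A ≃ₗ[F] A :=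
  DistribMulAction.toLinearEquiv F A α

theorem det_mulEquiv (α : Aˣ) :
    LinearMap.det (mulEquiv F α).toLinearMap = Algebra.norm F (α : A) := by
  rw [Algebra.norm_apply]
  rfl

/-- The element of `GL V` with two prescribed blocks. -/
def twoElt (e : V ≃ₗ[F] A × K) (α : Aˣ) (β : Kˣ) : V ≃ₗ[F] V :=
  (e.trans ((mulEquiv F α).prodCongr (mulEquiv F β))).trans e.symm

theorem actsTwo_twoElt (e : V ≃ₗ[F] A × K) (α : Aˣ) (β : Kˣ) :
    ActsTwo (twoElt e α β) e α β := fun v => by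
  simp only [twoElt, LinearEquiv.trans_apply, LinearEquiv.apply_symm_apply]
  rfl

theorem det_twoElt [Module.Finite F A] [Module.Finite F K] (e : V ≃ₗ[F] A × K) (α : Aˣ) (β : Kˣ) :
    LinearMap.det (twoElt e α β).toLinearMap =
      Algebra.norm F (α : A) * Algebra.norm F (β : K) := by
  have : (twoElt e α β).toLinearMap = (e.symm : A × K →ₗ[F] V) ∘ₗ
      ((mulEquiv F α).toLinearMap.prodMap (mulEquiv F β).toLinearMap) ∘ₗ
      (e.symm.symm : V →ₗ[F] A × K) := by
    ext v; rfl
  rw [this, LinearMap.det_conj, LinearMap.det_prodMap, det_mulEquiv, det_mulEquiv]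

theorem norm_algebraMap_mul [Module.Finite F A] (c : F) (η : A) (h : Algebra.norm F η = 1) :
    Algebra.norm F (algebraMap F A c * η) = c ^ Module.finrank F A := by
  rw [map_mul, h, mul_one, Algebra.norm_algebraMap]

/-- The element of `GL V` with three prescribed blocks. -/
def threeElt (e : V ≃ₗ[F] A × B × K) (α : Aˣ) (α' : Bˣ) (β : Kˣ) : V ≃ₗ[F] V :=
  (e.trans ((mulEquiv F α).prodCongr ((mulEquiv F α').prodCongr (mulEquiv F β)))).trans e.symm

theorem actsThree_threeElt (e : V ≃ₗ[F] A × B × K) (α : Aˣ) (α' : Bˣ) (β : Kˣ) :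
    ActsThree (threeElt e α α' β) e α α' β := fun v => by
  simp only [threeElt, LinearEquiv.trans_apply, LinearEquiv.apply_symm_apply]
  rfl

theorem det_threeElt [Module.Finite F A] [Module.Finite F B] [Module.Finite F K]
    (e : V ≃ₗ[F] A × B × K) (α : Aˣ) (α' : Bˣ) (β : Kˣ) :
    LinearMap.det (threeElt e α α' β).toLinearMap =
      Algebra.norm F (α : A) * (Algebra.norm F (α' : B) * Algebra.norm F (β : K)) := by
  have : (threeElt e α α' β).toLinearMap = (e.symm : A × B × K →ₗ[F] V) ∘ₗ
      ((mulEquiv F α).toLinearMap.prodMap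
        ((mulEquiv F α').toLinearMap.prodMap (mulEquiv F β).toLinearMap)) ∘ₗ
      (e.symm.symm : V →ₗ[F] A × B × K) := by
    ext v; rfl
  rw [this, LinearMap.det_conj, LinearMap.det_prodMap, LinearMap.det_prodMap, det_mulEquiv,
    det_mulEquiv, det_mulEquiv]

/-- `x` is an admissible element with two blocks, the smaller one of dimension `k`. -/
def IsTwo (k : ℕ) (x : V ≃ₗ[F] V) : Prop :=
  ∃ (A K : Type) (_ : Field A) (_ : Field K) (_ : Algebra F A) (_ : Algebra F K) (_ : Finite A)
    (_ : Finite K) (e : V ≃ₗ[F] A × K) (α : Aˣ) (β : Kˣ),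
    TwoAdm F α β ∧ ActsTwo x e α β ∧ Module.finrank F A = k

/-- `x` is an admissible element with three blocks, the first two of dimensions `a` and `b`. -/
def IsThree (a b : ℕ) (x : V ≃ₗ[F] V) : Prop :=
  ∃ (A B K : Type) (_ : Field A) (_ : Field B) (_ : Field K) (_ : Algebra F A) (_ : Algebra F B)
    (_ : Algebra F K) (_ : Finite A) (_ : Finite B) (_ : Finite K) (e : V ≃ₗ[F] A × B × K)
    (l₁ l₂ : ℕ) (α : Aˣ) (α' : Bˣ) (β : Kˣ),
    ThreeAdm F l₁ l₂ α α' β ∧ ActsThree x e α α' β ∧ Module.finrank F A = a ∧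
      Module.finrank F B = b

theorem exists_extension (F : Type*) [Field F] [Finite F] {k : ℕ} (hk : 0 < k) :
    ∃ (A : Type) (_ : Field A) (_ : Algebra F A), Finite A ∧ Module.finrank F A = k := by
  obtain ⟨p, hp⟩ := CharP.exists F
  have : Fact p.Prime := ⟨CharP.char_is_prime F p⟩
  have : NeZero k := ⟨hk.ne'⟩
  exact ⟨FiniteField.Extension F p k, inferInstance, inferInstance, inferInstance,
    FiniteField.finrank_extension F p k⟩

theorem exists_isTwo [Finite F] [Finite V] {k : ℕ} (hk : 5 ≤ k)
    (hc : k.Coprime (Module.finrank F V)) (hkn : 2 * k + 9 ≤ Module.finrank F V) (δ : Fˣ) :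
    ∃ x : V ≃ₗ[F] V, IsTwo k x ∧ LinearMap.det x.toLinearMap = δ := by
  have hq : 2 ≤ Nat.card F := Finite.one_lt_card
  obtain ⟨m, hm⟩ := Nat.exists_eq_add_of_le (show k ≤ Module.finrank F V by lia)
  obtain ⟨A, _, _, _, hA⟩ := exists_extension F (k := k) (by lia)
  obtain ⟨K, _, _, _, hK⟩ := exists_extension F (k := m) (by lia)
  have : Module.Finite F A := .of_finite
  have : Module.Finite F K := .of_finite
  have : Module.Finite F V := .of_finite
  have hkm : k.Coprime m := by rw [hm] at hc; simpa using hc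
  let e : V ≃ₗ[F] A × K := LinearEquiv.ofFinrankEq _ _ (by rw [Module.finrank_prod, hA, hK, hm])
  obtain ⟨c, β, hβ, hδ⟩ := exists_projGen_norm (F := F) (K := K) (k := k) (by rwa [hK]) δ
  obtain ⟨η, hη⟩ := exists_orderOf (F := F) (K := A) (l := repunit (Nat.card F) k)
    (by rw [hA, ← repunit_mul hq]; exact dvd_mul_right _ _)
  have hη1 : Algebra.norm F (η : A) = 1 :=
    norm_eq_one_of_pow (by rw [hA, ← hη]; exact pow_orderOf_eq_one η)
  let α : Aˣ := Units.map (algebraMap F A).toMonoidHom c * η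
  have hα : (α : A) = algebraMap F A c * η := rfl
  refine ⟨twoElt e α β, ⟨A, K, _, _, _, _, inferInstance, inferInstance, e, α, β,
    ⟨hβ, by rwa [hA, hK], by lia, by lia, c, c.ne_zero, η, hα, by rw [hA, hη]⟩,
    actsTwo_twoElt e α β, hA⟩, ?_⟩
  rw [det_twoElt, hα, norm_algebraMap_mul _ _ hη1, hA, hδ]

theorem exists_isThree [Finite F] [Finite V] {a b m l₁ l₂ : ℕ} (ha : 5 ≤ a) (hab : a < b)
    (hm : a + b + 9 ≤ m) (hn : a + (b + m) = Module.finrank F V)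
    (hc : (Nat.gcd a b).Coprime (Module.finrank F V)) (ham : ¬ a ∣ m) (hbm : ¬ b ∣ m)
    (hl₁ : l₁.Prime) (hl₂ : l₂.Prime) (hd₁ : ∀ d, l₁ ∣ Nat.card F ^ d - 1 ↔ a ∣ d)
    (hd₂ : ∀ d, l₂ ∣ Nat.card F ^ d - 1 ↔ b ∣ d) (δ : Fˣ) :
    ∃ x : V ≃ₗ[F] V, IsThree a b x ∧ LinearMap.det x.toLinearMap = δ := by
  have hq : 2 ≤ Nat.card F := Finite.one_lt_card
  obtain ⟨A, _, _, _, hA⟩ := exists_extension F (k := a) (by lia)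
  obtain ⟨B, _, _, _, hB⟩ := exists_extension F (k := b) (by lia)
  obtain ⟨K, _, _, _, hK⟩ := exists_extension F (k := m) (by lia)
  have : Module.Finite F A := .of_finite
  have : Module.Finite F B := .of_finite
  have : Module.Finite F K := .of_finite
  have : Module.Finite F V := .of_finite
  have hgm : (Nat.gcd a b).Coprime m := by
    rw [← hn] at hc
    have h1 : Nat.gcd a b ∣ a + b := dvd_add (Nat.gcd_dvd_left _ _) (Nat.gcd_dvd_right _ _)
    rw [← add_assoc] at hc
    obtain ⟨r, hr⟩ := h1
    rw [hr, Nat.coprime_mul_left_add_right] at hc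
    exact hc
  let e : V ≃ₗ[F] A × B × K := LinearEquiv.ofFinrankEq _ _
    (by rw [Module.finrank_prod, Module.finrank_prod, hA, hB, hK, hn])
  obtain ⟨c, β, hβ, hδ⟩ := exists_projGen_norm (F := F) (K := K) (k := Nat.gcd a b) (by rwa [hK]) δ
  have key : ∀ {E : Type} [Field E] [Algebra F E] [Finite E] {l : ℕ}, l.Prime →
      1 < Module.finrank F E →
      (∀ d, l ∣ Nat.card F ^ d - 1 ↔ Module.finrank F E ∣ d) →
      ∃ η : Eˣ, orderOf η = l ∧ Algebra.norm F (η : E) = 1 := by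
    intro E _ _ _ l hl h1 hd
    obtain ⟨η, hη⟩ := exists_orderOf (F := F) (K := E) ((hd _).2 dvd_rfl)
    refine ⟨η, hη, norm_eq_one_of_pow (orderOf_dvd_iff_pow_eq_one.1 ?_)⟩
    rw [hη]
    have h2 := (hd _).2 dvd_rfl
    rw [← repunit_mul hq] at h2
    refine (hl.dvd_mul.1 h2).resolve_right fun h3 => ?_
    have := (hd 1).1 (by simpa using h3)
    have := Nat.le_of_dvd one_pos this
    lia
  obtain ⟨η, hη, hη1⟩ := key (E := A) hl₁ (by lia) (by rwa [hA])
  obtain ⟨η', hη', hη1'⟩ := key (E := B) hl₂ (by lia) (by rwa [hB])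
  let α : Aˣ := Units.map (algebraMap F A).toMonoidHom (c ^ Nat.gcdA a b) * η
  let α' : Bˣ := Units.map (algebraMap F B).toMonoidHom (c ^ Nat.gcdB a b) * η'
  have hα : (α : A) = algebraMap F A (c ^ Nat.gcdA a b : Fˣ) * η := rfl
  have hα' : (α' : B) = algebraMap F B (c ^ Nat.gcdB a b : Fˣ) * η' := rfl
  refine ⟨threeElt e α α' β, ⟨A, B, K, _, _, _, _, _, _, inferInstance, inferInstance,
    inferInstance, e, l₁, l₂, α, α', β,
    ⟨hβ, hl₁, hl₂, ⟨_, Units.ne_zero _, η, hα, hη⟩, ⟨_, Units.ne_zero _, η', hα', hη'⟩,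
      by rwa [hA], by rwa [hB], by rwa [hA, hK], by rwa [hB, hK], by lia, by lia, by lia,
      by rwa [hA, hB, hK, hn]⟩,
    actsThree_threeElt e α α' β, hA, hB⟩, ?_⟩
  rw [det_threeElt, hα, hα', norm_algebraMap_mul _ _ hη1, norm_algebraMap_mul _ _ hη1', hA, hB,
    ← hδ, ← mul_assoc]
  congr 1
  rw [← Units.val_pow_eq_pow_val, ← Units.val_pow_eq_pow_val, ← Units.val_pow_eq_pow_val,
    ← Units.val_mul, ← zpow_natCast, ← zpow_natCast, ← zpow_natCast, ← zpow_mul, ← zpow_mul,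
    ← zpow_add, Nat.gcd_eq_gcd_ab]
  congr 2; ring

end FieldSplit

namespace FieldSplit

variable {F V : Type*} [Field F] [AddCommGroup V] [Module F V]

/-- The two shapes of elements used: two blocks or three blocks. -/
def IsKind : ℕ ⊕ ℕ × ℕ → (V ≃ₗ[F] V) → Prop
  | Sum.inl k, x => IsTwo k x
  | Sum.inr (a, b), x => IsThree a b x

/-- The dimensions of the proper nonzero invariant subspaces of an element of given shape. -/
def kindDims (n : ℕ) : ℕ ⊕ ℕ × ℕ → Finset ℕ
  | Sum.inl k => {k, n - k}
  | Sum.inr (a, b) => {a, b, a + b, n - a, n - b, n - (a + b)}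

theorem IsKind.conj {κ : ℕ ⊕ ℕ × ℕ} {x : V ≃ₗ[F] V} (hx : IsKind κ x) (h : V ≃ₗ[F] V) :
    IsKind κ (h * x * h⁻¹) := by
  rcases κ with k | ⟨a, b⟩
  · obtain ⟨A, K, _, _, _, _, _, _, e, α, β, h1, h2, h3⟩ := hx
    refine ⟨A, K, _, _, _, _, inferInstance, inferInstance, h.symm.trans e, α, β, h1, fun v => ?_,
      h3⟩
    have := h2 (h.symm v)
    simp only [LinearEquiv.trans_apply]
    rw [← this]
    congr 1
    change h.symm (h (x (h.symm v))) = _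
    simp
  · obtain ⟨A, B, K, _, _, _, _, _, _, _, _, _, e, l₁, l₂, α, α', β, h1, h2, h3⟩ := hx
    refine ⟨A, B, K, _, _, _, _, _, _, inferInstance, inferInstance, inferInstance,
      h.symm.trans e, l₁, l₂, α, α', β, h1, fun v => ?_, h3⟩
    have := h2 (h.symm v)
    simp only [LinearEquiv.trans_apply]
    rw [← this]
    congr 1
    change h.symm (h (x (h.symm v))) = _
    simp

theorem IsKind.invariant [Finite F] [Finite V] {κ : ℕ ⊕ ℕ × ℕ} {x : V ≃ₗ[F] V} (hx : IsKind κ x)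
    {N : Submodule F V} (hN : N.map x.toLinearMap = N) :
    N = ⊥ ∨ N = ⊤ ∨ Module.finrank F N ∈ kindDims (Module.finrank F V) κ := by
  have : Module.Finite F V := .of_finite
  rcases κ with k | ⟨a, b⟩
  · obtain ⟨A, K, _, _, _, _, _, _, e, α, β, h1, h2, h3⟩ := hx
    have := h1.invariant h2 hN
    simp only [kindDims, Finset.mem_insert, Finset.mem_singleton]
    rcases this with h | h | h | h
    · exact Or.inl h
    · exact Or.inr (Or.inl h)
    · lia
    · lia
  · obtain ⟨A, B, K, _, _, _, _, _, _, _, _, _, e, l₁, l₂, α, α', β, h1, h2, h3, h4⟩ := hx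
    have : Module.Finite F A := .of_finite
    have : Module.Finite F B := .of_finite
    have : Module.Finite F K := .of_finite
    have := h1.invariant h2 hN
    have hV := finrank_eq_add_add e
    simp only [kindDims, Finset.mem_insert, Finset.mem_singleton]
    rcases this with h | h | h | h | h | h | h | h
    · exact Or.inl h
    · exact Or.inr (Or.inl h)
    all_goals lia

theorem IsKind.exists_invariant [Finite F] [Finite V] {κ : ℕ ⊕ ℕ × ℕ} {x : V ≃ₗ[F] V}
    (hx : IsKind κ x) : ∃ N : Submodule F V, N.map x.toLinearMap = N ∧ N ≠ ⊥ ∧ N ≠ ⊤ ∧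
      Module.finrank F N ∈ kindDims (Module.finrank F V) κ := by
  have : Module.Finite F V := .of_finite
  suffices ∃ N : Submodule F V, N.map x.toLinearMap = N ∧ 0 < Module.finrank F N ∧
      Module.finrank F N < Module.finrank F V by
    obtain ⟨N, h1, h2, h3⟩ := this
    have hb : N ≠ ⊥ := by rintro rfl; simp at h2
    have ht : N ≠ ⊤ := by rintro rfl; simp at h3
    exact ⟨N, h1, hb, ht, ((hx.invariant h1).resolve_left hb).resolve_left ht⟩
  rcases κ with k | ⟨a, b⟩
  · obtain ⟨A, K, _, _, _, _, _, _, e, α, β, h1, h2, h3⟩ := hx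
    have : Module.Finite F A := .of_finite
    have : Module.Finite F K := .of_finite
    have hd := h1.dim
    have hg := h1.gap
    have hV := finrank_eq_add e
    refine ⟨(two1 e).W, map_W_of_mul h2.fst, ?_⟩
    rw [(two1 e).finrank_W]
    lia
  · obtain ⟨A, B, K, _, _, _, _, _, _, _, _, _, e, l₁, l₂, α, α', β, h1, h2, h3, h4⟩ := hx
    have : Module.Finite F A := .of_finite
    have : Module.Finite F B := .of_finite
    have : Module.Finite F K := .of_finite
    have hd := h1.dim
    have hg := h1.gap
    have hV := finrank_eq_add_add e
    refine ⟨(three1 e).W, map_W_of_mul h2.fst, ?_⟩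
    rw [(three1 e).finrank_W]
    lia

variable {Γ : Subgroup (V ≃ₗ[F] V)}

theorem transvections_of_pair [Finite F] [Finite V] {κ κ' : ℕ ⊕ ℕ × ℕ} {x y : V ≃ₗ[F] V}
    (hx : IsKind κ x) (hy : IsKind κ' y)
    (hd : Disjoint (kindDims (Module.finrank F V) κ) (kindDims (Module.finrank F V) κ'))
    (hxΓ : x ∈ Γ) (hyΓ : y ∈ Γ) (hsc : HasScalars Γ) (u : V) (l : V →ₗ[F] F) (hlu : l u = 0) :
    ∃ γ ∈ Γ, ∀ v, γ v = v + l v • u := by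
  have : Module.Finite F V := .of_finite
  have hirr : IrredOn Γ := by
    intro Q hQ
    by_contra! h
    have h1 := ((hx.invariant (hQ x hxΓ)).resolve_left h.1).resolve_left h.2
    have h2 := ((hy.invariant (hQ y hyΓ)).resolve_left h.1).resolve_left h.2
    exact Finset.disjoint_left.1 hd h1 h2
  rcases κ with k | ⟨a, b⟩
  · obtain ⟨A, K, _, _, _, _, _, _, e, α, β, h1, h2, h3⟩ := hx
    exact h1.transvections h2 hxΓ hsc hirr u l hlu
  rcases κ' with k | ⟨a', b'⟩
  · obtain ⟨A, K, _, _, _, _, _, _, e, α, β, h1, h2, h3⟩ := hy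
    exact h1.transvections h2 hyΓ hsc hirr u l hlu
  have hne : a + b ≠ a' + b' := by
    intro h
    have h1 : a + b ∈ kindDims (Module.finrank F V) (Sum.inr (a, b)) := by simp [kindDims]
    exact Finset.disjoint_left.1 hd h1 (by simp [kindDims, h])
  obtain ⟨A, B, K, _, _, _, _, _, _, _, _, _, e, l₁, l₂, α, α', β, h1, h2, h3, h4⟩ := hx
  obtain ⟨A₂, B₂, K₂, _, _, _, _, _, _, _, _, _, e', l₃, l₄, α₂, α₂', β₂, g1, g2, g3, g4⟩ := hy
  have : Module.Finite F A := .of_finite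
  have : Module.Finite F B := .of_finite
  have : Module.Finite F K := .of_finite
  have : Module.Finite F A₂ := .of_finite
  have : Module.Finite F B₂ := .of_finite
  have : Module.Finite F K₂ := .of_finite
  have hV := finrank_eq_add_add e
  have hV' := finrank_eq_add_add e'
  have hg := h1.gap
  have hg' := g1.gap
  rcases le_total (Module.finrank F A) (Module.finrank F A₂) with h | h
  · exact h1.transvections h2 hxΓ g1 g2 hyΓ h (by lia) (by lia) hsc hirr u l hlu
  · exact g1.transvections g2 hyΓ h1 h2 hxΓ h (by lia) (by lia) hsc hirr u l hlu

end FieldSplit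

open Matrix in
theorem Matrix.transvection_mulVec_eq_update {ι R : Type*} [Fintype ι] [DecidableEq ι] [CommRing R]
    (i j : ι) (c : R) (v : ι → R) :
    Matrix.transvection i j c *ᵥ v = Function.update v i (v i + c * v j) := by
  rw [Matrix.transvection, Matrix.add_mulVec, Matrix.one_mulVec, Matrix.single_mulVec_eq]
  ext k
  by_cases hk : k = i
  · subst hk; simp
  · simp [hk]

namespace GLGen

open Matrix

theorem matrix_ext {ι F : Type*} [Fintype ι] [Field F] {M N : Matrix ι ι F}
    (h : ∀ v : ι → F, M *ᵥ v = N *ᵥ v) : M = N :=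
  Matrix.mulVec_injective (funext h)

variable {ι F : Type*} [Fintype ι] [DecidableEq ι] [Field F]

variable {H : Subgroup (GL ι F)}

/-- The group contains all elementary transvections. -/
def HasTransvections (H : Subgroup (GL ι F)) : Prop :=
  ∀ i j : ι, i ≠ j → ∀ c : F, ∃ γ ∈ H, (γ : Matrix ι ι F) = Matrix.transvection i j c

theorem HasTransvections.diag_two (hH : HasTransvections H) {i j : ι} (hij : i ≠ j) {a : F}
    (ha : a ≠ 0) : ∃ γ ∈ H, (γ : Matrix ι ι F) =
      diagonal (Function.update (Function.update (fun _ => 1) i a) j a⁻¹) := by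
  obtain ⟨g1, h1, e1⟩ := hH i j hij a
  obtain ⟨g2, h2, e2⟩ := hH j i hij.symm (-a⁻¹)
  obtain ⟨g3, h3, e3⟩ := hH i j hij (-1)
  obtain ⟨g4, h4, e4⟩ := hH j i hij.symm 1
  refine ⟨g1 * (g2 * (g1 * (g3 * (g4 * g3)))), H.mul_mem h1 (H.mul_mem h2 (H.mul_mem h1
    (H.mul_mem h3 (H.mul_mem h4 h3)))), matrix_ext fun v => ?_⟩
  simp only [Matrix.GeneralLinearGroup.coe_mul, e1, e2, e3, e4, ← Matrix.mulVec_mulVec,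
    transvection_mulVec_eq_update]
  ext k
  rw [Matrix.mulVec_diagonal]
  by_cases hk : k = i
  · subst hk
    simp [hij, hij.symm]
    field_simp
    ring
  · by_cases hk' : k = j
    · subst hk'
      simp [hij, hij.symm]
      field_simp
      ring
    · simp [hk, hk']

theorem HasTransvections.diag (hH : HasTransvections H) (i : ι) {D : ι → F} (hD : ∀ k, D k ≠ 0)
    (s : Finset ι) (hs : i ∉ s) : ∃ γ ∈ H, (γ : Matrix ι ι F) =
      diagonal (fun k => if k ∈ s then D k else if k = i then (∏ k ∈ s, D k)⁻¹ else 1) := by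
  induction s using Finset.induction_on with
  | empty => exact ⟨1, H.one_mem, by ext k l; by_cases h : k = l <;> simp [h]⟩
  | insert j s hj ih =>
    simp only [Finset.mem_insert, not_or] at hs
    obtain ⟨γ, hγ, e⟩ := ih hs.2
    obtain ⟨γ', hγ', e'⟩ := hH.diag_two (i := j) (j := i) (Ne.symm hs.1) (hD j)
    refine ⟨γ * γ', H.mul_mem hγ hγ', ?_⟩
    rw [Matrix.GeneralLinearGroup.coe_mul, e, e', Matrix.diagonal_mul_diagonal]
    congr 1
    ext k
    rw [Finset.prod_insert hj]
    by_cases hk : k = i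
    · subst hk
      simp [hs.1, hs.2, mul_comm]
    · by_cases hk' : k = j
      · subst hk'
        simp [hk, hj]
      · simp [hk, hk']

theorem HasTransvections.list_mem (hH : HasTransvections H) (L : List (TransvectionStruct ι F)) :
    ∃ γ ∈ H, (γ : Matrix ι ι F) = (L.map TransvectionStruct.toMatrix).prod := by
  induction L with
  | nil => exact ⟨1, H.one_mem, by simp⟩
  | cons t L ih =>
    obtain ⟨γ, hγ, e⟩ := ih
    obtain ⟨γ', hγ', e'⟩ := hH t.i t.j t.hij t.c
    exact ⟨γ' * γ, H.mul_mem hγ' hγ, by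
      rw [Matrix.GeneralLinearGroup.coe_mul, e, e', List.map_cons, List.prod_cons]; rfl⟩

theorem HasTransvections.mem_of_det_eq_one (hH : HasTransvections H) {g : GL ι F}
    (hg : (g : Matrix ι ι F).det = 1) : g ∈ H := by
  obtain ⟨L, L', D, h⟩ :=
    Pivot.exists_list_transvec_mul_mul_list_transvec_eq_diagonal (g : Matrix ι ι F)
  obtain ⟨γ, hγ, e⟩ := hH.list_mem L
  obtain ⟨γ', hγ', e'⟩ := hH.list_mem L'
  have hdet : ∏ k, D k = 1 := by
    have := congrArg Matrix.det h
    simpa [hg] using this.symm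
  have hD : ∀ k, D k ≠ 0 := fun k hk => by
    rw [Finset.prod_eq_zero (Finset.mem_univ k) hk] at hdet
    exact zero_ne_one hdet
  have hmem : γ * g * γ' ∈ H := by
    rcases isEmpty_or_nonempty ι with hι | ⟨⟨i⟩⟩
    · rw [Subsingleton.elim (γ * g * γ') 1]; exact H.one_mem
    obtain ⟨δ, hδ, e2⟩ := hH.diag i hD (Finset.univ.erase i) (Finset.notMem_erase _ _)
    have : γ * g * γ' = δ := by
      refine Units.ext ?_
      rw [Matrix.GeneralLinearGroup.coe_mul, Matrix.GeneralLinearGroup.coe_mul, e, e', h, e2]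
      congr 1
      ext k
      by_cases hk : k = i
      · subst hk
        rw [← Finset.mul_prod_erase _ _ (Finset.mem_univ k)] at hdet
        simp [eq_inv_of_mul_eq_one_left hdet]
      · simp [hk]
    rwa [this]
  rwa [H.mul_mem_cancel_right hγ', H.mul_mem_cancel_left hγ] at hmem

theorem hasTransvections_of_scalars (h3 : 3 ≤ Fintype.card ι)
    (h : ∀ i j : ι, i ≠ j → ∀ c : F, ∃ γ ∈ H, ∃ z : F, z ≠ 0 ∧
      (γ : Matrix ι ι F) = z • Matrix.transvection i j c) : HasTransvections H := by
  intro i j hij c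
  obtain ⟨k, hki, hkj⟩ : ∃ k, k ≠ i ∧ k ≠ j := by
    by_contra! hk
    have : (Finset.univ : Finset ι) ⊆ {i, j} := fun k _ => by
      by_cases h' : k = i
      · simp [h']
      · simp [hk k h']
    have := (Finset.card_le_card this).trans Finset.card_le_two
    rw [Finset.card_univ] at this
    lia
  obtain ⟨γ₁, h₁, z₁, hz₁, e₁⟩ := h i k hki.symm c
  obtain ⟨γ₂, h₂, z₂, hz₂, e₂⟩ := h k j hkj 1
  refine ⟨γ₁ * γ₂ * (γ₂ * γ₁)⁻¹, H.mul_mem (H.mul_mem h₁ h₂) (H.inv_mem (H.mul_mem h₂ h₁)), ?_⟩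
  have key : (γ₁ : Matrix ι ι F) * γ₂ = Matrix.transvection i j c * (γ₂ * γ₁) := by
    refine matrix_ext fun v => ?_
    simp only [e₁, e₂, ← Matrix.mulVec_mulVec, Matrix.smul_mulVec, Matrix.mulVec_smul,
      transvection_mulVec_eq_update]
    rw [smul_comm]
    congr 2
    ext l
    by_cases hl : l = i
    · subst hl; simp [hki, hij.symm, hki.symm, hkj.symm]; ring
    · by_cases hl' : l = k
      · subst hl'; simp [hl, hij.symm, hki.symm, hkj.symm]
      · simp [hl, hl']
  have h4 := congrArg (fun M => M * (((γ₂ * γ₁)⁻¹ : GL ι F) : Matrix ι ι F)) key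
  rw [mul_assoc (Matrix.transvection i j c), ← Matrix.GeneralLinearGroup.coe_mul,
    ← Matrix.GeneralLinearGroup.coe_mul, ← Matrix.GeneralLinearGroup.coe_mul,
    ← Matrix.GeneralLinearGroup.coe_mul] at h4
  rw [h4]; simp

end GLGen

namespace GLGen

open Matrix FieldSplit

variable {n : ℕ} {F : Type*} [Field F]

/-- Invertible matrices as linear automorphisms. -/
def glEquiv (n : ℕ) (F : Type*) [Field F] : GL (Fin n) F ≃* ((Fin n → F) ≃ₗ[F] (Fin n → F)) :=
  Matrix.GeneralLinearGroup.toLin.trans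
    (LinearMap.GeneralLinearGroup.generalLinearEquiv F (Fin n → F))

theorem glEquiv_apply (g : GL (Fin n) F) (v : Fin n → F) :
    glEquiv n F g v = (g : Matrix (Fin n) (Fin n) F) *ᵥ v := rfl

theorem det_glEquiv (g : GL (Fin n) F) :
    LinearMap.det (glEquiv n F g).toLinearMap = (g : Matrix (Fin n) (Fin n) F).det := by
  rw [← LinearMap.det_toLin' (g : Matrix (Fin n) (Fin n) F)]
  rfl

theorem mem_SLinGL {g : GL (Fin n) F} :
    g ∈ SLinGL n F ↔ (g : Matrix (Fin n) (Fin n) F).det = 1 := by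
  constructor
  · rintro ⟨s, rfl⟩
    exact s.2
  · intro h
    exact ⟨⟨g, h⟩, Units.ext rfl⟩

/-- The group generated by a linear group and the scalars. -/
def withScalars (H : Subgroup (GL (Fin n) F)) : Subgroup ((Fin n → F) ≃ₗ[F] (Fin n → F)) where
  carrier := {γ | ∃ h ∈ H, ∃ c : F, c ≠ 0 ∧ ∀ v, γ v = c • glEquiv n F h v}
  one_mem' := ⟨1, H.one_mem, 1, one_ne_zero, fun v => by simp⟩
  mul_mem' := by
    rintro γ γ' ⟨h, hh, c, hc, e⟩ ⟨h', hh', c', hc', e'⟩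
    refine ⟨h * h', H.mul_mem hh hh', c * c', mul_ne_zero hc hc', fun v => ?_⟩
    rw [LinearEquiv.mul_apply, e, e', map_mul, LinearEquiv.mul_apply, map_smul, smul_smul]
  inv_mem' := by
    rintro γ ⟨h, hh, c, hc, e⟩
    refine ⟨h⁻¹, H.inv_mem hh, c⁻¹, inv_ne_zero hc, fun v => ?_⟩
    refine γ.injective ?_
    rw [← LinearEquiv.mul_apply, mul_inv_cancel, e, map_smul, smul_smul, mul_inv_cancel₀ hc,
      one_smul, ← LinearEquiv.mul_apply, ← map_mul, mul_inv_cancel, map_one]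

theorem hasScalars_withScalars (H : Subgroup (GL (Fin n) F)) : HasScalars (withScalars H) :=
  fun c hc => ⟨LinearEquiv.smulOfNeZero F _ c hc, ⟨1, H.one_mem, c, hc, fun v => by simp⟩,
    fun _ => rfl⟩

theorem mem_withScalars {H : Subgroup (GL (Fin n) F)} {h : GL (Fin n) F} (hh : h ∈ H) :
    glEquiv n F h ∈ withScalars H := ⟨h, hh, 1, one_ne_zero, fun v => by simp⟩

theorem SLinGL_le_of_pair [Finite F] (h3 : 3 ≤ n) {κ κ' : ℕ ⊕ ℕ × ℕ} {x y : GL (Fin n) F}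
    (hx : IsKind κ (glEquiv n F x)) (hy : IsKind κ' (glEquiv n F y))
    (hd : Disjoint (kindDims n κ) (kindDims n κ')) : SLinGL n F ≤ Subgroup.closure {x, y} := by
  set H := Subgroup.closure {x, y} with hH
  have hr : Module.finrank F (Fin n → F) = n := by simp
  have ht : HasTransvections H := by
    refine hasTransvections_of_scalars (by simpa using h3) fun i j hij c => ?_
    obtain ⟨γ, ⟨h, hh, z, hz, e⟩, hγ⟩ := transvections_of_pair hx hy (by rwa [hr])
      (mem_withScalars (Subgroup.subset_closure (by simp) : x ∈ H))
      (mem_withScalars (Subgroup.subset_closure (by simp) : y ∈ H))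
      (hasScalars_withScalars H) (Pi.single i c) (LinearMap.proj j) (by simp [hij.symm])
    refine ⟨h, hh, z⁻¹, inv_ne_zero hz, matrix_ext fun v => ?_⟩
    have h1 := (e v).symm.trans (hγ v)
    rw [glEquiv_apply] at h1
    rw [Matrix.smul_mulVec, transvection_mulVec_eq_update, eq_inv_smul_iff₀ hz, h1]
    ext k
    by_cases hk : k = i
    · subst hk; simp [mul_comm]
    · simp [hk]
  exact fun g hg => ht.mem_of_det_eq_one (mem_SLinGL.1 hg)

theorem closure_eq_top_of_pair [Finite F] (h3 : 3 ≤ n) {κ κ' : ℕ ⊕ ℕ × ℕ}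
    {G : Subgroup (GL (Fin n) F)} {x y : G} {δ : Fˣ}
    (hx : IsKind κ (glEquiv n F x)) (hy : IsKind κ' (glEquiv n F y))
    (hd : Disjoint (kindDims n κ) (kindDims n κ'))
    (hδ : ∀ g ∈ G, ∃ i : ℤ, Matrix.GeneralLinearGroup.det g = δ ^ i)
    (hdet : Matrix.GeneralLinearGroup.det (x : GL (Fin n) F) = δ) :
    Subgroup.closure {x, y} = ⊤ := by
  have hS := SLinGL_le_of_pair h3 hx hy hd
  have hmap : (Subgroup.closure {x, y}).map G.subtype =
      Subgroup.closure {(x : GL (Fin n) F), (y : GL (Fin n) F)} := by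
    rw [MonoidHom.map_closure, Set.image_pair]; rfl
  rw [eq_top_iff]
  rintro g -
  suffices (g : GL (Fin n) F) ∈ (Subgroup.closure {x, y}).map G.subtype by
    obtain ⟨g', hg', h⟩ := this
    rwa [Subtype.ext h] at hg'
  rw [hmap]
  obtain ⟨i, hi⟩ := hδ g g.2
  have h1 : (g : GL (Fin n) F) * ((x : GL (Fin n) F) ^ i)⁻¹ ∈ SLinGL n F := by
    rw [mem_SLinGL]
    have : Matrix.GeneralLinearGroup.det ((g : GL (Fin n) F) * ((x : GL (Fin n) F) ^ i)⁻¹) = 1 := by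
      rw [map_mul, map_inv, map_zpow, hi, hdet, mul_inv_cancel]
    exact congrArg Units.val this
  have h2 := hS h1
  rwa [Subgroup.mul_mem_cancel_right _ (inv_mem (zpow_mem (Subgroup.subset_closure (by simp)) _))]
    at h2

/-- The shapes that are realised by elements of any prescribed determinant. -/
def GoodKind (n q : ℕ) : ℕ ⊕ ℕ × ℕ → Prop
  | Sum.inl k => 5 ≤ k ∧ k.Coprime n ∧ 2 * k + 9 ≤ n
  | Sum.inr (a, b) => 5 ≤ a ∧ a < b ∧ 2 * (a + b) + 9 ≤ n ∧ (Nat.gcd a b).Coprime n ∧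
      (¬ a ∣ n - (a + b)) ∧ (¬ b ∣ n - (a + b)) ∧
      (∃ l : ℕ, l.Prime ∧ ∀ d, l ∣ q ^ d - 1 ↔ a ∣ d) ∧
      ∃ l : ℕ, l.Prime ∧ ∀ d, l ∣ q ^ d - 1 ↔ b ∣ d

theorem GoodKind.exists_isKind [Finite F] {κ : ℕ ⊕ ℕ × ℕ} (h : GoodKind n (Nat.card F) κ)
    (δ : Fˣ) : ∃ x : GL (Fin n) F, IsKind κ (glEquiv n F x) ∧
      Matrix.GeneralLinearGroup.det x = δ := by
  have hr : Module.finrank F (Fin n → F) = n := by simp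
  suffices ∃ x : (Fin n → F) ≃ₗ[F] (Fin n → F), IsKind κ x ∧ LinearMap.det x.toLinearMap = δ by
    obtain ⟨x, h1, h2⟩ := this
    refine ⟨(glEquiv n F).symm x, by simpa using h1, Units.ext ?_⟩
    rw [← h2, ← (glEquiv n F).apply_symm_apply x, det_glEquiv]
    simp
  rcases κ with k | ⟨a, b⟩
  · obtain ⟨h1, h2, h3⟩ := h
    exact exists_isTwo h1 (by rwa [hr]) (by rwa [hr]) δ
  · obtain ⟨h1, h2, h3, h4, h5, h6, ⟨l₁, h7, h8⟩, l₂, h9, h10⟩ := h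
    exact exists_isThree (m := n - (a + b)) h1 h2 (by lia) (by rw [hr]; lia) (by rwa [hr]) h5 h6
      h7 h9 h8 h10 δ

/-- Good shapes with disjoint sets of invariant dimensions give independent classes. -/
theorem card_le_kappaIndep [Finite F] (h3 : 3 ≤ n) {G : Subgroup (GL (Fin n) F)}
    (hG : SLinGL n F ≤ G) (I : Finset (ℕ ⊕ ℕ × ℕ)) (hI : ∀ κ ∈ I, GoodKind n (Nat.card F) κ)
    (hd : ∀ κ ∈ I, ∀ κ' ∈ I, κ ≠ κ' → Disjoint (kindDims n κ) (kindDims n κ')) :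
    I.card ≤ kappaIndep G := by
  classical
  have hr : Module.finrank F (Fin n → F) = n := by simp
  have : Finite G := inferInstance
  have : Finite (ConjClasses G) := inferInstance
  have : Fintype (ConjClasses G) := Fintype.ofFinite _
  have hbdd : BddAbove {k | ∃ S : Finset (ConjClasses G), S.card = k ∧
      IsIndependentClasses G S} := by
    refine ⟨Fintype.card (ConjClasses G), ?_⟩
    rintro _ ⟨S, rfl, -⟩
    exact Finset.card_le_univ S
  obtain ⟨⟨δ, hδG⟩, hδ⟩ := IsCyclic.exists_generator
    (α := G.map (Matrix.GeneralLinearGroup.det (n := Fin n) (R := F)))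
  have hδ' : ∀ g ∈ G, ∃ i : ℤ, Matrix.GeneralLinearGroup.det g = δ ^ i := fun g hg => by
    obtain ⟨i, hi⟩ := hδ ⟨_, Subgroup.mem_map_of_mem _ hg⟩
    exact ⟨i, (congrArg Subtype.val hi).symm⟩
  have hex : ∀ κ : ℕ ⊕ ℕ × ℕ, ∃ x : G, κ ∈ I → IsKind κ (glEquiv n F x) ∧
      Matrix.GeneralLinearGroup.det (x : GL (Fin n) F) = δ := fun κ => by
    by_cases hκ : κ ∈ I
    · obtain ⟨x, h1, h2⟩ := (hI κ hκ).exists_isKind δ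
      obtain ⟨g, hg, hgδ⟩ := hδG
      have : x * g⁻¹ ∈ SLinGL n F := by
        rw [mem_SLinGL]
        have : Matrix.GeneralLinearGroup.det (x * g⁻¹) = 1 := by
          rw [map_mul, map_inv, h2, hgδ, mul_inv_cancel]
        exact congrArg Units.val this
      have hx := hG this
      rw [G.mul_mem_cancel_right (G.inv_mem hg)] at hx
      exact ⟨⟨x, hx⟩, fun _ => ⟨h1, h2⟩⟩
    · exact ⟨1, fun h => absurd h hκ⟩
  choose X hX using hex
  have hconj : ∀ κ ∈ I, ∀ y ∈ (ConjClasses.mk (X κ)).carrier, IsKind κ (glEquiv n F y) ∧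
      Matrix.GeneralLinearGroup.det (y : GL (Fin n) F) = δ := fun κ hκ y hy => by
    rw [ConjClasses.mem_carrier_iff_mk_eq, ConjClasses.mk_eq_mk_iff_isConj] at hy
    obtain ⟨g, hg⟩ := isConj_iff.1 hy.symm
    obtain ⟨h1, h2⟩ := hX κ hκ
    rw [← hg]
    constructor
    · have := h1.conj (glEquiv n F g)
      rw [← map_inv, ← map_mul, ← map_mul] at this
      exact this
    · rw [← h2, Subgroup.coe_mul, Subgroup.coe_mul, map_mul, map_mul, Subgroup.coe_inv, map_inv]
      exact mul_inv_cancel_comm _ _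
  have hinj : Set.InjOn (fun κ => ConjClasses.mk (X κ)) I := by
    intro κ hκ κ' hκ' h
    by_contra hne
    have h1 := (hX κ hκ).1
    have h2 := (hconj κ' hκ' (X κ) (by
      rw [ConjClasses.mem_carrier_iff_mk_eq]; exact h)).1
    obtain ⟨N, hN, hb, ht, hm⟩ := h1.exists_invariant
    have hm' := ((h2.invariant hN).resolve_left hb).resolve_left ht
    rw [hr] at hm hm'
    exact Finset.disjoint_left.1 (hd κ hκ κ' hκ' hne) hm hm'
  refine le_csSup hbdd ⟨I.image (fun κ => ConjClasses.mk (X κ)), Finset.card_image_of_injOn hinj,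
    ?_⟩
  intro c hc d hd' hcd x hx y hy
  obtain ⟨κ, hκ, rfl⟩ := Finset.mem_image.1 hc
  obtain ⟨κ', hκ', rfl⟩ := Finset.mem_image.1 hd'
  have hne : κ ≠ κ' := fun h => hcd (by rw [h])
  obtain ⟨h1, h2⟩ := hconj κ hκ x hx
  obtain ⟨h1', -⟩ := hconj κ' hκ' y hy
  exact closure_eq_top_of_pair h3 h1 h1' (hd κ hκ κ' hκ' hne) hδ' h2

end GLGen

namespace Zsigmondy

open Polynomial

theorem le_totient_sq (a : ℕ) (ha : 0 < a) :
    a ≤ (if 2 ∣ a then 2 else 1) * a.totient ^ 2 := by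
  induction a using Nat.recOnPosPrimePosCoprime with
  | zero => lia
  | one => simp
  | prime_pow p k hp hk =>
    obtain ⟨k, rfl⟩ := Nat.exists_eq_succ_of_ne_zero hk.ne'
    rw [Nat.totient_prime_pow_succ hp]
    rcases hp.eq_two_or_odd' with rfl | hodd
    · rw [if_pos (dvd_pow_self 2 k.succ_ne_zero), Nat.succ_eq_add_one]
      have : 1 ≤ 2 ^ k := Nat.one_le_two_pow
      rw [pow_succ]
      nlinarith
    · have h2 : 3 ≤ p := by
        have := hp.two_le
        rcases hodd with ⟨c, rfl⟩
        lia
      rw [if_neg (fun h => by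
        have := (Nat.prime_dvd_prime_iff_eq Nat.prime_two hp).1 (Nat.prime_two.dvd_of_dvd_pow h)
        lia), one_mul, Nat.succ_eq_add_one, pow_succ, mul_pow]
      obtain ⟨c, rfl⟩ := Nat.exists_eq_add_of_le h2
      refine Nat.mul_le_mul (Nat.le_self_pow two_ne_zero _) ?_
      rw [show 3 + c - 1 = c + 2 by lia]
      nlinarith
  | coprime a b ha' hb hc iha ihb =>
    have h1 := iha (by lia)
    have h2 := ihb (by lia)
    rw [Nat.totient_mul hc, mul_pow]
    refine (Nat.mul_le_mul h1 h2).trans ?_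
    by_cases ca : 2 ∣ a
    · have cb : ¬ 2 ∣ b := fun cb => by simpa using Nat.dvd_gcd ca cb |>.trans hc.dvd
      rw [if_pos ca, if_neg cb, if_pos (ca.mul_right b)]
      lia
    · by_cases cb : 2 ∣ b
      · rw [if_neg ca, if_pos cb, if_pos (cb.mul_left a)]
        lia
      · rw [if_neg ca, if_neg cb, if_neg (fun h => (Nat.prime_two.dvd_mul.1 h).elim ca cb)]
        lia

theorem eval_cyclotomic_pos {a : ℕ} {q : ℤ} (hq : 2 ≤ q) : 0 < (cyclotomic a ℤ).eval q :=
  cyclotomic_pos' a (by lia)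

theorem sub_one_pow_le (a : ℕ) {q : ℤ} (hq : 2 ≤ q) :
    (q - 1) ^ a.totient ≤ (cyclotomic a ℤ).eval q := by
  have := sub_one_pow_totient_le_cyclotomic_eval (q := (q : ℝ))
      (by exact_mod_cast (by lia : 1 < q)) a
  have h2 : (cyclotomic a ℝ).eval (q : ℝ) = ((cyclotomic a ℤ).eval q : ℤ) := by
    rw [← map_cyclotomic_int, eval_intCast_map]; simp
  rw [h2] at this
  exact_mod_cast this

theorem le_add_one_pow (a : ℕ) {q : ℤ} (hq : 2 ≤ q) :
    (cyclotomic a ℤ).eval q ≤ (q + 1) ^ a.totient := by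
  have := cyclotomic_eval_le_add_one_pow_totient (q := (q : ℝ))
      (by exact_mod_cast (by lia : 1 < q)) a
  have h2 : (cyclotomic a ℝ).eval (q : ℝ) = ((cyclotomic a ℤ).eval q : ℤ) := by
    rw [← map_cyclotomic_int, eval_intCast_map]; simp
  rw [h2] at this
  exact_mod_cast this

/-- The value at `2` of a cyclotomic polynomial is at least the square root of `2 ^ φ(a)`. -/
theorem two_pow_le_eval_two_sq {a : ℕ} (ha : 3 ≤ a) :
    (2 : ℤ) ^ a.totient ≤ (cyclotomic a ℤ).eval 2 ^ 2 := by
  obtain ⟨p, m, hp, rfl, h⟩ : ∃ p m : ℕ, p.Prime ∧ a = m * p ∧ (p ∣ m ∨ p ≠ 2) := by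
    by_cases h4 : 4 ∣ a
    · obtain ⟨c, rfl⟩ := h4
      exact ⟨2, 2 * c, Nat.prime_two, by ring, Or.inl (dvd_mul_right _ _)⟩
    · obtain ⟨p, hp, ⟨m, rfl⟩, h2⟩ :=
        (Nat.four_dvd_or_exists_odd_prime_and_dvd_of_two_lt ha).resolve_left h4
      exact ⟨p, m, hp, mul_comm _ _, Or.inr fun h => by
          subst h; exact absurd h2 (by decide)⟩
  have hev : ∀ m : ℕ, (expand ℤ p (cyclotomic m ℤ)).eval 2 = (cyclotomic m ℤ).eval (2 ^ p) :=
    fun m => expand_eval _ _ _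
  have hp2 : (2 : ℤ) ≤ 2 ^ p := le_self_pow₀ (by norm_num) hp.ne_zero
  have hp4 : (2 : ℤ) ^ p = 2 * 2 ^ (p - 1) := by
    rw [← pow_succ', Nat.sub_add_cancel hp.one_lt.le]
  have hp1 : (1 : ℤ) ≤ 2 ^ (p - 1) := one_le_pow₀ (by norm_num)
  have hpp := hp.two_le
  by_cases hd : p ∣ m
  · have h1 := hev m
    rw [cyclotomic_expand_eq_cyclotomic hp hd] at h1
    have h2 := sub_one_pow_le m hp2
    rw [← h1] at h2
    have h3 : (m * p).totient = p * m.totient := by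
      rw [mul_comm, Nat.totient_mul_of_prime_of_dvd hp hd]
    rw [h3]
    calc (2 : ℤ) ^ (p * m.totient) ≤ (2 ^ (p - 1)) ^ (m.totient * 2) := by
          rw [← pow_mul]
          refine pow_le_pow_right₀ (by norm_num) ?_
          nlinarith [Nat.sub_add_cancel hp.one_lt.le, m.totient.zero_le]
      _ ≤ (2 ^ p - 1) ^ (m.totient * 2) := pow_le_pow_left₀ (by positivity) (by lia) _
      _ ≤ _ := by
          rw [pow_mul]
          exact pow_le_pow_left₀ (pow_nonneg (by lia) _) h2 2
  · have hne := h.resolve_left hd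
    have h1 := hev m
    rw [cyclotomic_expand_eq_cyclotomic_mul hp hd, eval_mul] at h1
    have h2 := sub_one_pow_le m hp2
    have h4 := le_add_one_pow m (le_refl (2 : ℤ))
    have hpos := eval_cyclotomic_pos (a := m * p) (le_refl (2 : ℤ))
    rw [← h1] at h2
    have h3 : (m * p).totient = (p - 1) * m.totient := by
      rw [Nat.totient_mul ((Nat.Prime.coprime_iff_not_dvd hp).2 hd).symm, Nat.totient_prime hp,
        mul_comm]
    have h5 : (3 : ℤ) * 2 ^ (p - 2) ≤ 2 ^ p - 1 := by
      have e : (2 : ℤ) ^ p = 4 * 2 ^ (p - 2) := by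
        rw [show (4 : ℤ) = 2 ^ 2 by norm_num, ← pow_add, Nat.add_sub_cancel' hpp]
      have := one_le_pow₀ (n := p - 2) (by norm_num : (1 : ℤ) ≤ 2)
      lia
    have h6 : ((2 : ℤ) ^ (p - 2)) ^ m.totient ≤ (cyclotomic (m * p) ℤ).eval 2 := by
      have h7 : (3 : ℤ) ^ m.totient * (2 ^ (p - 2)) ^ m.totient ≤
          3 ^ m.totient * (cyclotomic (m * p) ℤ).eval 2 := by
        rw [← mul_pow]
        calc _ ≤ (2 ^ p - 1 : ℤ) ^ m.totient := pow_le_pow_left₀ (by positivity) h5 _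
          _ ≤ _ := h2
          _ ≤ _ := by
            rw [mul_comm]
            exact mul_le_mul_of_nonneg_right (by simpa using h4) hpos.le
      exact le_of_mul_le_mul_left h7 (by positivity)
    rw [h3]
    calc (2 : ℤ) ^ ((p - 1) * m.totient) ≤ (2 ^ (p - 2)) ^ (m.totient * 2) := by
          rw [← pow_mul]
          refine pow_le_pow_right₀ (by norm_num) ?_
          obtain ⟨c, rfl⟩ : ∃ c, p = c + 3 := ⟨p - 3, by lia⟩
          rw [show c + 3 - 1 = c + 2 by lia, show c + 3 - 2 = c + 1 by lia]
          nlinarith [m.totient.zero_le, (c * m.totient).zero_le]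
      _ ≤ _ := by
          rw [pow_mul]
          exact pow_le_pow_left₀ (by positivity) h6 2

theorem lt_eval_cyclotomic {a : ℕ} (ha : 800 ≤ a) {q : ℤ} (hq : 2 ≤ q) :
    (a : ℤ) < (cyclotomic a ℤ).eval q := by
  have h1 : (2 : ℤ) ^ a.totient ≤ (cyclotomic a ℤ).eval q ^ 2 := by
    rcases hq.eq_or_lt with rfl | hq
    · exact two_pow_le_eval_two_sq (by lia)
    · have h2 := sub_one_pow_le a hq.le
      calc (2 : ℤ) ^ a.totient ≤ (q - 1) ^ a.totient := pow_le_pow_left₀ (by norm_num) (by lia) _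
        _ ≤ _ := h2
        _ ≤ _ := le_self_pow₀ (by have := eval_cyclotomic_pos (a := a) hq.le; lia) two_ne_zero
  have h2 : a ≤ 2 * a.totient ^ 2 :=
    (le_totient_sq a (by lia)).trans (Nat.mul_le_mul_right _ (by split_ifs <;> lia))
  have h3 : 20 ≤ a.totient := by nlinarith
  have h4 : ∀ t, 20 ≤ t → 4 * t ^ 4 < 2 ^ t := by
    intro t ht
    induction t, ht using Nat.le_induction with
    | base => norm_num
    | succ t ht ih =>
      rw [pow_succ 2]
      have : (t + 1) ^ 4 ≤ 2 * t ^ 4 := by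
        obtain ⟨c, rfl⟩ := Nat.exists_eq_add_of_le ht
        ring_nf
        nlinarith [pow_nonneg c.zero_le 2, pow_nonneg c.zero_le 3, pow_nonneg c.zero_le 4]
      lia
  have h5 : (a : ℤ) ^ 2 < 2 ^ a.totient := by
    have : a ^ 2 < 2 ^ a.totient := by
      refine lt_of_le_of_lt ?_ (h4 _ h3)
      calc a ^ 2 ≤ (2 * a.totient ^ 2) ^ 2 := Nat.pow_le_pow_left h2 2
        _ = _ := by ring
    exact_mod_cast this
  exact lt_of_pow_lt_pow_left₀ 2 (eval_cyclotomic_pos hq).le (h5.trans_le h1)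

theorem not_sq_dvd_eval {a : ℕ} (ha : 3 ≤ a) {q : ℤ} (hq : 2 ≤ q) {l : ℕ} (hl : l.Prime)
    (hla : l ∣ a) :
    ¬ (l : ℤ) ^ 2 ∣ (cyclotomic a ℤ).eval q := by
  intro hsq
  obtain ⟨m, rfl⟩ := hla
  have hm : 0 < m := by by_contra!; simp_all
  set y := q ^ m with hy
  have hdvd : (y - 1) * (cyclotomic (l * m) ℤ).eval q ∣ y ^ l - 1 := by
    have h := X_pow_sub_one_mul_cyclotomic_dvd_X_pow_sub_one_of_dvd ℤ (d := m) (n := l * m)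
      (Nat.mem_properDivisors.2 ⟨dvd_mul_left _ _, by nlinarith [hl.two_le]⟩)
    have h2 := map_dvd (evalRingHom q) h
    simp only [coe_evalRingHom, eval_mul, eval_sub, eval_pow, eval_X, eval_one] at h2
    rwa [mul_comm l m, pow_mul, ← hy, mul_comm m l] at h2
  have hly : (l : ℤ) ∣ y - 1 := by
    have h1 : (l : ℤ) ∣ y ^ l - 1 := ((dvd_pow_self _ two_ne_zero).trans hsq).trans
      ((dvd_mul_left _ _).trans hdvd)
    have := Fact.mk hl
    rw [← ZMod.intCast_zmod_eq_zero_iff_dvd] at h1 ⊢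
    push_cast at h1 ⊢
    rwa [ZMod.pow_card] at h1
  have hy2 : 2 ≤ y := hq.trans (le_self_pow₀ (by lia) hm.ne')
  have hgs : (cyclotomic (l * m) ℤ).eval q ∣ ∑ i ∈ Finset.range l, y ^ i := by
    rw [← mul_geom_sum y l] at hdvd
    exact (mul_dvd_mul_iff_left (by lia : y - 1 ≠ 0)).1 hdvd
  have hs := hsq.trans hgs
  rcases hl.eq_two_or_odd' with rfl | hodd
  · simp only [Finset.sum_range_succ, Finset.sum_range_zero] at hs
    norm_num at hs
    have hs' : (1 + y) % 4 = 0 := Int.emod_eq_zero_of_dvd hs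
    rcases Nat.even_or_odd m with hev | hmo
    · obtain ⟨c, rfl⟩ := hev
      rw [pow_add] at hy
      have : q ^ c % 4 = 0 ∨ q ^ c % 4 = 1 ∨ q ^ c % 4 = 2 ∨ q ^ c % 4 = 3 := by lia
      have hmul := Int.mul_emod (q ^ c) (q ^ c) 4
      rcases this with h | h | h | h <;> (simp [h] at hmul; lia)
    · have hqo : (2 : ℤ) ∣ q - 1 := by
        have : Odd y := by
          obtain ⟨c, hc⟩ := hly
          exact ⟨c, by push_cast at hc; lia⟩
        rw [hy, Int.odd_pow' hm.ne'] at this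
        obtain ⟨c, rfl⟩ := this
        exact ⟨c, by ring⟩
      have h1 : (cyclotomic (2 * m) ℤ).eval 1 = 1 := by
        refine eval_one_cyclotomic_not_prime_pow fun {p} hp k hk => ?_
        have hp2 : p = 2 := by
          have : 2 ∣ p ^ k := hk ▸ dvd_mul_right 2 m
          exact ((Nat.prime_dvd_prime_iff_eq Nat.prime_two hp).1
            (Nat.prime_two.dvd_of_dvd_pow this)).symm
        subst hp2
        rcases k with _ | _ | k
        · lia
        · lia
        · obtain ⟨c, rfl⟩ := hmo
          rw [pow_succ, pow_succ] at hk
          lia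
      have h2 := (cyclotomic (2 * m) ℤ).sub_dvd_eval_sub q 1
      have h3 := hqo.trans h2
      rw [h1] at h3
      have h4 : (2 : ℤ) ∣ (cyclotomic (2 * m) ℤ).eval q := (by norm_num : (2 : ℤ) ∣ 2 ^ 2).trans
        (by exact_mod_cast hsq)
      lia
  · obtain ⟨u, hu⟩ := hly
    have h1 := odd_sq_dvd_geom_sum₂_sub (R := ℤ) (p := l) 1 u hodd
    have hyu : y = 1 + l * u := by lia
    simp only [one_pow, mul_one, ← hyu] at h1
    have h2 := (dvd_sub_right hs).1 h1
    have h3 : l ^ 2 ∣ l := by exact_mod_cast h2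
    have := Nat.le_of_dvd hl.pos h3
    nlinarith [hl.two_le]

/-- Primitive prime divisors exist for large exponents. -/
theorem exists_primitive_prime {a q : ℕ} (ha : 800 ≤ a) (hq : 2 ≤ q) :
    ∃ l : ℕ, l.Prime ∧ ∀ d, l ∣ q ^ d - 1 ↔ a ∣ d := by
  have hq' : (2 : ℤ) ≤ q := by exact_mod_cast hq
  set W := ((cyclotomic a ℤ).eval (q : ℤ)).natAbs with hW
  have hpos := eval_cyclotomic_pos (a := a) hq'
  have hlt : a < W := by
    have := lt_eval_cyclotomic ha hq'
    lia
  obtain ⟨l, hl, hlW, hla⟩ : ∃ l : ℕ, l.Prime ∧ l ∣ W ∧ ¬ l ∣ a := by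
    by_contra! h
    have hsf : Squarefree W := by
      rw [Nat.squarefree_iff_prime_squarefree]
      intro l hl hd
      refine not_sq_dvd_eval (by lia) hq' hl (h l hl ((dvd_mul_right _ _).trans hd)) ?_
      rw [← Int.natCast_pow, Int.natCast_dvd, sq]
      exact hd
    have h1 : W ∣ a := by
      rw [← Nat.prod_primeFactors_of_squarefree hsf]
      refine Finset.prod_primes_dvd _ (fun p hp => (Nat.prime_of_mem_primeFactors hp).prime)
        fun p hp => h p (Nat.prime_of_mem_primeFactors hp) (Nat.dvd_of_mem_primeFactors hp)
    exact absurd (Nat.le_of_dvd (by lia) h1) (by lia)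
  refine ⟨l, hl, fun d => ?_⟩
  have := Fact.mk hl
  have hne : NeZero ((a : ℕ) : ZMod l) := ⟨by rwa [Ne, ZMod.natCast_eq_zero_iff]⟩
  have hroot : (cyclotomic a (ZMod l)).IsRoot (q : ZMod l) := by
    rw [IsRoot.def, ← map_cyclotomic_int]
    have : (q : ZMod l) = ((q : ℤ) : ZMod l) := by simp
    rw [this, ← eq_intCast (Int.castRingHom (ZMod l)) (q : ℤ), eval_map, eval₂_hom, eq_intCast,
      ZMod.intCast_zmod_eq_zero_iff_dvd, Int.natCast_dvd]
    exact hlW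
  have hprim := isRoot_cyclotomic_iff.1 hroot
  rw [← hprim.pow_eq_one_iff_dvd, ← ZMod.natCast_eq_zero_iff,
    Nat.cast_sub (Nat.one_le_pow _ _ (by lia)), sub_eq_zero]
  simp

end Zsigmondy

namespace CoprimeCount

open Finset

/-- The number of `i < L` for which `u * i + v` is divisible by no member of `S`. -/
def sieveCount (S : Finset ℕ) (u v : ℤ) (L : ℕ) : ℕ :=
  #((range L).filter fun i : ℕ => ∀ p ∈ S, ¬ (p : ℤ) ∣ u * i + v)

theorem exists_dvd_mul_add {p : ℕ} (hp : p.Prime) {u : ℤ} (hu : ¬ (p : ℤ) ∣ u) (v : ℤ) :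
    ∃ c : ℕ, c < p ∧ (p : ℤ) ∣ u * c + v := by
  have := Fact.mk hp
  refine ⟨((-v : ZMod p) * (u : ZMod p)⁻¹).val, ZMod.val_lt _, ?_⟩
  have hu0 : (u : ZMod p) ≠ 0 := by rwa [Ne, ZMod.intCast_zmod_eq_zero_iff_dvd]
  rw [← ZMod.intCast_zmod_eq_zero_iff_dvd]
  push_cast
  rw [ZMod.natCast_zmod_val, mul_comm, inv_mul_cancel_right₀ hu0]
  ring

theorem card_filter_dvd_eq_sieveCount {S : Finset ℕ} {u v : ℤ} {p c : ℕ} (hp : p.Prime)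
    (hu : ¬ (p : ℤ) ∣ u) (hcp : c < p) (hc : (p : ℤ) ∣ u * c + v) (L : ℕ) :
    #((range L).filter fun i : ℕ => (p : ℤ) ∣ u * i + v ∧ ∀ r ∈ S, ¬ (r : ℤ) ∣ u * i + v) =
      sieveCount S (u * p) (u * c + v) ((L - c + (p - 1)) / p) := by
  have hp0 := hp.pos
  have hlt : ∀ j, j < (L - c + (p - 1)) / p ↔ c + p * j < L := fun j => by
    rw [Nat.lt_iff_add_one_le, Nat.le_div_iff_mul_le hp0, add_mul, one_mul, mul_comm j]
    generalize p * j = w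
    lia
  have he : ∀ j : ℕ, u * ((c + p * j : ℕ) : ℤ) + v = u * p * j + (u * c + v) := fun j => by
    push_cast; ring
  symm
  refine card_bij (fun j _ => c + p * j) ?_ ?_ ?_
  · intro j hj
    obtain ⟨h1, h2⟩ := mem_filter.1 hj
    rw [mem_filter, mem_range, he]
    exact ⟨(hlt j).1 (mem_range.1 h1), dvd_add ((dvd_mul_left _ _).mul_right _) hc, h2⟩
  · intro j _ j' _ h
    exact Nat.eq_of_mul_eq_mul_left hp0 (Nat.add_left_cancel h)
  · intro i hi
    obtain ⟨h1, h2, h3⟩ := mem_filter.1 hi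
    have h4 : (p : ℤ) ∣ i - c := by
      have : (p : ℤ) ∣ u * (i - c) := by
        have := dvd_sub h2 hc
        rwa [show u * (i : ℤ) + v - (u * c + v) = u * (i - c) by ring] at this
      exact ((Nat.prime_iff_prime_int.1 hp).dvd_or_dvd this).resolve_left hu
    have h5 : c ≤ i := by
      by_contra! hlt
      have := Int.le_of_dvd (by lia) (dvd_neg.2 h4 : (p : ℤ) ∣ -((i : ℤ) - c))
      lia
    obtain ⟨j, hj⟩ := Int.natCast_dvd_natCast.1 (by rwa [Nat.cast_sub h5] : (p : ℤ) ∣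
        ((i - c : ℕ) : ℤ))
    have hi' : i = c + p * j := by lia
    subst hi'
    refine ⟨j, mem_filter.2 ⟨mem_range.2 ((hlt j).2 (mem_range.1 h1)), fun r hr => ?_⟩, rfl⟩
    rw [← he]
    exact h3 r hr

theorem prod_one_sub_inv_mem {S : Finset ℕ} (hS : ∀ p ∈ S, p.Prime) :
    0 ≤ ∏ p ∈ S, (1 - 1 / (p : ℝ)) ∧ ∏ p ∈ S, (1 - 1 / (p : ℝ)) ≤ 1 := by
  have h : ∀ p ∈ S, 0 ≤ 1 - 1 / (p : ℝ) ∧ 1 - 1 / (p : ℝ) ≤ 1 := fun p hp => by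
    have h1 : (1 : ℝ) ≤ p := by exact_mod_cast (hS p hp).one_lt.le
    have h2 : 1 / (p : ℝ) ≤ 1 := by rw [div_le_one (by linarith)]; exact h1
    have h3 : 0 ≤ 1 / (p : ℝ) := by positivity
    constructor <;> linarith
  exact ⟨prod_nonneg fun p hp => (h p hp).1, prod_le_one (fun p hp => (h p hp).1)
    fun p hp => (h p hp).2⟩

/-- Legendre's sieve for an arithmetic progression. -/
theorem abs_sieveCount_sub_le {S : Finset ℕ} (hS : ∀ p ∈ S, p.Prime) {u : ℤ}
    (hu : ∀ p ∈ S, ¬ (p : ℤ) ∣ u) (v : ℤ) (L : ℕ) :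
    |(sieveCount S u v L : ℝ) - L * ∏ p ∈ S, (1 - 1 / (p : ℝ))| ≤ 2 ^ #S - 1 := by
  induction S using Finset.induction_on generalizing u v L with
  | empty => simp [sieveCount]
  | insert p S hpS ih =>
    have hp := hS p (mem_insert_self _ _)
    have hS' : ∀ r ∈ S, r.Prime := fun r hr => hS r (mem_insert_of_mem hr)
    have hup := hu p (mem_insert_self _ _)
    have hu' : ∀ r ∈ S, ¬ (r : ℤ) ∣ u := fun r hr => hu r (mem_insert_of_mem hr)
    obtain ⟨c, hcp, hc⟩ := exists_dvd_mul_add hp hup v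
    have hsplit : sieveCount (insert p S) u v L +
        sieveCount S (u * p) (u * c + v) ((L - c + (p - 1)) / p) = sieveCount S u v L := by
      rw [← card_filter_dvd_eq_sieveCount hp hup hcp hc, sieveCount, sieveCount, add_comm,
        ← card_union_of_disjoint]
      · congr 1
        ext i
        simp only [mem_union, mem_filter, mem_insert, forall_eq_or_imp]
        tauto
      · rw [disjoint_filter]
        intro i _ h1 h2
        exact h2 p (mem_insert_self _ _) h1.1
    set L' := (L - c + (p - 1)) / p with hL'
    have h1 := ih hS' hu' v L
    have h2 := ih hS' (u := u * p) (fun r hr h => by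
      rcases (Nat.prime_iff_prime_int.1 (hS' r hr)).dvd_or_dvd h with h | h
      · exact hu' r hr h
      · rw [Int.natCast_dvd_natCast, Nat.prime_dvd_prime_iff_eq (hS' r hr) hp] at h
        exact hpS (h ▸ hr)) (u * c + v) L'
    obtain ⟨h3, h4⟩ := prod_one_sub_inv_mem hS'
    have hp0 : (0 : ℝ) < p := by exact_mod_cast hp.pos
    have h5 : |(L' : ℝ) - L / p| ≤ 1 := by
      have h6 : p * L' ≤ L - c + (p - 1) := Nat.mul_div_le _ _
      have h7 : L - c + (p - 1) < p * L' + p := by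
        rw [hL']
        have := Nat.lt_mul_div_succ (L - c + (p - 1)) hp.pos
        lia
      have h8 : p * L' ≤ L + p := by lia
      have h9 : L ≤ p * L' + p := by lia
      have h8' : (p : ℝ) * L' ≤ L + p := by exact_mod_cast h8
      have h9' : (L : ℝ) ≤ p * L' + p := by exact_mod_cast h9
      rw [abs_le]
      constructor
      · rw [neg_le_sub_iff_le_add, div_le_iff₀ hp0]; linarith
      · rw [sub_le_iff_le_add, ← sub_le_iff_le_add', le_div_iff₀ hp0]; linarith
    rw [prod_insert hpS, card_insert_of_notMem hpS]
    set Q := ∏ p ∈ S, (1 - 1 / (p : ℝ))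
    have hs : (sieveCount (insert p S) u v L : ℝ) = sieveCount S u v L -
        sieveCount S (u * p) (u * c + v) L' := by
      rw [← hsplit]; push_cast; ring
    have h6 : |((L' : ℝ) - L / p) * Q| ≤ 1 := by
      rw [abs_mul, abs_of_nonneg h3]
      exact mul_le_one₀ h5 h3 h4
    have e : (sieveCount (insert p S) u v L : ℝ) - L * ((1 - 1 / p) * Q) =
        (sieveCount S u v L - L * Q) - (sieveCount S (u * p) (u * c + v) L' - L' * Q) -
          ((L' : ℝ) - L / p) * Q := by
      rw [hs]; ring
    rw [e, pow_succ]
    rw [abs_le] at h1 h2 h6 ⊢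
    constructor <;> linarith [h1.1, h1.2, h2.1, h2.2, h6.1, h6.2]

theorem totient_eq_mul_prod (n : ℕ) :
    (n.totient : ℝ) = n * ∏ p ∈ n.primeFactors, (1 - 1 / (p : ℝ)) := by
  have := Nat.totient_eq_mul_prod_factors n
  have h2 := congrArg (fun x : ℚ => (x : ℝ)) this
  push_cast at h2
  simpa using h2

/-- Products of an increasing function are smallest on initial segments. -/
theorem prod_range_le_prod {f : ℕ → ℝ} (hf : Monotone f) (h0 : ∀ i, 0 ≤ f i) (T : Finset ℕ) :
    ∏ i ∈ range #T, f i ≤ ∏ t ∈ T, f t := by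
  induction T using Finset.induction_on_max with
  | empty => simp
  | insert a T ha ih =>
    have hn : a ∉ T := fun h => (ha a h).false
    rw [prod_insert hn, card_insert_of_notMem hn, prod_range_succ, mul_comm]
    have : #T ≤ a := by
      have : T ⊆ range a := fun t ht => mem_range.2 (ha t ht)
      simpa using card_le_card this
    exact mul_le_mul (hf this) ih (prod_nonneg fun i _ => h0 i) (h0 a)

theorem coprime_iff_forall_not_dvd {x n : ℕ} (hn : n ≠ 0) :
    x.Coprime n ↔ ∀ p ∈ n.primeFactors, ¬ (p : ℤ) ∣ x := by
  constructor
  · intro h p hp hd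
    have h1 : p ∣ Nat.gcd x n :=
      Nat.dvd_gcd (Int.natCast_dvd_natCast.1 hd) (Nat.dvd_of_mem_primeFactors hp)
    rw [h] at h1
    exact (Nat.prime_of_mem_primeFactors hp).one_lt.ne' (Nat.dvd_one.1 h1)
  · intro h
    by_contra hc
    obtain ⟨p, hp, h1, h2⟩ := Nat.Prime.not_coprime_iff_dvd.1 hc
    exact h p (Nat.mem_primeFactors.2 ⟨hp, h2, hn⟩) (Int.natCast_dvd_natCast.2 h1)

theorem sieveCount_le {S : Finset ℕ} (hS : ∀ p ∈ S, p.Prime) {u : ℤ}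
    (hu : ∀ p ∈ S, ¬ (p : ℤ) ∣ u) (v : ℤ) (L : ℕ) :
    (sieveCount S u v L : ℝ) ≤ L * ∏ p ∈ S, (1 - 1 / (p : ℝ)) + 2 ^ #S - 1 := by
  have := (abs_le.1 (abs_sieveCount_sub_le hS hu v L)).2
  linarith

theorem not_dvd_one_of_prime {S : Finset ℕ} (hS : ∀ p ∈ S, p.Prime) :
    ∀ p ∈ S, ¬ (p : ℤ) ∣ 1 := fun p hp h =>
  (hS p hp).one_lt.ne' (by exact_mod_cast Int.eq_one_of_dvd_one (by positivity) h)

theorem partialTotient_three_mul_le {n : ℕ} (hn : 0 < n) (h3 : ¬ 3 ∣ n) :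
    (partialTotient 12 1 (3 * n) : ℝ) ≤ n.totient / 6 + 2 * 2 ^ nuPrimes n := by
  have h3' : 3 ∉ n.primeFactors := fun h => h3 (Nat.dvd_of_mem_primeFactors h)
  set S := insert 3 n.primeFactors with hS
  have hSp : ∀ p ∈ S, p.Prime := fun p hp => by
    rcases mem_insert.1 hp with rfl | hp
    · exact Nat.prime_three
    · exact Nat.prime_of_mem_primeFactors hp
  have hSn : (3 * n).primeFactors = S := by
    rw [Nat.primeFactors_mul (by norm_num) hn.ne', Nat.Prime.primeFactors Nat.prime_three, hS]
    rfl
  have h1 : partialTotient 12 1 (3 * n) ≤ sieveCount S 1 (n / 4 + 1 : ℕ) (n / 2 - n / 4) := by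
    refine card_le_card_of_injOn (fun x => x - (n / 4 + 1)) ?_ ?_
    · intro x hx
      obtain ⟨-, h1, h2, h3⟩ := mem_filter.1 (mem_coe.1 hx)
      have h2' : n < 4 * x := by
        push_cast at h2
        have : (n : ℚ) < 4 * x := by linarith
        exact_mod_cast this
      have h3' : 2 * x < n := by
        push_cast at h3
        have : 2 * (x : ℚ) < n := by linarith
        exact_mod_cast this
      refine mem_coe.2 (mem_filter.2 ⟨mem_range.2 (by lia), fun p hp => ?_⟩)
      have e : (1 : ℤ) * ((x - (n / 4 + 1) : ℕ) : ℤ) + (n / 4 + 1 : ℕ) = x := by lia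
      rw [e]
      exact (coprime_iff_forall_not_dvd (by lia)).1 h1 p (hSn ▸ hp)
    · intro x hx y hy h
      have hl : ∀ x ∈ (range (3 * n * (1 + 1) + 1)).filter (fun x => Nat.Coprime x (3 * n) ∧
          ((3 * n : ℕ) * (1 : ℕ) : ℚ) / (12 : ℕ) < (x : ℚ) ∧
          (x : ℚ) < ((3 * n : ℕ) * ((1 : ℕ) + 1) : ℚ) / (12 : ℕ)), n < 4 * x := fun x hx => by
        obtain ⟨-, h1, h2, h3⟩ := mem_filter.1 hx
        push_cast at h2
        have : (n : ℚ) < 4 * x := by linarith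
        exact_mod_cast this
      have h1 := hl x hx
      have h2 := hl y hy
      simp only at h
      lia
  have h2 := sieveCount_le hSp (not_dvd_one_of_prime hSp) (n / 4 + 1 : ℕ) (n / 2 - n / 4)
  have h4 : ((n / 2 - n / 4 : ℕ) : ℝ) ≤ n / 4 + 1 := by
    have : 4 * (n / 2 - n / 4) ≤ n + 4 := by lia
    have : (4 : ℝ) * (n / 2 - n / 4 : ℕ) ≤ n + 4 := by exact_mod_cast this
    linarith
  rw [hS, prod_insert h3', card_insert_of_notMem h3', ← hS] at h2
  obtain ⟨hQ0, hQ1⟩ := prod_one_sub_inv_mem (S := n.primeFactors)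
    fun p hp => Nat.prime_of_mem_primeFactors hp
  rw [totient_eq_mul_prod, nuPrimes]
  set Q := ∏ p ∈ n.primeFactors, (1 - 1 / (p : ℝ))
  have h5 : ((n / 2 - n / 4 : ℕ) : ℝ) * ((1 - 1 / (3 : ℕ)) * Q) ≤ (n / 4 + 1) * (2 / 3 * Q) := by
    norm_num
    exact mul_le_mul_of_nonneg_right h4 (by positivity)
  have h6 : (partialTotient 12 1 (3 * n) : ℝ) ≤ sieveCount S 1 (n / 4 + 1 : ℕ) (n / 2 - n / 4) := by
    exact_mod_cast h1
  rw [pow_succ] at h2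
  nlinarith

theorem partialTotient_zero_le {n : ℕ} (hn : 0 < n) :
    (partialTotient 12 0 n : ℝ) ≤ n.totient / 12 + 2 ^ nuPrimes n := by
  have hSp : ∀ p ∈ n.primeFactors, p.Prime := fun p hp => Nat.prime_of_mem_primeFactors hp
  have h1 : partialTotient 12 0 n ≤ sieveCount n.primeFactors 1 0 (n / 12 + 1) := by
    refine card_le_card fun x hx => ?_
    obtain ⟨-, h1, h2, h3⟩ := mem_filter.1 hx
    have h3' : 12 * x < n := by
      push_cast at h3
      have : 12 * (x : ℚ) < n := by linarith
      exact_mod_cast this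
    refine mem_filter.2 ⟨mem_range.2 (by lia), fun p hp => ?_⟩
    rw [one_mul, add_zero]
    exact (coprime_iff_forall_not_dvd (by lia)).1 h1 p hp
  have h2 := sieveCount_le hSp (not_dvd_one_of_prime hSp) 0 (n / 12 + 1)
  have h4 : ((n / 12 + 1 : ℕ) : ℝ) ≤ n / 12 + 1 := by
    have : 12 * (n / 12 + 1) ≤ n + 12 := by lia
    have : (12 : ℝ) * (n / 12 + 1 : ℕ) ≤ n + 12 := by exact_mod_cast this
    linarith
  obtain ⟨hQ0, hQ1⟩ := prod_one_sub_inv_mem hSp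
  rw [totient_eq_mul_prod, nuPrimes]
  have h6 : (partialTotient 12 0 n : ℝ) ≤ sieveCount n.primeFactors 1 0 (n / 12 + 1) := by
    exact_mod_cast h1
  nlinarith

/-- The dimensions used for decompositions into two summands. -/
def twoDims (n : ℕ) : Finset ℕ := {k ∈ range n | 5 ≤ k ∧ k.Coprime n ∧ 2 * k + 9 ≤ n}

theorem mem_twoDims {n k : ℕ} : k ∈ twoDims n ↔ 5 ≤ k ∧ k.Coprime n ∧ 2 * k + 9 ≤ n := by
  rw [twoDims, mem_filter, mem_range]
  exact ⟨fun h => h.2, fun h => ⟨by lia, h⟩⟩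

theorem totient_le_card_twoDims {n : ℕ} (hn : Odd n) (h1 : 1 < n) :
    n.totient ≤ 2 * #(twoDims n) + 16 := by
  set B := twoDims n ∪ (Icc 1 4 ∪ Icc ((n - 7) / 2) ((n - 1) / 2)) with hB
  have hcB : #B ≤ #(twoDims n) + 8 := by
    refine (card_union_le _ _).trans (Nat.add_le_add_left ((card_union_le _ _).trans ?_) _)
    simp only [Nat.card_Icc]
    lia
  have hsub : {k ∈ range n | n.Coprime k} ⊆ B ∪ B.image (fun k => n - k) := by
    have key : ∀ k, k.Coprime n → 2 * k < n → k ∈ B := fun k hk hlt => by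
      by_cases h5 : 5 ≤ k
      · by_cases h9 : 2 * k + 9 ≤ n
        · exact mem_union_left _ (mem_twoDims.2 ⟨h5, hk, h9⟩)
        · exact mem_union_right _ (mem_union_right _ (mem_Icc.2 (by
            obtain ⟨c, rfl⟩ := hn
            lia)))
      · refine mem_union_right _ (mem_union_left _ (mem_Icc.2 ?_))
        rcases k.eq_zero_or_pos with rfl | h0
        · rw [Nat.coprime_zero_left] at hk
          lia
        · lia
    intro k hk
    obtain ⟨hkn, hc⟩ := mem_filter.1 hk
    rw [mem_range] at hkn
    by_cases h : 2 * k < n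
    · exact mem_union_left _ (key k hc.symm h)
    · refine mem_union_right _ (mem_image.2 ⟨n - k, key _ ?_ ?_, by lia⟩)
      · exact (Nat.coprime_self_sub_left hkn.le).2 hc.symm
      · obtain ⟨c, rfl⟩ := hn
        lia
  calc n.totient = #{k ∈ range n | n.Coprime k} := rfl
    _ ≤ #(B ∪ B.image (fun k => n - k)) := card_le_card hsub
    _ ≤ #B + #B := (card_union_le _ _).trans (Nat.add_le_add_left card_image_le _)
    _ ≤ _ := by lia

end CoprimeCount

namespace GLGen

open Finset CoprimeCount FieldSplit

theorem goodKind_inl {n q k : ℕ} (h : k ∈ twoDims n) : GoodKind n q (Sum.inl k) := by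
  obtain ⟨h1, h2, h3⟩ := mem_twoDims.1 h
  exact ⟨h1, h2, h3⟩

theorem disjoint_kindDims_inl {n k k' : ℕ} (h : k ∈ twoDims n) (h' : k' ∈ twoDims n)
    (hne : k ≠ k') : Disjoint (kindDims n (Sum.inl k)) (kindDims n (Sum.inl k')) := by
  obtain ⟨h1, h2, h3⟩ := mem_twoDims.1 h
  obtain ⟨h1', h2', h3'⟩ := mem_twoDims.1 h'
  rw [Finset.disjoint_left]
  simp only [kindDims, mem_insert, mem_singleton]
  lia

theorem card_twoDims_le_kappaIndep {n : ℕ} {F : Type*} [Field F] [Finite F] (h3 : 3 ≤ n)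
    {G : Subgroup (GL (Fin n) F)} (hG : SLinGL n F ≤ G) : #(twoDims n) ≤ kappaIndep G := by
  classical
  rw [← card_image_of_injective _ (Sum.inl_injective (α := ℕ) (β := ℕ × ℕ))]
  refine card_le_kappaIndep h3 hG _ ?_ ?_
  · intro κ hκ
    obtain ⟨k, hk, rfl⟩ := mem_image.1 hκ
    exact goodKind_inl hk
  · intro κ hκ κ' hκ' hne
    obtain ⟨k, hk, rfl⟩ := mem_image.1 hκ
    obtain ⟨k', hk', rfl⟩ := mem_image.1 hκ'
    exact disjoint_kindDims_inl hk hk' fun h => hne (h ▸ rfl)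

end GLGen

namespace CoprimeCount

open Finset

theorem le_card_twoDims_add {n J : ℕ} (hn : Odd n) (h1 : 1 < n) (h3 : ¬ 3 ∣ n)
    (h : (n : ℝ) + 102 + 36 * 2 ^ nuPrimes n + 12 * nuPrimes n ≤ 3 * n.totient + 12 * J) :
    (n + 6) / 12 + partialTotient 12 1 (3 * n) + partialTotient 12 0 n + nuPrimes n ≤
      #(twoDims n) + J := by
  have hX := partialTotient_three_mul_le (by lia) h3
  have hY := partialTotient_zero_le (n := n) (by lia)
  have hD : (n.totient : ℝ) ≤ 2 * #(twoDims n) + 16 := by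
    exact_mod_cast totient_le_card_twoDims hn h1
  have h12 : (((n + 6) / 12 : ℕ) : ℝ) ≤ (n + 6) / 12 := by
    have := Nat.div_mul_le_self (n + 6) 12
    have : (((n + 6) / 12 : ℕ) : ℝ) * 12 ≤ n + 6 := by exact_mod_cast this
    linarith
  have : (((n + 6) / 12 + partialTotient 12 1 (3 * n) + partialTotient 12 0 n + nuPrimes n : ℕ) : ℝ)
      ≤ (#(twoDims n) + J : ℕ) := by
    push_cast
    linarith
  exact_mod_cast this

theorem five_le_of_mem_primeFactors {n p : ℕ} (h6 : Nat.gcd n 6 = 1) (hp : p ∈ n.primeFactors) :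
    5 ≤ p ∧ p % 2 = 1 := by
  have hpp := Nat.prime_of_mem_primeFactors hp
  have hd := Nat.dvd_of_mem_primeFactors hp
  have hndvd : ∀ r, r ∣ 6 → r ≠ 1 → p ≠ r := fun r hr h1 h => by
    subst h
    exact h1 (Nat.dvd_one.1 (h6 ▸ Nat.dvd_gcd hd hr))
  have h2 := hndvd 2 (by norm_num) (by norm_num)
  have h3 := hndvd 3 (by norm_num) (by norm_num)
  have h4 := hpp.two_le
  have h5 := hpp.eq_two_or_odd.resolve_left h2
  lia

theorem prod_le_prod_primeFactors {n : ℕ} (h6 : Nat.gcd n 6 = 1) {f : ℕ → ℝ} (hf : Monotone f)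
    (h0 : ∀ i, 0 ≤ f i) :
    ∏ i ∈ range (nuPrimes n), f i ≤ ∏ p ∈ n.primeFactors, f ((p - 5) / 2) := by
  have hinj : Set.InjOn (fun p => (p - 5) / 2) (n.primeFactors : Set ℕ) := by
    intro p hp p' hp' h
    have h1 := five_le_of_mem_primeFactors h6 hp
    have h2 := five_le_of_mem_primeFactors h6 hp'
    simp only at h
    lia
  have := prod_range_le_prod hf h0 (n.primeFactors.image fun p => (p - 5) / 2)
  rwa [card_image_of_injOn hinj, prod_image hinj] at this

theorem mul_prod_le_totient {n : ℕ} (h6 : Nat.gcd n 6 = 1) :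
    n * ∏ i ∈ range (nuPrimes n), (1 - 1 / (2 * (i : ℝ) + 5)) ≤ n.totient := by
  rw [totient_eq_mul_prod]
  refine mul_le_mul_of_nonneg_left ?_ (Nat.cast_nonneg n)
  refine (prod_le_prod_primeFactors h6 (f := fun i => 1 - 1 / (2 * (i : ℝ) + 5)) ?_ ?_).trans_eq ?_
  · intro i j hij
    have : (i : ℝ) ≤ j := by exact_mod_cast hij
    have := one_div_le_one_div_of_le (by positivity : 0 < 2 * (i : ℝ) + 5)
      (by linarith : 2 * (i : ℝ) + 5 ≤ 2 * (j : ℝ) + 5)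
    simp only
    linarith
  · intro i
    have : 1 / (2 * (i : ℝ) + 5) ≤ 1 := by
      rw [div_le_one (by positivity)]
      have : (0 : ℝ) ≤ i := by positivity
      linarith
    linarith
  · refine prod_congr rfl fun p hp => ?_
    obtain ⟨h1, h2⟩ := five_le_of_mem_primeFactors h6 hp
    have : 2 * ((p - 5) / 2) + 5 = p := by lia
    have h3 : 2 * (((p - 5) / 2 : ℕ) : ℝ) + 5 = p := by exact_mod_cast this
    rw [h3]

theorem prod_le_self {n : ℕ} (h0 : 0 < n) (h6 : Nat.gcd n 6 = 1) :
    ∏ i ∈ range (nuPrimes n), (2 * (i : ℝ) + 5) ≤ n := by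
  refine (prod_le_prod_primeFactors h6 (f := fun i => 2 * (i : ℝ) + 5) ?_ ?_).trans ?_
  · intro i j hij
    have : (i : ℝ) ≤ j := by exact_mod_cast hij
    simp only
    linarith
  · intro i
    positivity
  · have h1 : ∏ p ∈ n.primeFactors, (2 * (((p - 5) / 2 : ℕ) : ℝ) + 5) =
        ((∏ p ∈ n.primeFactors, p : ℕ) : ℝ) := by
      push_cast
      refine prod_congr rfl fun p hp => ?_
      obtain ⟨h1, h2⟩ := five_le_of_mem_primeFactors h6 hp
      have : 2 * ((p - 5) / 2) + 5 = p := by lia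
      exact_mod_cast this
    rw [h1]
    exact_mod_cast Nat.le_of_dvd h0 (Nat.prod_primeFactors_dvd n)

theorem totient_large_of_nu_le {n : ℕ} (h0 : 0 < n) (h6 : Nat.gcd n 6 = 1) (h3 : 3 ≤ nuPrimes n)
    (h13 : nuPrimes n ≤ 13) (h : nuPrimes n = 3 → 520 ≤ n) :
    (n : ℝ) + 102 + 36 * 2 ^ nuPrimes n + 12 * nuPrimes n ≤ 3 * n.totient := by
  have h1 := mul_prod_le_totient h6
  have h2 := prod_le_self h0 h6
  have h' : nuPrimes n = 3 → (520 : ℝ) ≤ n := fun h4 => by exact_mod_cast h h4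
  clear h h6 h0
  generalize (n.totient : ℝ) = t at *
  generalize (n : ℝ) = x at *
  generalize nuPrimes n = ν at *
  interval_cases ν
  · have := h' rfl
    norm_num [prod_range_succ] at *
    linarith
  all_goals
    norm_num [prod_range_succ] at *
    linarith

theorem eq_or_eq_of_lt {n : ℕ} (h0 : 0 < n) (h6 : Nat.gcd n 6 = 1) (h3 : 3 ≤ nuPrimes n)
    (hn : n < 520) : n = 385 ∨ n = 455 := by
  have : ∀ m < 520, 0 < m → Nat.gcd m 6 = 1 → 3 ≤ nuPrimes m → m = 385 ∨ m = 455 := by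
    decide +kernel
  exact this n hn h0 h6 h3

theorem totient_bound_385 : (385 + 6) / 12 + partialTotient 12 1 (3 * 385) + partialTotient 12 0 385
    + nuPrimes 385 ≤ #(twoDims 385) := by
  decide +kernel

theorem totient_bound_455 : (455 + 6) / 12 + partialTotient 12 1 (3 * 455) + partialTotient 12 0 455
    + nuPrimes 455 ≤ #(twoDims 455) := by
  decide +kernel

theorem exists_shift (n : ℕ) (hn : Odd n) (h3 : Nat.gcd n 3 = 1) :
    ∃ h : ℕ, 3 * n ≤ 8 * h + 7 ∧ 8 * h + 1 ≤ 3 * n ∧ Nat.Coprime (2 * h + 1) n := by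
  obtain ⟨m, rfl⟩ := hn
  refine ⟨(3 * (2 * m + 1) - 1) / 8, by lia, by lia, ?_⟩
  set h := (3 * (2 * m + 1) - 1) / 8 with hh
  have hd1 : ∀ d, d ∣ 2 * h + 1 → d ∣ 2 * m + 1 → d ∣ 3 := fun d h1 h2 => by
    have e : (4 * (2 * h + 1) : ℤ) - 3 * (2 * m + 1) = 1 ∨ (4 * (2 * h + 1) : ℤ) - 3 * (2 * m + 1) =
        -1
        ∨ (4 * (2 * h + 1) : ℤ) - 3 * (2 * m + 1) = 3 ∨
          (4 * (2 * h + 1) : ℤ) - 3 * (2 * m + 1) = -3 := by lia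
    have h4 : (d : ℤ) ∣ 4 * (2 * h + 1) - 3 * (2 * m + 1) := by
      refine dvd_sub (Dvd.dvd.mul_left ?_ _) (Dvd.dvd.mul_left ?_ _)
      · exact_mod_cast h1
      · exact_mod_cast h2
    rw [← Int.natCast_dvd_natCast]
    rcases e with e | e | e | e <;> rw [e] at h4
    · exact h4.mul_left 3
    · exact ((dvd_neg.2 h4).mul_left 3).trans (by norm_num)
    · exact h4
    · exact (dvd_neg.2 h4).trans (by norm_num)
  have h1 := hd1 _ (Nat.gcd_dvd_left (2 * h + 1) (2 * m + 1)) (Nat.gcd_dvd_right _ _)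
  have h2 := Nat.dvd_gcd (Nat.gcd_dvd_right (2 * h + 1) (2 * m + 1)) h1
  rw [h3] at h2
  exact Nat.dvd_one.1 h2

/-- Indices for which all block dimensions of the associated three-block shape have a common
factor with `n`. -/
def threeIndex (n h : ℕ) : Finset ℕ :=
  {j ∈ range (19 * n / 200 - 1) | (¬ (2 * (n / 40 + 1 + j) + 1).Coprime n) ∧
    (¬ (h - (n / 40 + 1 + j)).Coprime n) ∧ (¬ (h + (n / 40 + 1 + j) + 1).Coprime n) ∧
    ¬ 2 * (n / 40 + 1 + j) + 1 ∣ 2 * n - (2 * h + 1)}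

/-- The three-block shape attached to an index. -/
def threeShape (n h j : ℕ) : ℕ × ℕ := (2 * (n / 40 + 1 + j) + 1, h - (n / 40 + 1 + j))

end CoprimeCount

namespace GLGen

open Finset CoprimeCount FieldSplit

theorem goodKind_inr {n h q j : ℕ} (hq : 2 ≤ q) (hn : 32000 ≤ n) (h1 : 3 * n ≤ 8 * h + 7)
    (h2 : 8 * h + 1 ≤ 3 * n) (hc : Nat.Coprime (2 * h + 1) n) (hj : j ∈ threeIndex n h) :
    GoodKind n q (Sum.inr (threeShape n h j)) := by
  obtain ⟨hjL, -, -, -, hd⟩ := mem_filter.1 hj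
  rw [mem_range] at hjL
  unfold threeShape
  set i := n / 40 + 1 + j with hi
  have hi1 : n ≤ 40 * i := by lia
  have hi2 : 25 * i ≤ 3 * n := by lia
  clear_value i
  refine ⟨by lia, by lia, by lia, ?_, fun hdv => hd ?_, fun hdv => ?_,
    Zsigmondy.exists_primitive_prime (by lia) hq, Zsigmondy.exists_primitive_prime (by lia) hq⟩
  · refine Nat.Coprime.coprime_dvd_left ?_ hc
    have e : 2 * h + 1 = 2 * i + 1 + 2 * (h - i) := by lia
    rw [e]
    exact dvd_add (Nat.gcd_dvd_left _ _) ((Nat.gcd_dvd_right _ _).mul_left 2)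
  · have e : 2 * n - (2 * h + 1) = 2 * (n - (2 * i + 1 + (h - i))) + (2 * i + 1) := by lia
    rw [e]
    exact dvd_add (hdv.mul_left 2) dvd_rfl
  · obtain ⟨c, hc⟩ := hdv
    rcases c with _ | _ | c
    · lia
    · lia
    · have : (h - i) * (c + 2) = (h - i) * c + 2 * (h - i) := by ring
      have := Nat.zero_le ((h - i) * c)
      lia

theorem disjoint_kindDims_inr {n h j j' : ℕ} (hn : 32000 ≤ n) (h1 : 3 * n ≤ 8 * h + 7)
    (h2 : 8 * h + 1 ≤ 3 * n) (hj : j ∈ threeIndex n h) (hj' : j' ∈ threeIndex n h) (hne : j ≠ j') :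
    Disjoint (kindDims n (Sum.inr (threeShape n h j)))
      (kindDims n (Sum.inr (threeShape n h j'))) := by
  have hjL := mem_range.1 (mem_filter.1 hj).1
  have hjL' := mem_range.1 (mem_filter.1 hj').1
  rw [Finset.disjoint_left]
  simp only [kindDims, threeShape, mem_insert, mem_singleton]
  set i := n / 40 + 1 + j with hi
  set i' := n / 40 + 1 + j' with hi'
  have hi1 : n ≤ 40 * i := by lia
  have hi2 : 25 * i ≤ 3 * n := by lia
  have hi1' : n ≤ 40 * i' := by lia
  have hi2' : 25 * i' ≤ 3 * n := by lia
  have hne' : i ≠ i' := by lia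
  clear_value i i'
  rintro x (rfl | rfl | rfl | rfl | rfl | rfl) <;> lia

theorem disjoint_kindDims_inl_inr {n h j k : ℕ} (hn : 32000 ≤ n) (h1 : 3 * n ≤ 8 * h + 7)
    (h2 : 8 * h + 1 ≤ 3 * n) (hk : k ∈ twoDims n) (hj : j ∈ threeIndex n h) :
    Disjoint (kindDims n (Sum.inl k)) (kindDims n (Sum.inr (threeShape n h j))) := by
  obtain ⟨hjL, ha, hb, hz, -⟩ := mem_filter.1 hj
  rw [mem_range] at hjL
  obtain ⟨-, hkc, hkn⟩ := mem_twoDims.1 hk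
  have hk' : ∀ x ∈ kindDims n (Sum.inl k), x.Coprime n := by
    intro x hx
    simp only [kindDims, mem_insert, mem_singleton] at hx
    rcases hx with rfl | rfl
    · exact hkc
    · exact (Nat.coprime_self_sub_left (by lia)).2 hkc
  have hsub : ∀ x, x ≤ n → ¬ x.Coprime n → ¬ (n - x).Coprime n := fun x hx h h' =>
    h ((Nat.coprime_self_sub_left hx).1 h')
  rw [Finset.disjoint_left]
  intro x hx hx'
  have hxc := hk' x hx
  simp only [kindDims, threeShape, mem_insert, mem_singleton] at hx'
  have ez : 2 * (n / 40 + 1 + j) + 1 + (h - (n / 40 + 1 + j)) = h + (n / 40 + 1 + j) + 1 := by lia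
  rw [ez] at hx'
  rcases hx' with rfl | rfl | rfl | rfl | rfl | rfl
  · exact ha hxc
  · exact hb hxc
  · exact hz hxc
  · exact hsub _ (by lia) ha hxc
  · exact hsub _ (by lia) hb hxc
  · exact hsub _ (by lia) hz hxc

theorem card_add_card_le_kappaIndep {n h : ℕ} {F : Type*} [Field F] [Finite F] (hn : 32000 ≤ n)
    (h1 : 3 * n ≤ 8 * h + 7) (h2 : 8 * h + 1 ≤ 3 * n) (hc : Nat.Coprime (2 * h + 1) n)
    {G : Subgroup (GL (Fin n) F)} (hG : SLinGL n F ≤ G) :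
    #(twoDims n) + #(threeIndex n h) ≤ kappaIndep G := by
  classical
  have hq : 2 ≤ Nat.card F := Finite.one_lt_card
  set I : Finset (ℕ ⊕ ℕ × ℕ) := (twoDims n).image Sum.inl ∪
    (threeIndex n h).image (fun j => Sum.inr (threeShape n h j)) with hI
  have hcard : #I = #(twoDims n) + #(threeIndex n h) := by
    rw [hI, card_union_of_disjoint, card_image_of_injective _ Sum.inl_injective,
      card_image_of_injective]
    · intro j j' h
      have := congrArg Prod.fst (Sum.inr_injective h)
      simp only [threeShape] at this
      lia
    · rw [Finset.disjoint_left]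
      intro x hx hx'
      obtain ⟨_, -, rfl⟩ := mem_image.1 hx
      obtain ⟨_, -, h⟩ := mem_image.1 hx'
      cases h
  rw [← hcard]
  refine card_le_kappaIndep (by lia) hG I ?_ ?_
  · intro κ hκ
    rcases mem_union.1 hκ with hκ | hκ
    · obtain ⟨k, hk, rfl⟩ := mem_image.1 hκ
      exact goodKind_inl hk
    · obtain ⟨j, hj, rfl⟩ := mem_image.1 hκ
      exact goodKind_inr hq hn h1 h2 hc hj
  · intro κ hκ κ' hκ' hne
    rcases mem_union.1 hκ with hκ | hκ <;> rcases mem_union.1 hκ' with hκ' | hκ' <;>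
      obtain ⟨k, hk, rfl⟩ := mem_image.1 hκ <;> obtain ⟨k', hk', rfl⟩ := mem_image.1 hκ'
    · exact disjoint_kindDims_inl hk hk' fun h => hne (h ▸ rfl)
    · exact disjoint_kindDims_inl_inr hn h1 h2 hk hk'
    · exact (disjoint_kindDims_inl_inr hn h1 h2 hk' hk).symm
    · exact disjoint_kindDims_inr hn h1 h2 hk hk' fun h => hne (h ▸ rfl)

end GLGen

namespace CoprimeCount

open Finset

theorem card_filter_dvd_le {n h : ℕ} (hn : 32000 ≤ n) (h1 : 3 * n ≤ 8 * h + 7)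
    (h2 : 8 * h + 1 ≤ 3 * n) :
    #((range (19 * n / 200 - 1)).filter fun j =>
      2 * (n / 40 + 1 + j) + 1 ∣ 2 * n - (2 * h + 1)) ≤ 27 := by
  have hm : ∀ j ∈ (range (19 * n / 200 - 1)).filter fun j =>
      2 * (n / 40 + 1 + j) + 1 ∣ 2 * n - (2 * h + 1),
      (2 * (n / 40 + 1 + j) + 1) * ((2 * n - (2 * h + 1)) / (2 * (n / 40 + 1 + j) + 1)) =
        2 * n - (2 * h + 1) := fun j hj => Nat.mul_div_cancel' (mem_filter.1 hj).2
  rw [← card_range 27]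
  refine card_le_card_of_injOn
    (fun j => (2 * n - (2 * h + 1)) / (2 * (n / 40 + 1 + j) + 1)) ?_ ?_
  · intro j hj
    refine mem_coe.2 (mem_range.2 ?_)
    rw [Nat.div_lt_iff_lt_mul (by lia)]
    lia
  · intro j hj j' hj' hjj
    have e := hm j hj
    have e' := hm j' hj'
    simp only at hjj
    rw [hjj] at e
    have h0 : 0 < (2 * n - (2 * h + 1)) / (2 * (n / 40 + 1 + j') + 1) := by
      rw [Nat.pos_iff_ne_zero]
      intro h0
      rw [h0] at e'
      lia
    have := Nat.eq_of_mul_eq_mul_right h0 (e.trans e'.symm)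
    lia

theorem le_card_threeIndex_add {n h : ℕ} (hn : 32000 ≤ n) (h1 : 3 * n ≤ 8 * h + 7)
    (h2 : 8 * h + 1 ≤ 3 * n) :
    19 * n / 200 - 1 ≤ #(threeIndex n h) +
      (sieveCount n.primeFactors 2 (2 * (n / 40 + 1 : ℕ) + 1) (19 * n / 200 - 1) +
      sieveCount n.primeFactors (-1) (h - (n / 40 + 1 : ℕ)) (19 * n / 200 - 1) +
      sieveCount n.primeFactors 1 (h + (n / 40 + 1 : ℕ) + 1) (19 * n / 200 - 1)) + 27 := by
  classical
  have hs : range (19 * n / 200 - 1) ⊆ threeIndex n h ∪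
      (((range (19 * n / 200 - 1)).filter (fun j : ℕ => ∀ p ∈ n.primeFactors,
        ¬ (p : ℤ) ∣ 2 * j + (2 * (n / 40 + 1 : ℕ) + 1)) ∪
      (range (19 * n / 200 - 1)).filter (fun j : ℕ => ∀ p ∈ n.primeFactors,
        ¬ (p : ℤ) ∣ -1 * j + (h - (n / 40 + 1 : ℕ)))) ∪
      (range (19 * n / 200 - 1)).filter (fun j : ℕ => ∀ p ∈ n.primeFactors,
        ¬ (p : ℤ) ∣ 1 * j + (h + (n / 40 + 1 : ℕ) + 1))) ∪
      (range (19 * n / 200 - 1)).filter fun j =>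
        2 * (n / 40 + 1 + j) + 1 ∣ 2 * n - (2 * h + 1) := by
    intro j hj
    have hjL := mem_range.1 hj
    have e1 : ((2 * (n / 40 + 1 + j) + 1 : ℕ) : ℤ) = 2 * j + (2 * (n / 40 + 1 : ℕ) + 1) := by
      push_cast; ring
    have e2 : ((h - (n / 40 + 1 + j) : ℕ) : ℤ) = -1 * j + (h - (n / 40 + 1 : ℕ)) := by
      rw [Nat.cast_sub (by lia)]
      push_cast; ring
    have e3 : ((h + (n / 40 + 1 + j) + 1 : ℕ) : ℤ) = 1 * j + (h + (n / 40 + 1 : ℕ) + 1) := by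
      push_cast; ring
    simp only [threeIndex, mem_union, mem_filter, coprime_iff_forall_not_dvd (by lia : n ≠ 0), hj,
      true_and, ← e1, ← e2, ← e3]
    tauto
  have h3 := card_le_card hs
  rw [card_range] at h3
  refine h3.trans ((card_union_le _ _).trans ?_)
  refine add_le_add ((card_union_le _ _).trans (Nat.add_le_add_left ?_ _))
    (card_filter_dvd_le hn h1 h2)
  exact (card_union_le _ _).trans (Nat.add_le_add_right (card_union_le _ _) _)

theorem card_threeIndex_ge_of_sieve {n h : ℕ} (h6 : Nat.gcd n 6 = 1) (hn : 32000 ≤ n)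
    (h1 : 3 * n ≤ 8 * h + 7) (h2 : 8 * h + 1 ≤ 3 * n) (hD : (3 : ℝ) * n.totient ≤ n) :
    (19 / 200 : ℝ) * (n - 3 * n.totient) - 29 - 3 * 2 ^ nuPrimes n ≤ #(threeIndex n h) := by
  have hSp : ∀ p ∈ n.primeFactors, p.Prime := fun p hp => Nat.prime_of_mem_primeFactors hp
  have hone := not_dvd_one_of_prime hSp
  have h3 := le_card_threeIndex_add hn h1 h2
  have s1 := sieveCount_le hSp (u := 2) (fun p hp h => by
    have h5 := (five_le_of_mem_primeFactors h6 hp).1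
    have := Int.le_of_dvd (by norm_num) h
    lia) (2 * (n / 40 + 1 : ℕ) + 1) (19 * n / 200 - 1)
  have s2 := sieveCount_le hSp (u := -1) (fun p hp h => hone p hp (by simpa using h))
    (h - (n / 40 + 1 : ℕ)) (19 * n / 200 - 1)
  have s3 := sieveCount_le hSp (u := 1) hone (h + (n / 40 + 1 : ℕ) + 1) (19 * n / 200 - 1)
  have h3' : ((19 * n / 200 - 1 : ℕ) : ℝ) ≤ #(threeIndex n h) +
      (sieveCount n.primeFactors 2 (2 * (n / 40 + 1 : ℕ) + 1) (19 * n / 200 - 1) +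
      sieveCount n.primeFactors (-1) (h - (n / 40 + 1 : ℕ)) (19 * n / 200 - 1) +
      sieveCount n.primeFactors 1 (h + (n / 40 + 1 : ℕ) + 1) (19 * n / 200 - 1)) + 27 := by
    exact_mod_cast h3
  rw [totient_eq_mul_prod] at hD ⊢
  obtain ⟨hQ0, hQ1⟩ := prod_one_sub_inv_mem hSp
  set Q := ∏ p ∈ n.primeFactors, (1 - 1 / (p : ℝ))
  have hn0 : (0 : ℝ) < n := by exact_mod_cast (by lia : 0 < n)
  have hQ3 : 3 * Q ≤ 1 := by
    by_contra! hc
    nlinarith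
  have hL : (19 / 200 : ℝ) * n - 2 ≤ (19 * n / 200 - 1 : ℕ) := by
    have : 19 * n ≤ 200 * (19 * n / 200 - 1) + 400 := by lia
    have : (19 : ℝ) * n ≤ 200 * (19 * n / 200 - 1 : ℕ) + 400 := by exact_mod_cast this
    linarith
  have hm := mul_le_mul_of_nonneg_right hL (by linarith : 0 ≤ 1 - 3 * Q)
  have he : (2 : ℝ) ^ nuPrimes n = 2 ^ #n.primeFactors := rfl
  rw [he]
  nlinarith

theorem exists_common_residue {n : ℕ} (h6 : Nat.gcd n 6 = 1) {p₁ p₂ p₃ : ℕ}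
    (hp₁ : p₁ ∈ n.primeFactors) (hp₂ : p₂ ∈ n.primeFactors) (hp₃ : p₃ ∈ n.primeFactors)
    (h12 : p₁ ≠ p₂) (h13 : p₁ ≠ p₃) (h23 : p₂ ≠ p₃) (v₁ v₂ v₃ : ℤ) :
    ∃ c : ℕ, c < p₁ * p₂ * p₃ ∧ ∀ k : ℕ, (p₁ : ℤ) ∣ 2 * (c + p₁ * p₂ * p₃ * k : ℕ) + v₁ ∧
      (p₂ : ℤ) ∣ -1 * (c + p₁ * p₂ * p₃ * k : ℕ) + v₂ ∧
      (p₃ : ℤ) ∣ 1 * (c + p₁ * p₂ * p₃ * k : ℕ) + v₃ := by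
  have hSp : ∀ p ∈ n.primeFactors, p.Prime := fun p hp => Nat.prime_of_mem_primeFactors hp
  have hone := not_dvd_one_of_prime hSp
  obtain ⟨c₁, -, h1⟩ := exists_dvd_mul_add (hSp _ hp₁) (u := 2) (fun h => by
    have h5 := (five_le_of_mem_primeFactors h6 hp₁).1
    have := Int.le_of_dvd (by norm_num) h
    lia) v₁
  obtain ⟨c₂, -, h2⟩ := exists_dvd_mul_add (hSp _ hp₂) (u := -1)
    (fun h => hone _ hp₂ (by simpa using h)) v₂
  obtain ⟨c₃, -, h3⟩ := exists_dvd_mul_add (hSp _ hp₃) (u := 1) (hone _ hp₃) v₃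
  have co12 : p₁.Coprime p₂ := (Nat.coprime_primes (hSp _ hp₁) (hSp _ hp₂)).2 h12
  have co13 : p₁.Coprime p₃ := (Nat.coprime_primes (hSp _ hp₁) (hSp _ hp₃)).2 h13
  have co23 : p₂.Coprime p₃ := (Nat.coprime_primes (hSp _ hp₂) (hSp _ hp₃)).2 h23
  obtain ⟨d, hd1, hd2⟩ := Nat.chineseRemainder co12 c₁ c₂
  obtain ⟨e, he1, he2⟩ := Nat.chineseRemainder (co13.mul_left co23) d c₃
  have hpos : 0 < p₁ * p₂ * p₃ := Nat.mul_pos (Nat.mul_pos (hSp _ hp₁).pos (hSp _ hp₂).pos)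
    (hSp _ hp₃).pos
  refine ⟨e % (p₁ * p₂ * p₃), Nat.mod_lt _ hpos, fun k => ?_⟩
  have hx : ∀ p, p ∣ p₁ * p₂ * p₃ → ∀ c, e ≡ c [MOD p] → ∀ u v : ℤ, (p : ℤ) ∣ u * c + v →
      (p : ℤ) ∣ u * (e % (p₁ * p₂ * p₃) + p₁ * p₂ * p₃ * k : ℕ) + v := by
    intro p hp c hec u v hdv
    have h4 : e % (p₁ * p₂ * p₃) + p₁ * p₂ * p₃ * k ≡ c [MOD p] := by
      refine Nat.ModEq.trans ?_ hec
      have h5 : e % (p₁ * p₂ * p₃) ≡ e [MOD p] := (Nat.mod_modEq _ _).of_dvd hp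
      have h6 : p₁ * p₂ * p₃ * k ≡ 0 [MOD p] :=
        (Nat.modEq_zero_iff_dvd).2 (hp.mul_right k)
      exact (h5.add h6).trans (by rw [add_zero])
    have h5 := (Nat.modEq_iff_dvd.1 h4.symm)
    have h7 := dvd_add (h5.mul_left u) hdv
    rwa [show u * (((e % (p₁ * p₂ * p₃) + p₁ * p₂ * p₃ * k : ℕ) : ℤ) - c) + (u * c + v) =
      u * (e % (p₁ * p₂ * p₃) + p₁ * p₂ * p₃ * k : ℕ) + v by ring] at h7
  refine ⟨hx _ ⟨p₂ * p₃, by ring⟩ c₁ ?_ _ _ h1, hx _ ⟨p₁ * p₃, by ring⟩ c₂ ?_ _ _ h2,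
    hx _ ⟨p₁ * p₂, by ring⟩ c₃ he2 _ _ h3⟩
  · exact (he1.of_dvd (dvd_mul_right _ _)).trans hd1
  · exact (he1.of_dvd (dvd_mul_left _ _)).trans hd2

theorem card_threeIndex_ge_of_residue {n h : ℕ} (h6 : Nat.gcd n 6 = 1) (hn : 32000 ≤ n)
    (h1 : 3 * n ≤ 8 * h + 7) (h2 : 8 * h + 1 ≤ 3 * n) (hν : 3 ≤ nuPrimes n) :
    (19 / 200 : ℝ) * 5 ^ (nuPrimes n - 3) - 29 ≤ #(threeIndex n h) := by
  classical
  obtain ⟨P, hPs, hP⟩ := exists_subset_card_eq hν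
  obtain ⟨p₁, p₂, p₃, h12, h13, h23, rfl⟩ := card_eq_three.1 hP
  have hp₁ : p₁ ∈ n.primeFactors := hPs (by simp)
  have hp₂ : p₂ ∈ n.primeFactors := hPs (by simp)
  have hp₃ : p₃ ∈ n.primeFactors := hPs (by simp)
  obtain ⟨c, hcM, hc⟩ := exists_common_residue h6 hp₁ hp₂ hp₃ h12 h13 h23
    (2 * (n / 40 + 1 : ℕ) + 1) (h - (n / 40 + 1 : ℕ)) (h + (n / 40 + 1 : ℕ) + 1)
  have hprod : p₁ * p₂ * p₃ * 5 ^ (nuPrimes n - 3) ≤ n := by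
    have e := prod_sdiff hPs (f := fun p : ℕ => p)
    have h3 : ∏ p ∈ {p₁, p₂, p₃}, p = p₁ * p₂ * p₃ := by
      rw [prod_insert (by simp [h12, h13]), prod_insert (by simpa using h23), prod_singleton,
        mul_assoc]
    have h4 : 5 ^ (nuPrimes n - 3) ≤ ∏ p ∈ n.primeFactors \ {p₁, p₂, p₃}, p := by
      have h5 := pow_card_le_prod (n.primeFactors \ {p₁, p₂, p₃}) (fun p => p) 5
        fun p hp => (five_le_of_mem_primeFactors h6 (mem_sdiff.1 hp).1).1
      rwa [card_sdiff_of_subset hPs, hP] at h5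
    have h5 := Nat.le_of_dvd (by lia : 0 < n) (Nat.prod_primeFactors_dvd n)
    rw [← e, h3] at h5
    rw [mul_comm]
    exact (Nat.mul_le_mul_right _ h4).trans h5
  set M := p₁ * p₂ * p₃ with hM
  set L := 19 * n / 200 - 1 with hL
  have hM0 : 0 < M := by lia
  set K := (L - c + (M - 1)) / M with hK
  have hKlt : ∀ k, k < K → c + M * k < L := fun k hk => by
    have h7 : M * K ≤ L - c + (M - 1) := Nat.mul_div_le _ _
    have h8 : M * (k + 1) ≤ M * K := Nat.mul_le_mul_left _ hk
    rw [mul_add] at h8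
    lia
  have hsub : (range K).image (fun k => c + M * k) ⊆ threeIndex n h ∪
      (range L).filter fun j => 2 * (n / 40 + 1 + j) + 1 ∣ 2 * n - (2 * h + 1) := by
    intro j hj
    obtain ⟨k, hk, rfl⟩ := mem_image.1 hj
    have hjL := hKlt k (mem_range.1 hk)
    obtain ⟨d1, d2, d3⟩ := hc k
    set j := c + M * k with hj'
    have e1 : ((2 * (n / 40 + 1 + j) + 1 : ℕ) : ℤ) = 2 * j + (2 * (n / 40 + 1 : ℕ) + 1) := by
      push_cast; ring
    have e2 : ((h - (n / 40 + 1 + j) : ℕ) : ℤ) = -1 * j + (h - (n / 40 + 1 : ℕ)) := by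
      rw [Nat.cast_sub (by lia)]
      push_cast; ring
    have e3 : ((h + (n / 40 + 1 + j) + 1 : ℕ) : ℤ) = 1 * j + (h + (n / 40 + 1 : ℕ) + 1) := by
      push_cast; ring
    rw [← e1] at d1
    rw [← e2] at d2
    rw [← e3] at d3
    have hn0 : n ≠ 0 := by lia
    by_cases hd : 2 * (n / 40 + 1 + j) + 1 ∣ 2 * n - (2 * h + 1)
    · exact mem_union_right _ (mem_filter.2 ⟨mem_range.2 hjL, hd⟩)
    · exact mem_union_left _ (mem_filter.2 ⟨mem_range.2 hjL,
        fun hcop => (coprime_iff_forall_not_dvd hn0).1 hcop p₁ hp₁ d1,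
        fun hcop => (coprime_iff_forall_not_dvd hn0).1 hcop p₂ hp₂ d2,
        fun hcop => (coprime_iff_forall_not_dvd hn0).1 hcop p₃ hp₃ d3, hd⟩)
  have hcard := (card_le_card hsub).trans ((card_union_le _ _).trans
    (Nat.add_le_add_left (card_filter_dvd_le hn h1 h2) _))
  rw [card_image_of_injective _ (fun k k' hkk => Nat.eq_of_mul_eq_mul_left hM0
    (Nat.add_left_cancel hkk)), card_range] at hcard
  have hKL : L ≤ M * K + M := by
    have := Nat.lt_mul_div_succ (L - c + (M - 1)) hM0
    rw [← hK, mul_add] at this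
    lia
  have hKL' : (19 / 200 : ℝ) * n - 2 ≤ M * K + M := by
    have h3 : 19 * n ≤ 200 * L + 400 := by lia
    have h3' : (19 : ℝ) * n ≤ 200 * L + 400 := by exact_mod_cast h3
    have h4 : (L : ℝ) ≤ M * K + M := by exact_mod_cast hKL
    linarith
  have hprod' : (M : ℝ) * 5 ^ (nuPrimes n - 3) ≤ n := by exact_mod_cast hprod
  have hcard' : (K : ℝ) ≤ #(threeIndex n h) + 27 := by exact_mod_cast hcard
  have hM2 : (2 : ℝ) ≤ M := by
    have := (hKlt 0)
    have h5 := (five_le_of_mem_primeFactors h6 hp₁).1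
    have : p₁ ≤ M := by
      rw [hM, mul_assoc]
      exact Nat.le_mul_of_pos_right _ (Nat.mul_pos (Nat.pos_of_mem_primeFactors hp₂)
        (Nat.pos_of_mem_primeFactors hp₃))
    exact_mod_cast (by lia : 2 ≤ M)
  have hfin : (M : ℝ) * ((19 / 200) * 5 ^ (nuPrimes n - 3)) ≤ M * (K + 2) := by
    nlinarith
  have := le_of_mul_le_mul_left hfin (by linarith)
  linarith

theorem two_pow_bounds {ν : ℕ} (h : 14 ≤ ν) :
    12 * (ν : ℝ) ≤ 2 ^ ν ∧ (16384 : ℝ) ≤ 2 ^ ν ∧ (650 : ℝ) * 2 ^ ν ≤ 5 ^ (ν - 3) := by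
  induction ν, h using Nat.le_induction with
  | base => norm_num
  | succ ν h ih =>
    obtain ⟨h1, h2, h3⟩ := ih
    rw [show ν + 1 - 3 = ν - 3 + 1 by lia, pow_succ, pow_succ]
    push_cast
    refine ⟨?_, ?_, ?_⟩ <;> linarith

theorem le_of_fourteen_le_nuPrimes {n : ℕ} (h0 : 0 < n) (h6 : Nat.gcd n 6 = 1)
    (h : 14 ≤ nuPrimes n) : 32000 ≤ n := by
  have h1 : 5 ^ nuPrimes n ≤ n :=
    (pow_card_le_prod _ _ _ fun p hp => (five_le_of_mem_primeFactors h6 hp).1).trans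
      (Nat.le_of_dvd h0 (Nat.prod_primeFactors_dvd n))
  have h2 : 5 ^ 14 ≤ 5 ^ nuPrimes n := Nat.pow_le_pow_right (by norm_num) h
  lia

theorem totient_add_card_threeIndex_large {n h : ℕ} (h6 : Nat.gcd n 6 = 1)
    (hν : 14 ≤ nuPrimes n) (hn : 32000 ≤ n) (h1 : 3 * n ≤ 8 * h + 7) (h2 : 8 * h + 1 ≤ 3 * n) :
    (n : ℝ) + 102 + 36 * 2 ^ nuPrimes n + 12 * nuPrimes n ≤
      3 * n.totient + 12 * #(threeIndex n h) := by
  obtain ⟨e1, e2, e3⟩ := two_pow_bounds hν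
  rcases le_total ((n : ℝ) - 3 * n.totient) (700 * 2 ^ nuPrimes n) with hD | hD
  · have := card_threeIndex_ge_of_residue h6 hn h1 h2 (by lia)
    linarith
  · have := card_threeIndex_ge_of_sieve h6 hn h1 h2 (by linarith)
    linarith

end CoprimeCount

theorem second_lower_bound_for_kappa_coprime_six
    (n q : ℕ) (hν : 3 ≤ nuPrimes n)
    (hn : ¬ ∃ p : ℕ, p.Prime ∧ (n = 6 * p ∨ n = 10 * p))
    (h6 : Nat.gcd n 6 = 1) (hq : IsPrimePow q)
    (F : Type*) [Field F] [Fintype F] (hF : Fintype.card F = q)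
    (G : Subgroup (GL (Fin n) F)) (hG : SLinGL n F ≤ G) :
    (n + 6) / 12 + partialTotient 12 1 (3 * n) + partialTotient 12 0 n + nuPrimes n
      ≤ kappaIndep G := by
  have h0 : 0 < n := Nat.pos_of_ne_zero fun h => by simp [h] at h6
  have h2 : Odd n := by
    rw [← Nat.coprime_two_right]
    exact Nat.Coprime.coprime_dvd_right (by norm_num : 2 ∣ 6) h6
  have h3 : Nat.Coprime n 3 := Nat.Coprime.coprime_dvd_right (by norm_num : 3 ∣ 6) h6
  have h3' : ¬ 3 ∣ n := fun h => by
    have := Nat.Coprime.eq_one_of_dvd h3.symm h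
    lia
  have hn1 : 1 < n := by
    rcases Nat.lt_or_ge 1 n with h | h
    · exact h
    · obtain rfl : n = 1 := by lia
      simp [nuPrimes] at hν
  have htwo := GLGen.card_twoDims_le_kappaIndep (by obtain ⟨k, rfl⟩ := h2; lia) hG
  rcases Nat.lt_or_ge n 520 with hlt | hge
  · rcases CoprimeCount.eq_or_eq_of_lt h0 h6 hν hlt with rfl | rfl
    · exact CoprimeCount.totient_bound_385.trans htwo
    · exact CoprimeCount.totient_bound_455.trans htwo
  rcases Nat.lt_or_ge 13 (nuPrimes n) with hlarge | hsmall
  · obtain ⟨h, e1, e2, hc⟩ := CoprimeCount.exists_shift n h2 h3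
    have hbig := CoprimeCount.le_of_fourteen_le_nuPrimes h0 h6 hlarge
    exact (CoprimeCount.le_card_twoDims_add h2 hn1 h3'
      (CoprimeCount.totient_add_card_threeIndex_large h6 hlarge hbig e1 e2)).trans
      (GLGen.card_add_card_le_kappaIndep hbig e1 e2 hc hG)
  · refine (CoprimeCount.le_card_twoDims_add (J := 0) h2 hn1 h3' ?_).trans htwo
    simpa using CoprimeCount.totient_large_of_nu_le h0 h6 hν hsmall fun _ => hge
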